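/- arXiv:1309.6267 — 2 statements merged into one kernel-verified Lean document; each statement's English description precedes it below -/
import Mathlib

section
/- Suppose h belongs to ℛ (i.e. Case 1 or Case 2 holds) and q satisfies the corresponding tail condition. For α ∈ ℕ define Ψ(t,α) := ∫₀^∞ (x − x̂)^α e^{tx} p(x) dx and T₁(t,α) := ∫_{−L(t)^{1/3}/√2}^{L(t)^{1/3}/√2} y^α e^{−y²/2} dy − (h''(x̂) σ̂³/6) ∫_{−L(t)^{1/3}/√2}^{L(t)^{1/3}/√2} y^{3+α} e^{−y²/2} dy, where L(t) := (log t)³. Then for every α ∈ ℕ, Ψ(t,α) = σ̂^{α+1} e^{K(x̂,t)} T₁(t,α) (1 + o(1)) as t → ∞. -/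
open Real Filter MeasureTheory Set ProbabilityTheory Asymptotics

noncomputable section

/-- `f` is regularly varying at infinity with index `α`: `f` is eventually positive and
`f (λ t) / f t → λ ^ α` as `t → ∞` for every `λ > 0`. -/
def RegVary (α : ℝ) (f : ℝ → ℝ) : Prop :=
  (∀ᶠ x in atTop, 0 < f x) ∧
  ∀ lam : ℝ, 0 < lam →
    Tendsto (fun t => f (lam * t) / f t) atTop (nhds (lam ^ α))

/-- Case 1 (the regularly varying case) for the function `h = g'`:
`h x = c x^β exp (∫₁^x ε(u)/u du)` with `β > 0`, `c > 0`, `ε` twice differentiable with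
`ε(x) → 0`, `x ε'(x) = O(1)`, `x² ε''(x) = O(1)`, and `|h''| ∈ RV(θ)` for some `θ ≤ β - 2`. -/
structure Case1 (h : ℝ → ℝ) (β c θ : ℝ) (ε : ℝ → ℝ) : Prop where
  beta_pos : 0 < β
  c_pos : 0 < c
  h_eq : ∀ x ≥ (1:ℝ), h x = c * x ^ β * Real.exp (∫ u in (1:ℝ)..x, ε u / u)
  eps_diff : ∀ x ≥ (1:ℝ), DifferentiableAt ℝ ε x
  eps_diff2 : ∀ x ≥ (1:ℝ), DifferentiableAt ℝ (deriv ε) x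
  eps_to_zero : Tendsto ε atTop (nhds 0)
  eps_deriv_bigO : (fun x => x * deriv ε x) =O[atTop] (fun _ => (1:ℝ))
  eps_deriv2_bigO : (fun x => x ^ 2 * deriv (deriv ε) x) =O[atTop] (fun _ => (1:ℝ))
  h2_RV : RegVary θ (fun x => |deriv (deriv h) x|)
  theta_le : θ ≤ β - 2

/-- Case 2 (the rapidly varying case), stated through `ψ = h⁻¹`:
`ψ t = c exp (∫₁^t ε(u)/u du)` with `c > 0`, `ε` twice differentiable with `ε(t) → 0`,
`t ε'(t)/ε(t) → 0` and `t² ε''(t)/ε(t) → 0`. -/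
structure Case2 (ψ : ℝ → ℝ) (c : ℝ) (ε : ℝ → ℝ) : Prop where
  c_pos : 0 < c
  psi_eq : ∀ t ≥ (1:ℝ), ψ t = c * Real.exp (∫ u in (1:ℝ)..t, ε u / u)
  eps_diff : ∀ t ≥ (1:ℝ), DifferentiableAt ℝ ε t
  eps_diff2 : ∀ t ≥ (1:ℝ), DifferentiableAt ℝ (deriv ε) t
  eps_to_zero : Tendsto ε atTop (nhds 0)
  eps_ratio1 : Tendsto (fun t => t * deriv ε t / ε t) atTop (nhds 0)
  eps_ratio2 : Tendsto (fun t => t ^ 2 * deriv (deriv ε) t / ε t) atTop (nhds 0)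

/-- The truncated Gaussian moment `∫_{-l}^{l} y^k e^{-y²/2} dy`. -/
def truncMoment (k : ℕ) (l : ℝ) : ℝ := ∫ y in (-l)..l, y ^ k * Real.exp (-(y ^ 2) / 2)

lemma truncMoment_of_odd {k : ℕ} (hk : Odd k) (l : ℝ) : truncMoment k l = 0 := by
  have h := intervalIntegral.integral_comp_neg (a := -l) (b := l)
    (fun y : ℝ => y ^ k * Real.exp (-(y ^ 2) / 2))
  simp only [hk.neg_pow, neg_mul, intervalIntegral.integral_neg, even_two.neg_pow, neg_neg] at h
  unfold truncMoment
  linarith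

lemma truncMoment_one_pos {k : ℕ} (hk : Even k) : 0 < truncMoment k 1 := by
  refine intervalIntegral.integral_pos (by norm_num) (by fun_prop) (fun y _ => ?_)
    ⟨1, by norm_num, by positivity⟩
  have := hk.pow_nonneg y
  positivity

lemma truncMoment_mono {k : ℕ} (hk : Even k) {l : ℝ} (hl : 1 ≤ l) :
    truncMoment k 1 ≤ truncMoment k l := by
  refine intervalIntegral.integral_mono_interval (by linarith) (by norm_num) hl
    (Eventually.of_forall fun y => ?_) (Continuous.intervalIntegrable (by fun_prop) _ _)
  have := hk.pow_nonneg y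
  exact mul_nonneg this (Real.exp_pos _).le

/-- The main term `G_a - κ/6 G_{3+a}` is bounded below by a fixed multiple of `|κ|`. -/
lemma exists_mul_abs_le_mainTerm (a : ℕ) : ∃ c > (0 : ℝ), ∀ l κ : ℝ, 1 ≤ l → |κ| ≤ 1 →
    c * |κ| ≤ |truncMoment a l - κ / 6 * truncMoment (3 + a) l| := by
  rcases Nat.even_or_odd a with ha | ha
  · refine ⟨truncMoment a 1, truncMoment_one_pos ha, fun l κ hl hκ => ?_⟩
    have h3 : Odd (3 + a) := Odd.add_even (by decide) ha
    rw [truncMoment_of_odd h3, mul_zero, sub_zero]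
    have h1 := truncMoment_one_pos ha
    have h2 := truncMoment_mono ha hl
    calc _ ≤ truncMoment a 1 * 1 := by gcongr
      _ ≤ truncMoment a l := by linarith
      _ ≤ _ := le_abs_self _
  · have h3 : Even (3 + a) := Odd.add_odd (by decide) ha
    refine ⟨truncMoment (3 + a) 1 / 6, by have := truncMoment_one_pos h3; positivity,
      fun l κ hl _ => ?_⟩
    have h1 := truncMoment_one_pos h3
    have h2 := truncMoment_mono h3 hl
    rw [truncMoment_of_odd ha, zero_sub, abs_neg, abs_mul, abs_div,
      abs_of_pos (h1.trans_le h2), abs_of_pos (by norm_num : (0 : ℝ) < 6)]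
    have : 0 ≤ |κ| := abs_nonneg κ
    nlinarith

lemma integrable_abs_pow_mul_exp_neg_sq (k : ℕ) :
    Integrable (fun y : ℝ => |y| ^ k * Real.exp (-(y ^ 2) / 2)) := by
  have h := (integrable_rpow_mul_exp_neg_mul_sq (b := 1 / 2) (by norm_num)
    (s := (k : ℝ)) (by have : (0 : ℝ) ≤ k := k.cast_nonneg
                       linarith)).norm
  refine h.congr (Eventually.of_forall fun y => ?_)
  simp only [Real.rpow_natCast, norm_mul, norm_pow, Real.norm_eq_abs, Real.abs_exp]
  ring_nf

lemma integrable_abs_pow_mul_exp_neg_abs (k : ℕ) :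
    Integrable (fun y : ℝ => |y| ^ k * Real.exp (-(|y| / 8))) := by
  have h1 : IntegrableOn (fun y : ℝ => y ^ k * Real.exp (-(y / 8))) (Ioi 0) := by
    have := integrableOn_rpow_mul_exp_neg_mul_rpow (p := 1) (s := (k : ℝ)) (b := 1 / 8)
      (by have : (0 : ℝ) ≤ k := k.cast_nonneg
          linarith) (by norm_num) (by norm_num)
    refine this.congr_fun (fun y _ => ?_) measurableSet_Ioi
    simp only [Real.rpow_natCast, Real.rpow_one]
    ring_nf
  have h2 := (integrable_fun_norm_addHaar (E := ℝ) volume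
    (f := fun y => y ^ k * Real.exp (-(y / 8)))).mpr (by simpa using h1)
  simpa using h2

/-- Comparison of `∫ y^a E(y) dy` with the main term, when `E` is close to
`e^{-y²/2}(1 - κy³/6)` on `[-l, l]` and exponentially small outside. -/
lemma exists_moment_sub_mainTerm_le (a : ℕ) : ∃ C > (0 : ℝ), ∀ (E : ℝ → ℝ) (l κ δ D : ℝ),
    1 ≤ l → 0 ≤ δ → 0 ≤ D → Measurable E →
    (∀ y, |y| ≤ l → |E y - Real.exp (-(y ^ 2) / 2) * (1 - κ * y ^ 3 / 6)| ≤
      δ * (1 + |y| ^ 3) * Real.exp (-(y ^ 2) / 2)) →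
    (∀ y, l < |y| → |E y| ≤ D * Real.exp (-(l / 4 * |y|))) →
    |(∫ y, y ^ a * E y) - (truncMoment a l - κ / 6 * truncMoment (3 + a) l)| ≤
      C * (δ + D * Real.exp (-(l ^ 2 / 8))) := by
  set B₁ : ℝ → ℝ := fun y => |y| ^ a * Real.exp (-(y ^ 2) / 2) +
    |y| ^ (a + 3) * Real.exp (-(y ^ 2) / 2) with hB₁
  set B₂ : ℝ → ℝ := fun y => |y| ^ a * Real.exp (-(|y| / 8)) with hB₂
  have hB₁i : Integrable B₁ :=
    (integrable_abs_pow_mul_exp_neg_sq a).add (integrable_abs_pow_mul_exp_neg_sq (a + 3))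
  have hB₂i : Integrable B₂ := integrable_abs_pow_mul_exp_neg_abs a
  have h1 : 0 ≤ ∫ y, B₁ y := integral_nonneg fun y => by positivity
  have h2 : 0 ≤ ∫ y, B₂ y := integral_nonneg fun y => by positivity
  refine ⟨(∫ y, B₁ y) + (∫ y, B₂ y) + 1, by linarith, fun E l κ δ D hl hδ hD hE hw ht => ?_⟩
  set E₀ : ℝ → ℝ := (Icc (-l) l).indicator
    (fun y => y ^ a * (Real.exp (-(y ^ 2) / 2) * (1 - κ * y ^ 3 / 6))) with hE₀
  have hE₀i : Integrable E₀ := by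
    rw [hE₀, integrable_indicator_iff measurableSet_Icc]
    exact Continuous.integrableOn_Icc (by fun_prop)
  have hE₀v : ∫ y, E₀ y = truncMoment a l - κ / 6 * truncMoment (3 + a) l := by
    rw [hE₀, integral_indicator measurableSet_Icc, integral_Icc_eq_integral_Ioc,
      ← intervalIntegral.integral_of_le (by linarith), truncMoment, truncMoment,
      ← intervalIntegral.integral_const_mul, ← intervalIntegral.integral_sub
        (Continuous.intervalIntegrable (by fun_prop) _ _)
        (Continuous.intervalIntegrable (by fun_prop) _ _)]
    congr 1
    ext y
    ring
  have hbound : ∀ y, ‖y ^ a * E y - E₀ y‖ ≤ δ * B₁ y + D * Real.exp (-(l ^ 2 / 8)) * B₂ y := by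
    intro y
    rw [Real.norm_eq_abs]
    by_cases hy : |y| ≤ l
    · have hmem : y ∈ Icc (-l) l := abs_le.mp hy
      rw [hE₀, indicator_of_mem hmem, ← mul_sub, abs_mul, abs_pow]
      have : 0 ≤ D * Real.exp (-(l ^ 2 / 8)) * B₂ y := by positivity
      calc _ ≤ |y| ^ a * (δ * (1 + |y| ^ 3) * Real.exp (-(y ^ 2) / 2)) := by
            gcongr; exact hw y hy
        _ = δ * B₁ y := by simp only [hB₁]; ring
        _ ≤ _ := by linarith
    · have hmem : y ∉ Icc (-l) l := fun h => hy (abs_le.mpr h)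
      push Not at hy
      rw [hE₀, indicator_of_notMem hmem, sub_zero, abs_mul, abs_pow]
      have : 0 ≤ δ * B₁ y := by positivity
      calc _ ≤ |y| ^ a * (D * Real.exp (-(l / 4 * |y|))) := by gcongr; exact ht y hy
        _ ≤ |y| ^ a * (D * (Real.exp (-(l ^ 2 / 8)) * Real.exp (-(|y| / 8)))) := by
            rw [← Real.exp_add]
            gcongr
            nlinarith
        _ = D * Real.exp (-(l ^ 2 / 8)) * B₂ y := by simp only [hB₂]; ring
        _ ≤ _ := by linarith
  have hbi : Integrable (fun y => δ * B₁ y + D * Real.exp (-(l ^ 2 / 8)) * B₂ y) :=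
    (hB₁i.const_mul _).add (hB₂i.const_mul _)
  have hdi : Integrable (fun y => y ^ a * E y - E₀ y) :=
    hbi.mono' (((by fun_prop : Measurable fun y : ℝ => y ^ a * E y).aestronglyMeasurable).sub
      hE₀i.aestronglyMeasurable) (Eventually.of_forall hbound)
  have hEi : Integrable (fun y => y ^ a * E y) := by
    exact (hdi.add hE₀i).congr (Eventually.of_forall fun y => by simp)
  rw [← hE₀v, ← integral_sub hEi hE₀i]
  refine (norm_integral_le_of_norm_le hbi (Eventually.of_forall hbound)).trans ?_
  rw [integral_add (hB₁i.const_mul _) (hB₂i.const_mul _), integral_const_mul, integral_const_mul]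
  have h3 : 0 ≤ D * Real.exp (-(l ^ 2 / 8)) := by positivity
  nlinarith [mul_nonneg hδ h2, mul_nonneg h3 h1]

/-- If `f 0 = 0` and `|f'| ≤ B |s|^k` on `[-w, w]`, then `|f u| ≤ B |u|^(k+1)` there. -/
lemma abs_le_mul_pow_of_deriv {f f' : ℝ → ℝ} {B w : ℝ} {k : ℕ} (hB : 0 ≤ B) (h0 : f 0 = 0)
    (hf : ∀ s, |s| ≤ w → HasDerivAt f (f' s) s) (hf' : ∀ s, |s| ≤ w → |f' s| ≤ B * |s| ^ k) :
    ∀ u, |u| ≤ w → |f u| ≤ B * |u| ^ (k + 1) := by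
  intro u hu
  have hle : ∀ s ∈ uIcc 0 u, |s| ≤ |u| := fun s hs => by
    simpa using abs_sub_left_of_mem_uIcc hs
  have h := (convex_uIcc (0 : ℝ) u).norm_image_sub_le_of_norm_hasDerivWithin_le (f := f)
    (f' := f') (C := B * |u| ^ k)
    (fun s hs => (hf s ((hle s hs).trans hu)).hasDerivWithinAt)
    (fun s hs => by
      have h1 := hle s hs
      exact (hf' s (h1.trans hu)).trans (by gcongr)) left_mem_uIcc right_mem_uIcc
  rw [h0, sub_zero, sub_zero, Real.norm_eq_abs, Real.norm_eq_abs] at h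
  rwa [pow_succ, ← mul_assoc]

/-- Second-order Taylor expansion with a cubic term, when the third derivative stays within `B`
of a constant. -/
lemma abs_taylor_cubic_le {g g₁ g₂ g₃ : ℝ → ℝ} {x w m B : ℝ} (hB : 0 ≤ B)
    (h1 : ∀ s, |s| ≤ w → HasDerivAt g (g₁ (x + s)) (x + s))
    (h2 : ∀ s, |s| ≤ w → HasDerivAt g₁ (g₂ (x + s)) (x + s))
    (h3 : ∀ s, |s| ≤ w → HasDerivAt g₂ (g₃ (x + s)) (x + s))
    (hb : ∀ s, |s| ≤ w → |g₃ (x + s) - m| ≤ B) :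
    ∀ u, |u| ≤ w →
      |g (x + u) - g x - g₁ x * u - g₂ x * u ^ 2 / 2 - m * u ^ 3 / 6| ≤ B * |u| ^ 3 := by
  have e2 := abs_le_mul_pow_of_deriv (f := fun s => g₂ (x + s) - g₂ x - m * s)
    (f' := fun s => g₃ (x + s) - m) (k := 0) (w := w) hB (by simp)
    (fun s hs => by
      have := (((h3 s hs).comp_const_add x s).sub_const (g₂ x)).sub ((hasDerivAt_id s).const_mul m)
      exact this.congr_deriv (by simp))
    (fun s hs => by simpa using hb s hs)
  have e1 := abs_le_mul_pow_of_deriv (f := fun s => g₁ (x + s) - g₁ x - g₂ x * s - m * s ^ 2 / 2)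
    (f' := fun s => g₂ (x + s) - g₂ x - m * s) (k := 1) (w := w) hB (by simp)
    (fun s hs => by
      have := ((((h2 s hs).comp_const_add x s).sub_const (g₁ x)).sub
        ((hasDerivAt_id s).const_mul (g₂ x))).sub
        ((((hasDerivAt_id s).pow 2).const_mul m).div_const 2)
      refine this.congr_deriv ?_
      simp
      ring)
    e2
  exact abs_le_mul_pow_of_deriv
    (f := fun s => g (x + s) - g x - g₁ x * s - g₂ x * s ^ 2 / 2 - m * s ^ 3 / 6)
    (f' := fun s => g₁ (x + s) - g₁ x - g₂ x * s - m * s ^ 2 / 2) (k := 2) (w := w) hB (by simp)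
    (fun s hs => by
      have := (((((h1 s hs).comp_const_add x s).sub_const (g x)).sub
        ((hasDerivAt_id s).const_mul (g₁ x))).sub
        ((((hasDerivAt_id s).pow 2).const_mul (g₂ x)).div_const 2)).sub
        ((((hasDerivAt_id s).pow 3).const_mul m).div_const 6)
      refine this.congr_deriv ?_
      simp
      ring)
    e1

lemma abs_exp_sub_one_sub_le {r κ δ Y : ℝ} (hY : 1 ≤ Y) (hδ1 : δ ≤ 1 / 2)
    (hκ : |κ| * Y ≤ δ) {c : ℝ} (hc : |c| ≤ Y) (hr : |r + κ * c / 6| ≤ δ * |κ| * Y) :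
    |Real.exp r - (1 - κ * c / 6)| ≤ 5 * δ * |κ| * Y := by
  have hκ0 := abs_nonneg κ
  have h1 : |κ * c / 6| ≤ |κ| * Y / 6 := by
    rw [abs_div, abs_mul, abs_of_pos (by norm_num : (0 : ℝ) < 6)]
    gcongr
  have hp : 0 ≤ |κ| * Y := by positivity
  have h2 : |r| ≤ |κ| * Y := by
    have : |r| ≤ |r + κ * c / 6| + |κ * c / 6| := by
      simpa using abs_sub (r + κ * c / 6) (κ * c / 6)
    nlinarith
  have h3 : |Real.exp r - 1 - r| ≤ r ^ 2 := Real.abs_exp_sub_one_sub_id_le (by linarith)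
  have h4 : r ^ 2 ≤ (|κ| * Y) * δ := by
    rw [← sq_abs, sq]
    exact mul_le_mul h2 (h2.trans hκ) (abs_nonneg _) hp
  have h5 : |Real.exp r - (1 - κ * c / 6)| ≤ |Real.exp r - 1 - r| + |r + κ * c / 6| := by
    have := abs_add_le (Real.exp r - 1 - r) (r + κ * c / 6)
    ring_nf at this ⊢
    exact this
  nlinarith

lemma ConvexOn.mul_abs_div_le_sub {G : ℝ → ℝ} {S : Set ℝ} (hG : ConvexOn ℝ S G)
    {x₀ w m x : ℝ} (hw : 0 < w) (hx₀ : x₀ ∈ S) (hx : x ∈ S) (hxw : w ≤ |x - x₀|)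
    (h₁ : m ≤ G (x₀ + w) - G x₀) (h₂ : m ≤ G (x₀ - w) - G x₀) :
    m * (|x - x₀| / w) ≤ G x - G x₀ := by
  have hd : 0 < |x - x₀| := hw.trans_le hxw
  set θ := w / |x - x₀| with hθ
  have hθ0 : 0 < θ := by positivity
  have hθ1 : θ ≤ 1 := (div_le_one hd).mpr hxw
  have hc := hG.2 hx₀ hx (sub_nonneg.mpr hθ1) hθ0.le (by ring)
  simp only [smul_eq_mul] at hc
  have hm : m ≤ G ((1 - θ) * x₀ + θ * x) - G x₀ := by
    have e : (1 - θ) * x₀ + θ * x = x₀ + θ * (x - x₀) := by ring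
    rw [e]
    rcases le_total 0 (x - x₀) with h | h
    · rw [hθ, abs_of_nonneg h] at *
      rwa [div_mul_cancel₀ _ hd.ne']
    · rw [hθ, abs_of_nonpos h] at *
      have : w / -(x - x₀) * (x - x₀) = -w := by
        rw [div_neg, neg_mul, div_mul_cancel₀ _ (by linarith)]
      rwa [this, ← sub_eq_add_neg]
  have e : |x - x₀| / w = 1 / θ := by rw [hθ]; field_simp
  rw [e, mul_one_div, div_le_iff₀ hθ0]
  linarith

/-- The Laplace-type estimate at a fixed `t`, with explicit error. -/
lemma exists_laplace_le (a : ℕ) : ∃ C > (0 : ℝ), ∀ (g q : ℝ → ℝ) (M x₀ s t l κ δ : ℝ),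
    0 < s → 2 ≤ l → s * l < x₀ → 0 < δ → δ ≤ 1 / 8 → |κ| * (1 + l ^ 3) ≤ δ →
    ConvexOn ℝ (Ioi 0) g → Measurable q → (∀ x ≥ (0 : ℝ), |q x| ≤ M) →
    (∀ y, |y| ≤ l → |g (x₀ + s * y) - g x₀ - t * (s * y) - y ^ 2 / 2 - κ * y ^ 3 / 6| ≤
      δ * |κ| * |y| ^ 3) →
    (∀ y, |y| ≤ l → |q (x₀ + s * y)| ≤ δ * |κ|) →
    |(∫ x in Ioi (0 : ℝ), (x - x₀) ^ a * Real.exp (t * x) * Real.exp (-(g x - q x))) /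
        (s ^ (a + 1) * Real.exp (t * x₀ - g x₀)) -
      (truncMoment a l - κ / 6 * truncMoment (3 + a) l)| ≤
      C * (δ * |κ| + Real.exp M * Real.exp (-(l ^ 2 / 8))) := by
  obtain ⟨C, hC, hmom⟩ := exists_moment_sub_mainTerm_le a
  refine ⟨5 * C, by positivity, ?_⟩
  intro g q M x₀ s t l κ δ hs hl hsl hδ hδ8 hκδ hconv hq hqM htay hqw
  have hx₀ : 0 < x₀ := by nlinarith
  have hgc : ContinuousOn g (Ioi 0) := hconv.continuousOn isOpen_Ioi
  set f : ℝ → ℝ := fun x => Real.exp (t * x - g x + q x - (t * x₀ - g x₀)) with hf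
  set F : ℝ → ℝ := (Ioi (0 : ℝ)).indicator f with hF
  have hFm : Measurable F := by
    classical
    have hgm : Measurable ((Ioi (0 : ℝ)).piecewise g 0) :=
      hgc.measurable_piecewise continuousOn_const measurableSet_Ioi
    have : F = (Ioi (0 : ℝ)).indicator (fun x => Real.exp (t * x -
        (Ioi (0 : ℝ)).piecewise g 0 x + q x - (t * x₀ - g x₀))) := by
      refine indicator_congr fun x hx => ?_
      simp only [hf, piecewise_eq_of_mem _ _ _ hx]
    rw [this]
    exact Measurable.indicator (by fun_prop) measurableSet_Ioi
  set E : ℝ → ℝ := fun y => F (x₀ + s * y) with hE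
  have hEm : Measurable E := hFm.comp (by fun_prop)
  have hint : (∫ x in Ioi (0 : ℝ), (x - x₀) ^ a * Real.exp (t * x) * Real.exp (-(g x - q x))) =
      s ^ (a + 1) * Real.exp (t * x₀ - g x₀) * ∫ y, y ^ a * E y := by
    have e1 : (∫ x in Ioi (0 : ℝ), (x - x₀) ^ a * Real.exp (t * x) * Real.exp (-(g x - q x))) =
        ∫ x, (x - x₀) ^ a * Real.exp (t * x₀ - g x₀) * F x := by
      rw [← integral_indicator measurableSet_Ioi]
      congr 1
      ext x
      by_cases hx : x ∈ Ioi (0 : ℝ)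
      · rw [indicator_of_mem hx, hF, indicator_of_mem hx, hf, mul_assoc, mul_assoc, ← Real.exp_add,
          ← Real.exp_add]
        ring_nf
      · rw [indicator_of_notMem hx, hF, indicator_of_notMem hx, mul_zero]
    rw [e1, ← integral_add_left_eq_self _ x₀]
    have e2 := Measure.integral_comp_mul_left (fun x => (x₀ + x - x₀) ^ a *
      Real.exp (t * x₀ - g x₀) * F (x₀ + x)) s
    rw [abs_of_pos (inv_pos.mpr hs), smul_eq_mul] at e2
    rw [← mul_inv_cancel_left₀ hs.ne' (∫ x, (x₀ + x - x₀) ^ a *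
      Real.exp (t * x₀ - g x₀) * F (x₀ + x)), ← e2, ← integral_const_mul, ← integral_const_mul]
    congr 1
    ext y
    simp only [hE]
    ring
  have hK : 0 < s ^ (a + 1) * Real.exp (t * x₀ - g x₀) := by positivity
  rw [hint, mul_div_cancel_left₀ _ hK.ne']
  have hpos : ∀ y, |y| ≤ l → 0 < x₀ + s * y := fun y hy => by
    have := (abs_le.mp hy).1
    nlinarith
  have hl3 : 1 ≤ l ^ 3 := one_le_pow₀ (by linarith)
  have hκ0 := abs_nonneg κ
  have main := hmom E l κ (5 * (δ * |κ|)) (Real.exp M) (by linarith) (by positivity)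
    (Real.exp_pos _).le hEm ?_ ?_
  · have : 0 < Real.exp M * Real.exp (-(l ^ 2 / 8)) := by positivity
    nlinarith
  · intro y hy
    have hy3 : |y| ^ 3 ≤ l ^ 3 := by gcongr
    have hmem : x₀ + s * y ∈ Ioi (0 : ℝ) := hpos y hy
    set r := -(g (x₀ + s * y) - g x₀ - t * (s * y) - y ^ 2 / 2) + q (x₀ + s * y) with hr
    have hEy : E y = Real.exp (-(y ^ 2) / 2) * Real.exp r := by
      simp only [hE, hF, indicator_of_mem hmem, hf, ← Real.exp_add, hr]
      ring_nf
    have hb : |r + κ * y ^ 3 / 6| ≤ δ * |κ| * (1 + |y| ^ 3) := by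
      have h1 := htay y hy
      have h2 := hqw y hy
      rw [abs_le] at *
      constructor <;> linarith [h1.1, h1.2, h2.1, h2.2]
    have h3 : |κ| * (1 + |y| ^ 3) ≤ δ := le_trans (by gcongr) hκδ
    have h4 := abs_exp_sub_one_sub_le (c := y ^ 3) (by have : 0 ≤ |y| ^ 3 := by positivity
                                                       linarith)
      (by linarith) h3 (by rw [abs_pow]; linarith) hb
    rw [hEy, ← mul_sub, abs_mul, Real.abs_exp]
    calc _ ≤ Real.exp (-(y ^ 2) / 2) * (5 * δ * |κ| * (1 + |y| ^ 3)) := by gcongr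
      _ = _ := by ring
  · intro y hy
    by_cases hmem : x₀ + s * y ∈ Ioi (0 : ℝ)
    · have hl0 : 0 < l := by linarith
      have hconv' : ConvexOn ℝ (Ioi 0) (fun x => g x - t * x) :=
        hconv.sub ((LinearMap.mulLeft ℝ t).concaveOn (convex_Ioi 0))
      have hend : ∀ y, |y| = l → l ^ 2 / 4 ≤
          (g (x₀ + s * y) - t * (x₀ + s * y)) - (g x₀ - t * x₀) := by
        intro y hy
        have h1 := (abs_le.mp (htay y hy.le)).1
        have h2 : |κ * y ^ 3 / 6| ≤ |κ| * l ^ 3 := by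
          rw [abs_div, abs_mul, abs_pow, hy, abs_of_pos (by norm_num : (0 : ℝ) < 6)]
          have : 0 ≤ |κ| * l ^ 3 := by positivity
          linarith
        have h3 := (abs_le.mp h2).1
        have h4 : y ^ 2 = l ^ 2 := by rw [← sq_abs, hy]
        rw [hy] at h1
        have h5 : |κ| * l ^ 3 ≤ 1 / 8 := by nlinarith
        have h6 : δ * |κ| * l ^ 3 ≤ 1 / 8 := by
          have : 0 ≤ |κ| * l ^ 3 := by positivity
          nlinarith
        nlinarith
      have hdiff : |x₀ + s * y - x₀| = s * |y| := by
        rw [add_sub_cancel_left, abs_mul, abs_of_pos hs]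
      have h := hconv'.mul_abs_div_le_sub (x₀ := x₀) (w := s * l) (m := l ^ 2 / 4)
        (x := x₀ + s * y) (by positivity) hx₀ hmem (by rw [hdiff]; gcongr)
        (hend l (abs_of_pos hl0))
        (by have := hend (-l) (by rw [abs_neg, abs_of_pos hl0])
            rwa [mul_neg, ← sub_eq_add_neg] at this)
      rw [hdiff] at h
      have e : l ^ 2 / 4 * (s * |y| / (s * l)) = l / 4 * |y| := by field_simp
      rw [e] at h
      simp only [hE, hF, indicator_of_mem hmem, hf, Real.abs_exp]
      rw [← Real.exp_add]
      have := (abs_le.mp (hqM _ (le_of_lt hmem))).2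
      gcongr
      linarith
    · simp only [hE, hF, indicator_of_notMem hmem, abs_zero]
      positivity

lemma eventually_exp_neg_log_sq_le (A R : ℝ) {δ : ℝ} (hδ : 0 < δ) :
    ∀ᶠ t in atTop, A * Real.exp (-((Real.log t / √2) ^ 2 / 8)) ≤ δ * t ^ (-R) := by
  have h1 : Tendsto (fun u : ℝ => u * (u / 16 - R)) atTop atTop :=
    tendsto_id.atTop_mul_atTop₀ (tendsto_atTop_add_const_right _ _
      (tendsto_id.atTop_div_const (by norm_num)))
  have h2 := (h1.comp Real.tendsto_log_atTop).eventually_ge_atTop (Real.log ((|A| + 1) / δ))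
  filter_upwards [h2, eventually_gt_atTop 0] with t ht ht0
  have e : (Real.log t / √2) ^ 2 / 8 = Real.log t ^ 2 / 16 := by
    rw [div_pow, Real.sq_sqrt (by norm_num)]
    ring
  have hA : 0 < |A| + 1 := by positivity
  rw [e, Real.rpow_def_of_pos ht0]
  have h3 : (|A| + 1) / δ ≤ Real.exp (Real.log t * (Real.log t / 16 - R)) :=
    (Real.log_le_iff_le_exp (by positivity)).mp ht
  rw [div_le_iff₀ hδ] at h3
  calc A * Real.exp (-(Real.log t ^ 2 / 16))
      ≤ (Real.exp (Real.log t * (Real.log t / 16 - R)) * δ) *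
        Real.exp (-(Real.log t ^ 2 / 16)) := by
        gcongr
        linarith [le_abs_self A]
    _ = δ * Real.exp (Real.log t * -R) := by
        rw [mul_right_comm, ← Real.exp_add, mul_comm δ]
        ring_nf

/-- The scale `σ̂ = (g''(x̂))^{-1/2}`. -/
def localScale (g ψ : ℝ → ℝ) (t : ℝ) : ℝ := √(1 / deriv (deriv g) (ψ t))

/-- The normalized third derivative `g'''(x̂) σ̂³`. -/
def localSkew (g ψ : ℝ → ℝ) (t : ℝ) : ℝ := deriv (deriv (deriv g)) (ψ t) * localScale g ψ t ^ 3

/-- Conditions on the window `|x - ψ t| ≤ σ̂ log t / √2` under which Laplace's method applies: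
`g'''` is asymptotically constant there and `q` is negligible. -/
structure LaplaceWindow (g ψ q : ℝ → ℝ) : Prop where
  pos : ∀ᶠ t in atTop, 0 < deriv (deriv g) (ψ t)
  width_lt : ∀ᶠ t in atTop, localScale g ψ t * (Real.log t / √2) < ψ t
  exists_le_skew : ∃ R : ℝ, ∀ᶠ t in atTop, t ^ (-R) ≤ |localSkew g ψ t|
  skew_tendsto : Tendsto (fun t => |localSkew g ψ t| * Real.log t ^ (3 : ℝ)) atTop (nhds 0)
  third_deriv : ∀ δ > 0, ∀ᶠ t in atTop, ∀ x,
    |x - ψ t| ≤ localScale g ψ t * (Real.log t / √2) →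
      |deriv (deriv (deriv g)) x - deriv (deriv (deriv g)) (ψ t)| ≤
        δ * |deriv (deriv (deriv g)) (ψ t)|
  perturbation : ∀ δ > 0, ∀ᶠ t in atTop, ∀ x,
    |x - ψ t| ≤ localScale g ψ t * (Real.log t / √2) → |q x| ≤ δ * |localSkew g ψ t|

lemma hasDerivAt_of_contDiffOn_Ioi {g : ℝ → ℝ} (hsmooth : ContDiffOn ℝ 4 g (Ioi 0)) {x : ℝ}
    (hx : 0 < x) : HasDerivAt g (deriv g x) x ∧ HasDerivAt (deriv g) (deriv (deriv g) x) x ∧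
      HasDerivAt (deriv (deriv g)) (deriv (deriv (deriv g)) x) x ∧
      ContinuousAt (deriv (deriv (deriv g))) x := by
  have c1 : ContDiffOn ℝ 3 (deriv g) (Ioi 0) :=
    hsmooth.deriv_of_isOpen isOpen_Ioi (by norm_num)
  have c2 : ContDiffOn ℝ 2 (deriv (deriv g)) (Ioi 0) :=
    c1.deriv_of_isOpen isOpen_Ioi (by norm_num)
  have c3 : ContDiffOn ℝ 1 (deriv (deriv (deriv g))) (Ioi 0) :=
    c2.deriv_of_isOpen isOpen_Ioi (by norm_num)
  have hn := Ioi_mem_nhds hx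
  exact ⟨((hsmooth.contDiffAt hn).differentiableAt (by norm_num)).hasDerivAt,
    ((c1.contDiffAt hn).differentiableAt (by norm_num)).hasDerivAt,
    ((c2.contDiffAt hn).differentiableAt (by norm_num)).hasDerivAt, (c3.contDiffAt hn).continuousAt⟩

/-- Laplace's method with the first correction term. -/
lemma LaplaceWindow.tendsto {g ψ q : ℝ → ℝ} (W : LaplaceWindow g ψ q)
    (hconv : ConvexOn ℝ (Ioi 0) g) (hsmooth : ContDiffOn ℝ 4 g (Ioi 0)) (hq : Measurable q)
    (hqM : ∃ M : ℝ, ∀ x ≥ (0 : ℝ), |q x| ≤ M) (hψ : ∀ᶠ t in atTop, deriv g (ψ t) = t) (a : ℕ) :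
    Tendsto (fun t => (∫ x in Ioi (0 : ℝ), (x - ψ t) ^ a * Real.exp (t * x) *
        Real.exp (-(g x - q x))) /
        (localScale g ψ t ^ (a + 1) * Real.exp (t * ψ t - g (ψ t)) *
        (truncMoment a (Real.log t / √2) -
          localSkew g ψ t / 6 * truncMoment (3 + a) (Real.log t / √2))))
      atTop (nhds 1) := by
  obtain ⟨R, hlow⟩ := W.exists_le_skew
  have hup := W.skew_tendsto
  have hg₃ := W.third_deriv
  have hqw := W.perturbation
  have hσ : ∀ t, localScale g ψ t = √(1 / deriv (deriv g) (ψ t)) := fun t => rfl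
  have hκ : ∀ t, localSkew g ψ t = deriv (deriv (deriv g)) (ψ t) * localScale g ψ t ^ 3 :=
    fun t => rfl
  obtain ⟨M, hM⟩ := hqM
  obtain ⟨c, hc, hmain⟩ := exists_mul_abs_le_mainTerm a
  obtain ⟨C, hC, hlap⟩ := exists_laplace_le a
  have hl : Tendsto (fun t => Real.log t / √2) atTop atTop :=
    Real.tendsto_log_atTop.atTop_div_const (by positivity)
  rw [Metric.tendsto_nhds]
  intro ε hε
  set δ := min (1 / 8) (ε * c / (4 * C)) with hδdef
  have hδ : 0 < δ := by positivity
  have hδ8 : δ ≤ 1 / 8 := min_le_left _ _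
  have hδε : C * (2 * δ) < ε * c := by
    have : δ ≤ ε * c / (4 * C) := min_le_right _ _
    rw [le_div_iff₀ (by positivity)] at this
    have : 0 < ε * c := by positivity
    nlinarith
  have hexp := eventually_exp_neg_log_sq_le (Real.exp M) R hδ
  have hup' : ∀ᶠ t in atTop, |localSkew g ψ t| * Real.log t ^ (3 : ℝ) < δ / 2 :=
    hup.eventually (gt_mem_nhds (by positivity))
  filter_upwards [hψ, W.pos, W.width_lt, hlow, hup', hg₃ δ hδ, hqw δ hδ, hexp,
    hl.eventually_ge_atTop 2, eventually_gt_atTop 0] with t h1 h2 h3 h4 h5 h6 h7 h8 hl2 ht0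
  set l := Real.log t / √2 with hldef
  have hlog : l ≤ Real.log t := by
    have hs2 : (1 : ℝ) ≤ √2 := Real.one_le_sqrt.mpr (by norm_num)
    have : 0 < Real.log t := by
      by_contra hcon
      push Not at hcon
      have : l ≤ 0 := div_nonpos_of_nonpos_of_nonneg hcon (by positivity)
      linarith
    exact div_le_self this.le hs2
  have hs : 0 < localScale g ψ t := by rw [hσ]; exact Real.sqrt_pos.mpr (by positivity)
  have hs2 : deriv (deriv g) (ψ t) * localScale g ψ t ^ 2 = 1 := by
    rw [hσ, Real.sq_sqrt (by positivity)]
    field_simp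
  have hκpos : 0 < |localSkew g ψ t| := (Real.rpow_pos_of_pos ht0 _).trans_le h4
  have hl3 : 1 ≤ l ^ 3 := one_le_pow₀ (by linarith)
  have hκl : |localSkew g ψ t| * (1 + l ^ 3) ≤ δ := by
    norm_cast at h5
    have : l ^ 3 ≤ Real.log t ^ 3 := by gcongr
    nlinarith
  have hκ1 : |localSkew g ψ t| ≤ 1 := by nlinarith
  have hmem : ∀ u, |u| ≤ localScale g ψ t * l → 0 < ψ t + u := fun u hu => by
    have := (abs_le.mp hu).1
    linarith
  have htay := abs_taylor_cubic_le (g := g) (g₁ := deriv g) (g₂ := deriv (deriv g))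
    (g₃ := deriv (deriv (deriv g))) (x := ψ t) (w := localScale g ψ t * l)
    (m := deriv (deriv (deriv g)) (ψ t)) (B := δ * |deriv (deriv (deriv g)) (ψ t)|)
    (by positivity) (fun u hu => (hasDerivAt_of_contDiffOn_Ioi hsmooth (hmem u hu)).1) (fun u hu => (hasDerivAt_of_contDiffOn_Ioi hsmooth (hmem u hu)).2.1)
    (fun u hu => (hasDerivAt_of_contDiffOn_Ioi hsmooth (hmem u hu)).2.2.1) (fun u hu => h6 _ (by simpa using hu))
  have hsy : ∀ y, |y| ≤ l → |localScale g ψ t * y| ≤ localScale g ψ t * l := fun y hy => by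
    rw [abs_mul, abs_of_pos hs]
    gcongr
  have key := hlap g q M (ψ t) (localScale g ψ t) t l (localSkew g ψ t) δ hs hl2 h3 hδ hδ8 hκl hconv hq hM
    (fun y hy => by
      have h := htay (localScale g ψ t * y) (hsy y hy)
      rw [h1] at h
      have e1 : deriv (deriv g) (ψ t) * (localScale g ψ t * y) ^ 2 / 2 = y ^ 2 / 2 := by
        rw [mul_pow, ← mul_assoc, hs2, one_mul]
      have e2 : deriv (deriv (deriv g)) (ψ t) * (localScale g ψ t * y) ^ 3 / 6 = localSkew g ψ t * y ^ 3 / 6 := by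
        rw [hκ]; ring
      have e3 : δ * |deriv (deriv (deriv g)) (ψ t)| * |localScale g ψ t * y| ^ 3 = δ * |localSkew g ψ t| * |y| ^ 3 := by
        rw [hκ, abs_mul, abs_mul, abs_pow, abs_of_pos hs]; ring
      rwa [e1, e2, e3] at h)
    (fun y hy => h7 _ (by simpa using hsy y hy))
  have hT := hmain l (localSkew g ψ t) (by linarith) hκ1
  set T := truncMoment a l - localSkew g ψ t / 6 * truncMoment (3 + a) l with hTdef
  have hTpos : 0 < |T| := lt_of_lt_of_le (by positivity) hT
  have hT0 : T ≠ 0 := abs_pos.mp hTpos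
  rw [← div_div, Real.dist_eq, div_sub_one hT0, abs_div, div_lt_iff₀ hTpos]
  calc _ ≤ C * (δ * |localSkew g ψ t| + Real.exp M * Real.exp (-(l ^ 2 / 8))) := key
    _ ≤ C * (δ * |localSkew g ψ t| + δ * |localSkew g ψ t|) := by
      have := h8.trans (mul_le_mul_of_nonneg_left h4 hδ.le)
      gcongr C * (_ + ?_)
    _ = C * (2 * δ) * |localSkew g ψ t| := by ring
    _ < ε * c * |localSkew g ψ t| := by gcongr
    _ ≤ ε * |T| := by rw [mul_assoc]; gcongr

/-- Uniform version of `f (x + u) - f x → ρ u` as `x → ∞`, for `u ∈ [0, 1]`. -/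
def UniformSlope (ρ : ℝ) (f : ℝ → ℝ) : Prop :=
  ∀ δ > 0, ∃ X, ∀ x ≥ X, ∀ u ∈ Icc (0 : ℝ) 1, |f (x + u) - f x - ρ * u| ≤ δ

namespace UniformSlope

/-- Uniform convergence theorem: for measurable functions the pointwise limit relation is
automatically uniform. -/
lemma of_tendsto {ρ : ℝ} {f : ℝ → ℝ} (hf : Measurable f)
    (h : ∀ u, Tendsto (fun x => f (x + u) - f x) atTop (nhds (ρ * u))) : UniformSlope ρ f := by
  set g : ℝ → ℝ := fun x => f x - ρ * x with hg
  have hgm : Measurable g := by fun_prop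
  have hgt : ∀ u, Tendsto (fun x => g (x + u) - g x) atTop (nhds 0) := fun u => by
    have := (h u).sub_const (ρ * u)
    rw [sub_self] at this
    refine this.congr fun x => ?_
    simp only [hg]; ring
  intro δ hδ
  by_contra! hcon
  choose x hx u hu hxu using fun n : ℕ => hcon n
  have hxt : Tendsto x atTop atTop := tendsto_atTop_mono hx tendsto_natCast_atTop_atTop
  have hxut : Tendsto (fun n => x n + u n) atTop atTop :=
    tendsto_atTop_mono (fun n => by linarith [(hu n).1]) hxt
  set G : (ℕ → ℝ) → ℕ → Set ℝ := fun z n =>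
    {v | v ∈ Icc (0 : ℝ) 2 ∧ ∀ m ≥ n, |g (z m + v) - g (z m)| ≤ δ / 2 / 2} with hG
  have hGm : ∀ z n, MeasurableSet (G z n) := fun z n => by
    have : G z n = Icc (0 : ℝ) 2 ∩
        ⋂ m, ⋂ _ : m ≥ n, {v | |g (z m + v) - g (z m)| ≤ δ / 2 / 2} := by
      ext v
      simp [hG]
    rw [this]
    refine measurableSet_Icc.inter ?_
    exact MeasurableSet.iInter fun m => MeasurableSet.iInter fun _ =>
      measurableSet_le (by fun_prop) measurable_const
  have hbig : ∀ z : ℕ → ℝ, Tendsto z atTop atTop →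
      ∀ᶠ n in atTop, ENNReal.ofReal (3 / 2) < volume (G z n) := by
    intro z hz
    have hmono : Monotone (G z) := fun a b hab v hv => ⟨hv.1, fun m hm => hv.2 m (hab.trans hm)⟩
    have hU : ⋃ n, G z n = Icc (0 : ℝ) 2 := by
      refine subset_antisymm (iUnion_subset fun n v hv => hv.1) fun v hv => ?_
      have := (Metric.tendsto_nhds.mp ((hgt v).comp hz)) (δ / 2 / 2) (by positivity)
      obtain ⟨n, hn⟩ := eventually_atTop.mp this
      refine mem_iUnion.mpr ⟨n, hv, fun m hm => ?_⟩
      have := hn m hm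
      simp only [Function.comp_apply, Real.dist_eq, sub_zero] at this
      exact this.le
    have ht := tendsto_measure_iUnion_atTop (μ := volume) hmono
    rw [hU, Real.volume_Icc, sub_zero] at ht
    exact ht.eventually (lt_mem_nhds ((ENNReal.ofReal_lt_ofReal_iff (by norm_num)).mpr
      (by norm_num)))
  obtain ⟨n, hn₁, hn₂⟩ := ((hbig x hxt).and (hbig _ hxut)).exists
  set V := G x n with hV
  set W := (fun v => v + -u n) ⁻¹' (G (fun n => x n + u n) n) with hW
  have hWv : ENNReal.ofReal (3 / 2) < volume W := by
    rwa [hW, measure_preimage_add_right]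
  have hVs : V ⊆ Icc (0 : ℝ) 3 := fun v hv => ⟨hv.1.1, by linarith [hv.1.2]⟩
  have hWs : W ⊆ Icc (0 : ℝ) 3 := fun v hv => by
    have h1 := hv.1
    have h2 := hu n
    simp only [mem_Icc] at h1 h2 ⊢
    constructor <;> linarith [h1.1, h1.2, h2.1, h2.2]
  have hne : (V ∩ W).Nonempty := by
    by_contra hemp
    rw [not_nonempty_iff_eq_empty, ← disjoint_iff_inter_eq_empty] at hemp
    have h1 := measure_union (μ := volume) hemp ((hGm _ n).preimage (by fun_prop) : MeasurableSet W)
    have h2 : volume (V ∪ W) ≤ ENNReal.ofReal 3 := by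
      simpa using measure_mono (μ := volume) (union_subset hVs hWs)
    have h3 : ENNReal.ofReal 3 < volume V + volume W := by
      have : ENNReal.ofReal 3 = ENNReal.ofReal (3 / 2) + ENNReal.ofReal (3 / 2) := by
        rw [← ENNReal.ofReal_add (by norm_num) (by norm_num)]; norm_num
      rw [this]
      exact ENNReal.add_lt_add hn₁ hWv
    rw [h1] at h2
    exact absurd h2 (not_le.mpr h3)
  obtain ⟨v, hv₁, hv₂⟩ := hne
  have h1 := hv₁.2 n le_rfl
  have h2 := hv₂.2 n le_rfl
  have e : x n + u n + (v + -u n) = x n + v := by ring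
  simp only [e] at h2
  have h3 := hxu n
  have e2 : f (x n + u n) - f (x n) - ρ * u n = (g (x n + v) - g (x n)) -
      (g (x n + v) - g (x n + u n)) := by simp only [hg]; ring
  rw [e2] at h3
  have := abs_sub (g (x n + v) - g (x n)) (g (x n + v) - g (x n + u n))
  linarith

lemma of_hasDerivAt {ρ : ℝ} {f f' : ℝ → ℝ} (hf : ∀ᶠ x in atTop, HasDerivAt f (f' x) x)
    (h : Tendsto f' atTop (nhds ρ)) : UniformSlope ρ f := by
  intro δ hδ
  obtain ⟨X, hX⟩ := eventually_atTop.mp (hf.and (Metric.tendsto_nhds.mp h δ hδ))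
  refine ⟨X, fun x hx u hu => ?_⟩
  have := (convex_Icc x (x + u)).norm_image_sub_le_of_norm_hasDerivWithin_le
    (f := fun y => f y - ρ * y) (f' := fun y => f' y - ρ) (C := δ)
    (fun y hy => (((hX y (hx.le.trans hy.1)).1.sub
      ((hasDerivAt_id y).const_mul ρ)).congr_deriv (by simp)).hasDerivWithinAt)
    (fun y hy => by
      have := (hX y (hx.le.trans hy.1)).2
      rw [Real.dist_eq] at this
      exact this.le)
    (left_mem_Icc.mpr (by linarith [hu.1])) (right_mem_Icc.mpr (by linarith [hu.1]))
  rw [Real.norm_eq_abs, Real.norm_eq_abs, add_sub_cancel_left, abs_of_nonneg hu.1] at this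
  have h2 : δ * u ≤ δ := by nlinarith [hu.2]
  have e : f (x + u) - f x - ρ * u = f (x + u) - ρ * (x + u) - (f x - ρ * x) := by ring
  rw [e]
  exact this.trans h2

lemma congr {ρ : ℝ} {f g : ℝ → ℝ} (hf : UniformSlope ρ f) (h : f =ᶠ[atTop] g) :
    UniformSlope ρ g := by
  intro δ hδ
  obtain ⟨X, hX⟩ := hf δ hδ
  obtain ⟨Y, hY⟩ := eventually_atTop.mp h
  refine ⟨max X Y, fun x hx u hu => ?_⟩
  rw [← hY x (le_of_max_le_right hx), ← hY (x + u) (by linarith [le_of_max_le_right hx, hu.1])]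
  exact hX x (le_of_max_le_left hx) u hu

lemma add {ρ ρ' : ℝ} {f g : ℝ → ℝ} (hf : UniformSlope ρ f) (hg : UniformSlope ρ' g) :
    UniformSlope (ρ + ρ') (fun x => f x + g x) := by
  intro δ hδ
  obtain ⟨X, hX⟩ := hf (δ / 2) (by positivity)
  obtain ⟨Y, hY⟩ := hg (δ / 2) (by positivity)
  refine ⟨max X Y, fun x hx u hu => ?_⟩
  have h1 := hX x (le_of_max_le_left hx) u hu
  have h2 := hY x (le_of_max_le_right hx) u hu
  rw [abs_le] at *
  constructor <;> linarith [h1.1, h1.2, h2.1, h2.2]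

lemma const_mul {ρ : ℝ} {f : ℝ → ℝ} (hf : UniformSlope ρ f) (c : ℝ) :
    UniformSlope (c * ρ) (fun x => c * f x) := by
  intro δ hδ
  obtain ⟨X, hX⟩ := hf (δ / (|c| + 1)) (by positivity)
  refine ⟨X, fun x hx u hu => ?_⟩
  have h1 := hX x hx u hu
  rw [le_div_iff₀ (by positivity)] at h1
  have e : c * f (x + u) - c * f x - c * ρ * u = c * (f (x + u) - f x - ρ * u) := by ring
  rw [e, abs_mul]
  nlinarith [abs_nonneg (f (x + u) - f x - ρ * u)]

lemma of_tendsto_const {f : ℝ → ℝ} {L : ℝ} (h : Tendsto f atTop (nhds L)) : UniformSlope 0 f := by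
  intro δ hδ
  obtain ⟨X, hX⟩ := eventually_atTop.mp (Metric.tendsto_nhds.mp h (δ / 2) (by positivity))
  refine ⟨X, fun x hx u hu => ?_⟩
  have h1 := hX x hx
  have h2 := hX (x + u) (by linarith [hu.1])
  rw [Real.dist_eq, abs_lt] at h1 h2
  rw [zero_mul, sub_zero, abs_le]
  constructor <;> linarith [h1.1, h1.2, h2.1, h2.2]

lemma abs_sub_le_of_mem {ρ : ℝ} {f : ℝ → ℝ} (hf : UniformSlope ρ f) {δ : ℝ} (hδ : 0 < δ) :
    ∀ᶠ x in atTop, |f x - ρ * x| ≤ δ * x := by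
  obtain ⟨X₀, hX₀⟩ := hf (δ / 2) (by positivity)
  set X := max X₀ 0 with hXdef
  have hstep : ∀ n : ℕ, |f (X + n) - f X - ρ * n| ≤ δ / 2 * n := by
    intro n
    induction n with
    | zero => simp
    | succ n ih =>
      have h1 := hX₀ (X + n) (by
        have : (0 : ℝ) ≤ n := n.cast_nonneg
        linarith [le_max_left X₀ 0]) 1 (by simp)
      push_cast
      rw [← add_assoc]
      rw [abs_le] at *
      constructor <;> linarith [h1.1, h1.2, ih.1, ih.2]
  filter_upwards [eventually_ge_atTop X,
    eventually_ge_atTop ((|f X| + |ρ * X| + δ / 2) / (δ / 2))] with x hx hx2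
  have hn := Nat.floor_le (sub_nonneg.mpr hx)
  have hn2 := Nat.lt_floor_add_one (x - X)
  set n := ⌊x - X⌋₊
  have hn0 : (0 : ℝ) ≤ n := n.cast_nonneg
  have h1 := hstep n
  have h2 := hX₀ (X + n) (by linarith [le_max_left X₀ 0]) (x - X - n)
    ⟨by linarith, by linarith⟩
  have e : X + n + (x - X - n) = x := by ring
  rw [e] at h2
  rw [div_le_iff₀ (by positivity)] at hx2
  have hX0 : 0 ≤ X := le_max_right _ _
  have h3 := abs_le.mp (le_refl |f X|)
  have h4 := abs_le.mp (le_refl |ρ * X|)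
  rw [abs_le] at h1 h2 ⊢
  constructor <;> nlinarith [h1.1, h1.2, h2.1, h2.2, h3.1, h3.2, h4.1, h4.2]

end UniformSlope

/-- Uniform regular variation with index `ρ`: the defining limit of `RegVary` holds uniformly for
`λ ∈ [1, e]`. -/
structure UniformRegVary (ρ : ℝ) (F : ℝ → ℝ) : Prop where
  pos : ∀ᶠ x in atTop, 0 < F x
  slope : UniformSlope ρ (fun x => Real.log (F (Real.exp x)))

namespace UniformRegVary

lemma of_regVary {ρ : ℝ} {F : ℝ → ℝ} (hF : Measurable F) (h : RegVary ρ F) :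
    UniformRegVary ρ F := by
  refine ⟨h.1, UniformSlope.of_tendsto (by fun_prop) fun u => ?_⟩
  have h1 := (h.2 (Real.exp u) (Real.exp_pos u)).comp Real.tendsto_exp_atTop
  have h2 := h1.log (Real.rpow_pos_of_pos (Real.exp_pos u) ρ).ne'
  rw [Real.log_rpow (Real.exp_pos u), Real.log_exp] at h2
  refine h2.congr' ?_
  have hp := Real.tendsto_exp_atTop.eventually h.1
  filter_upwards [hp, (tendsto_atTop_add_const_right _ u tendsto_id).eventually hp] with x h3 h4
  simp only [Function.comp_apply, id_eq] at *
  rw [← Real.exp_add, add_comm u x, Real.log_div h4.ne' h3.ne']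

lemma of_hasDerivAt {ρ : ℝ} {F F' : ℝ → ℝ} (hpos : ∀ᶠ x in atTop, 0 < F x)
    (hF : ∀ᶠ x in atTop, HasDerivAt F (F' x) x)
    (h : Tendsto (fun x => x * F' x / F x) atTop (nhds ρ)) : UniformRegVary ρ F := by
  refine ⟨hpos, UniformSlope.of_hasDerivAt (f' := fun x => Real.exp x * F' (Real.exp x) /
    F (Real.exp x)) ?_ (h.comp Real.tendsto_exp_atTop)⟩
  filter_upwards [Real.tendsto_exp_atTop.eventually hpos,
    Real.tendsto_exp_atTop.eventually hF] with x h1 h2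
  exact ((h2.comp x (Real.hasDerivAt_exp x)).log h1.ne').congr_deriv (by
    simp only [Function.comp_apply]; ring)

lemma congr {ρ : ℝ} {F G : ℝ → ℝ} (hF : UniformRegVary ρ F) (h : F =ᶠ[atTop] G) :
    UniformRegVary ρ G := by
  refine ⟨by filter_upwards [hF.pos, h] with x h1 h2; rwa [← h2], hF.slope.congr ?_⟩
  filter_upwards [Real.tendsto_exp_atTop.eventually h] with x hx
  rw [hx]

lemma mul {ρ ρ' : ℝ} {F G : ℝ → ℝ} (hF : UniformRegVary ρ F) (hG : UniformRegVary ρ' G) :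
    UniformRegVary (ρ + ρ') (fun x => F x * G x) := by
  refine ⟨by filter_upwards [hF.pos, hG.pos] with x h1 h2; positivity,
    (hF.slope.add hG.slope).congr ?_⟩
  filter_upwards [Real.tendsto_exp_atTop.eventually hF.pos,
    Real.tendsto_exp_atTop.eventually hG.pos] with x h1 h2
  rw [Real.log_mul h1.ne' h2.ne']

lemma rpow {ρ : ℝ} {F : ℝ → ℝ} (hF : UniformRegVary ρ F) (r : ℝ) :
    UniformRegVary (r * ρ) (fun x => F x ^ r) := by
  refine ⟨by filter_upwards [hF.pos] with x h1; positivity, (hF.slope.const_mul r).congr ?_⟩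
  filter_upwards [Real.tendsto_exp_atTop.eventually hF.pos] with x h1
  rw [Real.log_rpow h1]

lemma of_tendsto_pos {F : ℝ → ℝ} {L : ℝ} (hL : 0 < L) (h : Tendsto F atTop (nhds L)) :
    UniformRegVary 0 F :=
  ⟨h.eventually (lt_mem_nhds hL),
    UniformSlope.of_tendsto_const ((h.comp Real.tendsto_exp_atTop).log hL.ne')⟩

protected lemma id : UniformRegVary 1 (fun x => x) :=
  ⟨eventually_gt_atTop 0, fun δ hδ => ⟨0, fun x _ u _ => by simp [hδ.le]⟩⟩

lemma rpow_le_and_le_rpow {ρ : ℝ} {F : ℝ → ℝ} (hF : UniformRegVary ρ F) {δ : ℝ} (hδ : 0 < δ) :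
    ∀ᶠ t in atTop, t ^ (ρ - δ) ≤ F t ∧ F t ≤ t ^ (ρ + δ) := by
  filter_upwards [hF.pos, eventually_gt_atTop 0,
    Real.tendsto_log_atTop.eventually (hF.slope.abs_sub_le_of_mem hδ)] with t h1 h2 h3
  rw [Real.exp_log h2, abs_le] at h3
  rw [Real.rpow_def_of_pos h2, Real.rpow_def_of_pos h2, ← Real.le_log_iff_exp_le h1,
    ← Real.log_le_iff_le_exp h1]
  constructor <;> nlinarith [h3.1, h3.2]

lemma tendsto_zero {ρ : ℝ} {F : ℝ → ℝ} (hF : UniformRegVary ρ F) (hρ : ρ < 0) :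
    Tendsto F atTop (nhds 0) := by
  have h := hF.rpow_le_and_le_rpow (δ := -ρ / 2) (by linarith)
  have h2 := tendsto_rpow_neg_atTop (y := -ρ / 2) (by linarith)
  refine squeeze_zero' (hF.pos.mono fun x hx => hx.le) (h.mono fun x hx => hx.2) ?_
  convert h2 using 3
  ring

lemma eventually_one_le {ρ : ℝ} {F : ℝ → ℝ} (hF : UniformRegVary ρ F) (hρ : 0 < ρ) :
    ∀ᶠ t in atTop, 1 ≤ F t := by
  filter_upwards [hF.rpow_le_and_le_rpow hρ] with t ht
  simpa using ht.1

protected lemma log : UniformRegVary 0 Real.log := by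
  refine of_hasDerivAt (F' := fun x => x⁻¹) (Real.tendsto_log_atTop.eventually_gt_atTop 0)
    (by filter_upwards [eventually_gt_atTop 0] with x hx using Real.hasDerivAt_log hx.ne') ?_
  refine (tendsto_inv_atTop_zero.comp Real.tendsto_log_atTop).congr' ?_
  filter_upwards [eventually_gt_atTop 0] with x hx
  simp [hx.ne']

lemma exists_abs_sub_le {ρ : ℝ} {F : ℝ → ℝ} (hF : UniformRegVary ρ F) {ε : ℝ} (hε : 0 < ε) :
    ∃ η > 0, η ≤ 1 / 2 ∧ ∀ᶠ t in atTop, ∀ s, |s - t| ≤ η * t → |F s - F t| ≤ ε * F t := by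
  set δ := min (1 / 4) (ε / 4) with hδdef
  have hδ : 0 < δ := by positivity
  obtain ⟨X, hX⟩ := hF.slope δ hδ
  obtain ⟨Y, hY⟩ := eventually_atTop.mp hF.pos
  set η := min (1 / 2) (δ / (2 * (|ρ| + 1))) with hηdef
  have hη : 0 < η := by positivity
  have hη2 : η ≤ 1 / 2 := min_le_left _ _
  have hηρ : |ρ| * (2 * η) ≤ δ := by
    have h1 : η ≤ δ / (2 * (|ρ| + 1)) := min_le_right _ _
    rw [le_div_iff₀ (by positivity)] at h1
    nlinarith [abs_nonneg ρ]
  have hlog : ∀ r : ℝ, 1 ≤ r → r ≤ 1 + 2 * η → Real.log r ∈ Icc (0 : ℝ) 1 ∧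
      |ρ * Real.log r| ≤ δ := by
    intro r h1 h2
    have h3 := Real.log_nonneg h1
    have h4 := Real.log_le_sub_one_of_pos (by linarith : 0 < r)
    refine ⟨⟨h3, by linarith⟩, ?_⟩
    rw [abs_mul, abs_of_nonneg h3]
    exact (mul_le_mul_of_nonneg_left (by linarith) (abs_nonneg ρ)).trans hηρ
  have hcomp : ∀ s t : ℝ, 0 < s → X ≤ Real.log s → s ≤ t → t ≤ (1 + 2 * η) * s →
      |Real.log (F t) - Real.log (F s)| ≤ 2 * δ := by
    intro s t hs hsX hst hts
    have ht : 0 < t := hs.trans_le hst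
    obtain ⟨h1, h2⟩ := hlog (t / s) ((one_le_div hs).mpr hst) ((div_le_iff₀ hs).mpr hts)
    have h3 := hX _ hsX _ h1
    rw [Real.log_div ht.ne' hs.ne'] at h2 h3
    beta_reduce at h3
    rw [add_sub_cancel, Real.exp_log hs, Real.exp_log ht] at h3
    rw [abs_le] at *
    constructor <;> linarith [h2.1, h2.2, h3.1, h3.2]
  refine ⟨η, hη, hη2, ?_⟩
  filter_upwards [eventually_ge_atTop (2 * Y), eventually_gt_atTop 0, eventually_ge_atTop Y,
    eventually_ge_atTop (2 * Real.exp X)] with t ht1 ht0 ht2 ht3 s hs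
  have hst := abs_le.mp hs
  have hs2 : t / 2 ≤ s := by nlinarith
  have hs0 : 0 < s := by linarith
  have hXs : X ≤ Real.log s := (Real.le_log_iff_exp_le hs0).mpr (by linarith)
  have hXt : X ≤ Real.log t := (Real.le_log_iff_exp_le ht0).mpr (by linarith [Real.exp_pos X])
  have hFs := hY s (by linarith)
  have hFt := hY t ht2
  have hL : |Real.log (F s) - Real.log (F t)| ≤ 2 * δ := by
    rcases le_total s t with h | h
    · rw [abs_sub_comm]
      exact hcomp s t hs0 hXs h (by nlinarith)
    · exact hcomp t s ht0 hXt h (by nlinarith)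
  have hδ4 : δ ≤ 1 / 4 := min_le_left _ _
  have hδε : δ ≤ ε / 4 := min_le_right _ _
  have hexp := Real.abs_exp_sub_one_le (x := Real.log (F s) - Real.log (F t)) (by linarith)
  rw [Real.exp_sub, Real.exp_log hFs, Real.exp_log hFt, div_sub_one hFt.ne', abs_div,
    abs_of_pos hFt, div_le_iff₀ hFt] at hexp
  refine hexp.trans ?_
  gcongr
  linarith

/-- A function that is `UniformRegVary` along a parametrization `P` of the axis is asymptotically
constant on windows which are short in terms of the parameter. -/
lemma eventually_abs_sub_le {ρ : ℝ} {F P τ ψ w : ℝ → ℝ}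
    (hF : UniformRegVary ρ (fun s => F (P s))) (hτ : Tendsto τ atTop atTop)
    (hP : ∀ᶠ t in atTop, P (τ t) = ψ t)
    (hcover : ∀ η > 0, ∀ᶠ t in atTop, ∀ x, |x - ψ t| ≤ w t →
      ∃ s, P s = x ∧ |s - τ t| ≤ η * τ t) {ε : ℝ} (hε : 0 < ε) :
    ∀ᶠ t in atTop, ∀ x, |x - ψ t| ≤ w t → |F x - F (ψ t)| ≤ ε * F (ψ t) := by
  obtain ⟨η, hη, -, h⟩ := hF.exists_abs_sub_le hε
  filter_upwards [hτ.eventually h, hP, hcover η hη] with t h1 h2 h3 x hx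
  obtain ⟨s, rfl, hs⟩ := h3 x hx
  rw [← h2]
  exact h1 s hs

end UniformRegVary

lemma hasDerivAt_exp_integral_div {ε : ℝ → ℝ} (hε : ∀ x ≥ (1 : ℝ), DifferentiableAt ℝ ε x) {x : ℝ}
    (hx : 1 < x) : HasDerivAt (fun y => Real.exp (∫ u in (1 : ℝ)..y, ε u / u))
      (Real.exp (∫ u in (1 : ℝ)..x, ε u / u) * (ε x / x)) x := by
  have hc : ContinuousOn (fun u => ε u / u) (Ici 1) := fun u hu =>
    ((hε u hu).continuousAt.div continuousAt_id
      (by have : (1 : ℝ) ≤ u := hu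
          simp only [id_eq]
          linarith)).continuousWithinAt
  refine (intervalIntegral.integral_hasDerivAt_right
    ((hc.mono ?_).intervalIntegrable) ?_ (hc.continuousAt (Ici_mem_nhds hx))).exp
  · rw [uIcc_of_le hx.le]
    exact Icc_subset_Ici_self
  · exact (hc.mono Ioi_subset_Ici_self).stronglyMeasurableAtFilter isOpen_Ioi x hx

lemma UniformRegVary.sqrt_one_div {ρ : ℝ} {F : ℝ → ℝ} (hF : UniformRegVary ρ F) :
    UniformRegVary (-(1 / 2) * ρ) (fun x => √(1 / F x)) := by
  refine (hF.rpow (-(1 / 2))).congr ?_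
  filter_upwards [hF.pos] with x hx
  rw [Real.sqrt_eq_rpow, one_div (F x), Real.inv_rpow hx.le, Real.rpow_neg hx.le]

lemma laplaceWindow_of_case1 {g ψ q ε : ℝ → ℝ} {β c θ η : ℝ}
    (hsmooth : ContDiffOn ℝ 4 g (Ioi 0)) (hψ : ∀ᶠ t in atTop, deriv g (ψ t) = t)
    (hψ_top : Tendsto ψ atTop atTop) (hq : Measurable q) (h : Case1 (deriv g) β c θ ε)
    (hη : η < θ - 3 * β / 2 - 3 / 2) (hqη : RegVary η (fun x => |q x|)) :
    LaplaceWindow g ψ q := by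
  have hβ := h.beta_pos
  have hθ := h.theta_le
  have hd : ∀ x > (1 : ℝ), HasDerivAt (deriv g) (deriv g x * ((β + ε x) / x)) x := by
    intro x hx
    have h1 := ((Real.hasDerivAt_rpow_const (x := x) (p := β) (Or.inl (by linarith))).const_mul
      c).mul (hasDerivAt_exp_integral_div h.eps_diff hx)
    have he : deriv g =ᶠ[nhds x] fun y => c * y ^ β * Real.exp (∫ u in (1 : ℝ)..y, ε u / u) := by
      filter_upwards [Ioi_mem_nhds hx] with y hy using h.h_eq y (le_of_lt hy)
    refine (h1.congr_of_eventuallyEq he).congr_deriv ?_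
    rw [h.h_eq x hx.le, Real.rpow_sub_one (by linarith)]
    have : x ≠ 0 := by linarith
    field_simp
  have hpos : ∀ᶠ x in atTop, 0 < deriv g x := by
    filter_upwards [eventually_ge_atTop 1] with x hx
    have := h.c_pos
    have : 0 < x ^ β := Real.rpow_pos_of_pos (by linarith) β
    rw [h.h_eq x hx]
    positivity
  have hβε : Tendsto (fun x => β + ε x) atTop (nhds β) := by
    simpa using h.eps_to_zero.const_add β
  have hh : UniformRegVary β (deriv g) := by
    refine .of_hasDerivAt hpos ((eventually_gt_atTop 1).mono hd) (hβε.congr' ?_)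
    filter_upwards [hpos, eventually_gt_atTop 0] with x h1 h2
    field_simp
  have hh' : UniformRegVary (β + -1 * 1 + 0) (deriv (deriv g)) := by
    refine ((hh.mul (UniformRegVary.id.rpow (-1))).mul (.of_tendsto_pos hβ hβε)).congr ?_
    filter_upwards [eventually_gt_atTop 1] with x hx
    rw [(hd x hx).deriv, Real.rpow_neg_one]
    ring
  have hh'' : UniformRegVary θ (fun x => |deriv (deriv (deriv g)) x|) :=
    .of_regVary (continuous_abs.measurable.comp (measurable_deriv _)) h.h2_RV
  have hQ : UniformRegVary η (fun x => |q x|) := .of_regVary (continuous_abs.measurable.comp hq) hqη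
  set S : ℝ → ℝ := fun x => √(1 / deriv (deriv g) x) with hSdef
  have hS := hh'.sqrt_one_div
  set K : ℝ → ℝ := fun x => |deriv (deriv (deriv g)) x| * S x ^ (3 : ℝ) with hKdef
  have hK := hh''.mul (hS.rpow 3)
  have hKψ : ∀ t, |localSkew g ψ t| = K (ψ t) := fun t => by
    rw [localSkew, abs_mul, abs_pow, localScale, abs_of_nonneg (Real.sqrt_nonneg _), hKdef]
    norm_cast
  have hlog : UniformRegVary 0 (fun x => Real.log (deriv g x)) := by
    have ht : Tendsto (fun x => Real.log (deriv g x)) atTop atTop := by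
      have h1 := hh.rpow_le_and_le_rpow (δ := β / 2) (by linarith)
      exact Real.tendsto_log_atTop.comp (tendsto_atTop_mono' _ (h1.mono fun x hx => hx.1)
        (tendsto_rpow_atTop (by linarith)))
    refine .of_hasDerivAt (F' := fun x => deriv g x * ((β + ε x) / x) / deriv g x)
      (ht.eventually_gt_atTop 0) ?_ ?_
    · filter_upwards [hpos, eventually_gt_atTop 1] with x h1 h2 using (hd x h2).log h1.ne'
    · refine (hβε.div_atTop ht).congr' ?_
      filter_upwards [hpos, eventually_gt_atTop 0] with x h1 h2
      field_simp
  have hwidth : ∀ η > 0, ∀ᶠ t in atTop, localScale g ψ t * (Real.log t / √2) ≤ η * ψ t := by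
    intro η hη
    have h0 := ((hS.mul hlog).mul (UniformRegVary.id.rpow (-1))).tendsto_zero (by linarith)
    have h1 := hψ_top.eventually ((h0.eventually (gt_mem_nhds hη)).and (eventually_gt_atTop 0))
    filter_upwards [hψ, h1, eventually_ge_atTop 1] with t h1 h2 h3
    rw [h1, Real.rpow_neg_one, ← div_eq_mul_inv, div_lt_iff₀ h2.2] at h2
    refine le_trans ?_ h2.1.le
    have : (1 : ℝ) ≤ √2 := Real.one_le_sqrt.mpr (by norm_num)
    exact mul_le_mul_of_nonneg_left (div_le_self (Real.log_nonneg h3) this) (Real.sqrt_nonneg _)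
  have hcover : ∀ η > 0, ∀ᶠ t in atTop, ∀ x,
      |x - ψ t| ≤ localScale g ψ t * (Real.log t / √2) → ∃ s, s = x ∧ |s - ψ t| ≤ η * ψ t := by
    intro η hη
    filter_upwards [hwidth η hη] with t ht x hx using ⟨x, rfl, hx.trans ht⟩
  refine ⟨hψ_top.eventually hh'.pos, ?_, ?_, ?_, ?_, ?_⟩
  · filter_upwards [hwidth (1 / 2) (by norm_num), hψ_top.eventually_gt_atTop 0] with t h1 h2
    linarith
  · set ρ := θ + 3 * (-(1 / 2) * (β + -1 * 1 + 0)) with hρ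
    refine ⟨(|ρ| + 1) / β, ?_⟩
    have h1 := (hK.mul (hh.rpow ((|ρ| + 1) / β))).eventually_one_le (by
      rw [div_mul_cancel₀ _ hβ.ne']
      linarith [neg_abs_le ρ])
    filter_upwards [hψ_top.eventually h1, hψ, eventually_gt_atTop 0] with t h1 h2 h3
    rw [h2] at h1
    rw [hKψ, Real.rpow_neg h3.le, inv_le_iff_one_le_mul₀ (by positivity)]
    exact h1
  · have h1 := (hK.mul (hlog.rpow 3)).tendsto_zero (by linarith)
    refine (h1.comp hψ_top).congr' ?_
    filter_upwards [hψ] with t ht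
    simp only [Function.comp_apply, ht, hKψ, hKdef, hSdef]
  · intro δ hδ
    obtain ⟨X, hX⟩ := eventually_atTop.mp hh''.pos
    set Y := max X 1 with hY
    have hcont : ContinuousOn (deriv (deriv (deriv g))) (Ici Y) := fun x hx => by
      have h1 : Y ≤ x := hx
      exact (hasDerivAt_of_contDiffOn_Ioi hsmooth (x := x)
        (by linarith [le_max_right X 1])).2.2.2.continuousWithinAt
    have hsign := isPreconnected_Ici.eq_or_eq_neg_of_sq_eq (S := Ici Y) hcont.abs hcont
      (fun x _ => by simp) (fun {x} hx => by
        have h1 : Y ≤ x := hx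
        exact abs_pos.mp (hX x (by linarith [le_max_left X 1])))
    filter_upwards [UniformRegVary.eventually_abs_sub_le (P := fun x => x) hh'' hψ_top (Eventually.of_forall fun t => rfl)
      hcover hδ, hwidth (1 / 2) (by norm_num), hψ_top.eventually_ge_atTop (2 * Y)]
      with t h1 h2 h3 x hx
    have hx1 := (abs_le.mp hx).1
    have hY0 : 1 ≤ Y := le_max_right _ _
    have hxY : x ∈ Ici Y := by
      simp only [mem_Ici]
      linarith
    have hψY : ψ t ∈ Ici Y := by
      simp only [mem_Ici]
      linarith
    have h4 := h1 x hx
    rcases hsign with hs | hs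
    · have e1 := hs hxY
      have e2 := hs hψY
      simp only at e1 e2
      rw [e1, e2] at h4
      rwa [e2]
    · have e1 := hs hxY
      have e2 := hs hψY
      simp only [Pi.neg_apply] at e1 e2
      rw [e1, e2, neg_sub_neg, abs_sub_comm] at h4
      rwa [e2]
  · intro δ hδ
    have h0 := (hQ.mul (hK.rpow (-1))).tendsto_zero (by linarith)
    filter_upwards [UniformRegVary.eventually_abs_sub_le (F := fun x => |q x|) (P := fun x => x) hQ
      hψ_top (Eventually.of_forall fun t => rfl)
      hcover one_pos, hψ_top.eventually (h0.eventually (gt_mem_nhds (half_pos hδ))),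
      hψ_top.eventually hK.pos] with t h1 h2 h3 x hx
    rw [Real.rpow_neg_one, ← div_eq_mul_inv, div_lt_iff₀ h3] at h2
    have h4 := (abs_le.mp (h1 x hx)).2
    have h5 : K (ψ t) = |deriv (deriv (deriv g)) (ψ t)| * √(1 / deriv (deriv g) (ψ t)) ^ (3 : ℝ) :=
      rfl
    rw [hKψ, h5]
    linarith

lemma RegVary.congr {ρ : ℝ} {F G : ℝ → ℝ} (hF : RegVary ρ F) (h : F =ᶠ[atTop] G) :
    RegVary ρ G := by
  refine ⟨by filter_upwards [hF.1, h] with x h1 h2; rwa [← h2], fun l hl => (hF.2 l hl).congr' ?_⟩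
  filter_upwards [h, (tendsto_id.const_mul_atTop hl).eventually h] with x h1 h2
  rw [h1]
  exact congrArg (· / G x) h2

lemma laplaceWindow_of_case2 {g ψ q ε : ℝ → ℝ} {c η : ℝ} (hconv : ConvexOn ℝ (Ioi 0) g)
    (hsmooth : ContDiffOn ℝ 4 g (Ioi 0)) (hψ : ∀ᶠ t in atTop, deriv g (ψ t) = t)
    (hψ_top : Tendsto ψ atTop atTop) (hq : Measurable q) (h : Case2 ψ c ε)
    (hη : η < -(1 / 2)) (hqη : RegVary η (fun t => |q (ψ t)|)) :
    LaplaceWindow g ψ q := by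
  have hd : ∀ t > (1 : ℝ), HasDerivAt ψ (ψ t * (ε t / t)) t := by
    intro t ht
    have he : ψ =ᶠ[nhds t] fun y => c * Real.exp (∫ u in (1 : ℝ)..y, ε u / u) := by
      filter_upwards [Ioi_mem_nhds ht] with y hy using h.psi_eq y (le_of_lt hy)
    refine (((hasDerivAt_exp_integral_div h.eps_diff ht).const_mul
      c).congr_of_eventuallyEq he).congr_deriv ?_
    rw [h.psi_eq t ht.le]
    ring
  have hψpos := hψ_top.eventually_gt_atTop 0
  have hinv : ∀ᶠ t in atTop, deriv (deriv g) (ψ t) * (ψ t * (ε t / t)) = 1 := by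
    obtain ⟨T, hT⟩ := eventually_atTop.mp hψ
    filter_upwards [hψpos, eventually_gt_atTop 1, eventually_gt_atTop T] with t h1 h2 h3
    have h4 := (hasDerivAt_of_contDiffOn_Ioi hsmooth h1).2.1.comp t (hd t h2)
    refine h4.unique ((hasDerivAt_id t).congr_of_eventuallyEq ?_)
    filter_upwards [Ioi_mem_nhds h3] with s hs using hT s (le_of_lt hs)
  have hεpos : ∀ᶠ t in atTop, 0 < ε t := by
    filter_upwards [hinv, hψpos, eventually_gt_atTop 0] with t h1 h2 h3
    have hn : 0 ≤ deriv (deriv g) (ψ t) := by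
      rw [← derivWithin_of_isOpen isOpen_Ioi h2]
      exact (hconv.monotoneOn_deriv fun x hx =>
        (hasDerivAt_of_contDiffOn_Ioi hsmooth hx).1.differentiableAt).derivWithin_nonneg
    by_contra! h4
    have h5 : ψ t * (ε t / t) ≤ 0 :=
      mul_nonpos_of_nonneg_of_nonpos h2.le (div_nonpos_of_nonpos_of_nonneg h4 h3.le)
    nlinarith
  have hψR : UniformRegVary 0 ψ := by
    refine .of_hasDerivAt hψpos ((eventually_gt_atTop 1).mono hd) (h.eps_to_zero.congr' ?_)
    filter_upwards [hψpos, eventually_gt_atTop 0] with t h1 h2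
    field_simp
  have hεR : UniformRegVary 0 ε :=
    .of_hasDerivAt hεpos ((eventually_ge_atTop 1).mono fun t ht => (h.eps_diff t ht).hasDerivAt)
      h.eps_ratio1
  have hDR := (hψR.mul hεR).mul (UniformRegVary.id.rpow (-1))
  have hV : ∀ᶠ t in atTop, deriv (deriv g) (ψ t) = t / (ψ t * ε t) := by
    filter_upwards [hinv, hψpos, hεpos, eventually_gt_atTop 0] with t h1 h2 h3 h4
    field_simp at h1 ⊢
    linarith
  have hVR : UniformRegVary (1 + -1 * (0 + 0)) (fun t => deriv (deriv g) (ψ t)) := by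
    refine (UniformRegVary.id.mul ((hψR.mul hεR).rpow (-1))).congr ?_
    filter_upwards [hV] with t ht
    rw [ht, Real.rpow_neg_one, div_eq_mul_inv]
  have hJ : ∀ᶠ t in atTop, deriv (deriv (deriv g)) (ψ t) =
      t * (ψ t * ε t) ^ (-2 : ℝ) * (1 - ε t - t * deriv ε t / ε t) := by
    obtain ⟨T, hT⟩ := eventually_atTop.mp hV
    filter_upwards [hψpos, hεpos, hinv, eventually_gt_atTop 1, eventually_gt_atTop T]
      with t h1 h2 h0 h3 h4
    have h5 := (hasDerivAt_of_contDiffOn_Ioi hsmooth h1).2.2.1.comp t (hd t h3)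
    have h6 := (hasDerivAt_id t).div ((hd t h3).mul (h.eps_diff t h3.le).hasDerivAt)
      (by positivity : ψ t * ε t ≠ 0)
    have h7 := h5.unique (h6.congr_of_eventuallyEq (by
      filter_upwards [Ioi_mem_nhds h4] with s hs using hT s (le_of_lt hs)))
    have h8 : t ≠ 0 := by linarith
    rw [Real.rpow_neg (by positivity), Real.rpow_two]
    simp only [id_eq, Pi.mul_apply] at h7
    field_simp at h7 ⊢
    linarith
  have hJR : UniformRegVary (1 + -2 * (0 + 0) + 0) (fun t => deriv (deriv (deriv g)) (ψ t)) := by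
    have h1 : Tendsto (fun t => 1 - ε t - t * deriv ε t / ε t) atTop (nhds 1) := by
      simpa using (h.eps_to_zero.const_sub 1).sub h.eps_ratio1
    refine ((UniformRegVary.id.mul ((hψR.mul hεR).rpow (-2))).mul
      (.of_tendsto_pos one_pos h1)).congr ?_
    filter_upwards [hJ] with t ht using ht.symm
  have hSR : UniformRegVary _ (localScale g ψ) := hVR.sqrt_one_div
  have hKR : UniformRegVary _ (localSkew g ψ) :=
    (hJR.mul (hSR.rpow 3)).congr (Eventually.of_forall fun t => by
      beta_reduce
      rw [localSkew]
      norm_cast)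
  have hw : ∀ t ≥ (1 : ℝ), localScale g ψ t * (Real.log t / √2) ≤
      localScale g ψ t * Real.log t := fun t ht => by
    have : (1 : ℝ) ≤ √2 := Real.one_le_sqrt.mpr (by norm_num)
    exact mul_le_mul_of_nonneg_left (div_le_self (Real.log_nonneg ht) this) (Real.sqrt_nonneg _)
  have hcover : ∀ η > 0, ∀ᶠ t in atTop, ∀ x,
      |x - ψ t| ≤ localScale g ψ t * (Real.log t / √2) → ∃ s, ψ s = x ∧ |s - t| ≤ η * t := by
    intro η hη
    obtain ⟨κ, hκ, hκ2, hD⟩ := hDR.exists_abs_sub_le (ε := 1 / 2) (by norm_num)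
    set ν := min η κ with hν
    have hν0 : 0 < ν := lt_min hη hκ
    have h0 := ((hSR.mul UniformRegVary.log).mul ((hDR.mul .id).rpow (-1))).tendsto_zero
      (by norm_num)
    filter_upwards [hD, h0.eventually (gt_mem_nhds (half_pos hν0)), hDR.pos,
      eventually_ge_atTop 1, eventually_gt_atTop 2] with t h1 h2 h3 h4 h5 x hx
    set D : ℝ → ℝ := fun t => ψ t * ε t * t ^ (-1 : ℝ) with hDdef
    have h3' : 0 < D t := h3
    have hνt : ν * t ≤ t / 2 := by
      have : ν ≤ κ := min_le_right _ _
      nlinarith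
    have hνt0 : 0 < ν * t := by positivity
    have hder : ∀ s ∈ Icc (t - ν * t) (t + ν * t), HasDerivAt ψ (D s) s ∧ D t / 2 ≤ D s := by
      intro s hs
      refine ⟨(hd s (by linarith [hs.1])).congr_deriv ?_, ?_⟩
      · rw [hDdef]
        beta_reduce
        rw [Real.rpow_neg_one]
        ring
      · have := h1 s (abs_le.mpr (by
          have : ν ≤ κ := min_le_right _ _
          constructor <;> nlinarith [hs.1, hs.2]))
        have h6 := (abs_le.mp this).1
        simp only [hDdef]
        linarith
    have hmv : ∀ a ∈ Icc (t - ν * t) (t + ν * t), ∀ b ∈ Icc (t - ν * t) (t + ν * t), a ≤ b →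
        D t / 2 * (b - a) ≤ ψ b - ψ a := by
      refine (convex_Icc _ _).mul_sub_le_image_sub_of_le_deriv
        (fun s hs => (hder s hs).1.continuousAt.continuousWithinAt)
        (fun s hs => (hder s (interior_subset hs)).1.differentiableAt.differentiableWithinAt)
        (fun s hs => ?_)
      rw [(hder s (interior_subset hs)).1.deriv]
      exact (hder s (interior_subset hs)).2
    have ht0 : t ∈ Icc (t - ν * t) (t + ν * t) := ⟨by linarith, by linarith⟩
    have hl := hmv _ (left_mem_Icc.mpr (by linarith)) t ht0 (by linarith)
    have hr := hmv t ht0 _ (right_mem_Icc.mpr (by linarith)) (by linarith)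
    rw [Real.rpow_neg_one, ← div_eq_mul_inv, div_lt_iff₀ (by positivity)] at h2
    have hx1 := abs_le.mp (hx.trans (hw t h4))
    have h2' : localScale g ψ t * Real.log t < ν / 2 * (D t * t) := h2
    have hmem : x ∈ Icc (ψ (t - ν * t)) (ψ (t + ν * t)) := by
      constructor <;> nlinarith [hx1.1, hx1.2]
    obtain ⟨s, hs, rfl⟩ := intermediate_value_Icc (by linarith)
      (fun s hs => (hder s hs).1.continuousAt.continuousWithinAt) hmem
    refine ⟨s, rfl, (abs_le.mpr ⟨by linarith [hs.1], by linarith [hs.2]⟩ : |s - t| ≤ ν * t).trans ?_⟩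
    have : ν ≤ η := min_le_left _ _
    gcongr
  refine ⟨hVR.pos, ?_, ⟨1, ?_⟩, ?_, ?_, ?_⟩
  · have h0 := ((hSR.mul UniformRegVary.log).mul (hψR.rpow (-1))).tendsto_zero (by norm_num)
    filter_upwards [h0.eventually (gt_mem_nhds one_pos), hψpos, eventually_ge_atTop 1]
      with t h1 h2 h3
    rw [Real.rpow_neg_one, ← div_eq_mul_inv, div_lt_one h2] at h1
    exact (hw t h3).trans_lt h1
  · filter_upwards [hKR.rpow_le_and_le_rpow (δ := 1 / 2) (by norm_num)] with t ht
    refine le_trans ?_ (le_abs_self _)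
    refine (congrArg (t ^ ·) ?_).trans_le ht.1
    norm_num
  · have h0 := (hKR.mul (UniformRegVary.log.rpow 3)).tendsto_zero (by norm_num)
    refine h0.congr' ?_
    filter_upwards [hKR.pos] with t ht
    rw [abs_of_pos ht]
  · intro δ hδ
    filter_upwards [hJR.eventually_abs_sub_le tendsto_id (Eventually.of_forall fun t => rfl)
      hcover hδ, hJR.pos] with t h1 h2 x hx
    rw [abs_of_pos h2]
    exact h1 x hx
  · intro δ hδ
    classical
    have hm : Measurable ((Ioi 1).piecewise ψ fun _ => 0) :=
      ContinuousOn.measurable_piecewise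
        (fun t ht => (hd t ht).continuousAt.continuousWithinAt) continuousOn_const measurableSet_Ioi
    have he : (fun t => |q ((Ioi 1).piecewise ψ (fun _ => 0) t)|) =ᶠ[atTop] fun t => |q (ψ t)| := by
      filter_upwards [eventually_gt_atTop 1] with t ht
      rw [piecewise_eq_of_mem (Ioi 1) _ _ ht]
    have hQ : UniformRegVary η (fun t => |q (ψ t)|) :=
      (UniformRegVary.of_regVary (continuous_abs.measurable.comp (hq.comp hm))
        (hqη.congr he.symm)).congr he
    have h0 := (hQ.mul (hKR.rpow (-1))).tendsto_zero (by linarith)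
    filter_upwards [UniformRegVary.eventually_abs_sub_le (F := fun x => |q x|) hQ tendsto_id
      (Eventually.of_forall fun t => rfl) hcover one_pos,
      h0.eventually (gt_mem_nhds (half_pos hδ)), hKR.pos] with t h1 h2 h3 x hx
    rw [Real.rpow_neg_one, ← div_eq_mul_inv, div_lt_iff₀ h3] at h2
    rw [abs_of_pos h3]
    have h4 := (abs_le.mp (h1 x hx)).2
    rw [id_eq] at h4
    linarith

/-- for every `α ∈ ℕ`, with `Ψ(t,α) = ∫₀^∞ (x − x̂)^α e^{tx} p(x) dx` and
`T₁(t,α)` as in the paper, `Ψ(t,α) = σ̂^{α+1} e^{K(x̂,t)} T₁(t,α)(1 + o(1))` as `t → ∞`. -/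
theorem Psi_asymptotic
    (g ψ q p : ℝ → ℝ)
    (hg_pos : ∀ x > (0:ℝ), 0 < g x)
    (hg_conv : ConvexOn ℝ (Set.Ioi 0) g)
    (hg_smooth : ContDiffOn ℝ 4 g (Set.Ioi 0))
    (hg_super : Tendsto (fun x => g x / x) atTop atTop)
    (hh_mono : ∃ x₀ : ℝ, StrictMonoOn (deriv g) (Set.Ioi x₀))
    (hh_top : Tendsto (deriv g) atTop atTop)
    (hψ_inv : ∀ᶠ t in atTop, deriv g (ψ t) = t)
    (hψ_inv' : ∀ᶠ x in atTop, ψ (deriv g x) = x)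
    (hψ_top : Tendsto ψ atTop atTop)
    (hq_meas : Measurable q)
    (hq_bdd : ∃ M : ℝ, ∀ x ≥ (0:ℝ), |q x| ≤ M)
    (hcase :
      (∃ β c θ ε, Case1 (deriv g) β c θ ε ∧
        ∃ η, η < θ - 3 * β / 2 - 3 / 2 ∧ RegVary η (fun x => |q x|)) ∨
      (∃ c ε, Case2 ψ c ε ∧
        ∃ η, η < -(1/2 : ℝ) ∧ RegVary η (fun t => |q (ψ t)|)))
    (hp : ∀ x, p x = if 0 ≤ x then Real.exp (-(g x - q x)) else 0) :
    ∀ a : ℕ,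
      Tendsto (fun t =>
          (∫ x in Set.Ioi (0:ℝ), (x - ψ t) ^ a * Real.exp (t * x) * p x) /
            ((Real.sqrt (1 / deriv (deriv g) (ψ t))) ^ (a + 1) *
              Real.exp (t * ψ t - g (ψ t)) *
              ((∫ y in
                  (-((((Real.log t) ^ 3) ^ ((1:ℝ)/3)) / Real.sqrt 2))..((((Real.log t) ^ 3) ^ ((1:ℝ)/3)) / Real.sqrt 2),
                  y ^ a * Real.exp (-(y ^ 2) / 2)) -
                iteratedDeriv 2 (deriv g) (ψ t) *
                    (Real.sqrt (1 / deriv (deriv g) (ψ t))) ^ 3 / 6 *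
                  ∫ y in
                    (-((((Real.log t) ^ 3) ^ ((1:ℝ)/3)) / Real.sqrt 2))..((((Real.log t) ^ 3) ^ ((1:ℝ)/3)) / Real.sqrt 2),
                    y ^ (3 + a) * Real.exp (-(y ^ 2) / 2))))
        atTop (nhds 1) := by
  intro a
  have W : LaplaceWindow g ψ q := by
    rcases hcase with ⟨β, c, θ, ε, hC, η, hη, hqη⟩ | ⟨c, ε, hC, η, hη, hqη⟩
    · exact laplaceWindow_of_case1 hg_smooth hψ_inv hψ_top hq_meas hC hη hqη
    · exact laplaceWindow_of_case2 hg_conv hg_smooth hψ_inv hψ_top hq_meas hC hη hqη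
  refine (W.tendsto hg_conv hg_smooth hq_meas hq_bdd hψ_inv a).congr' ?_
  filter_upwards [eventually_ge_atTop 1] with t ht
  have hlog : ((Real.log t) ^ 3) ^ ((1 : ℝ) / 3) = Real.log t := by
    rw [← Real.rpow_natCast, ← Real.rpow_mul (Real.log_nonneg ht)]
    norm_num
  have hint : ∫ x in Ioi (0 : ℝ), (x - ψ t) ^ a * Real.exp (t * x) * p x =
      ∫ x in Ioi (0 : ℝ), (x - ψ t) ^ a * Real.exp (t * x) * Real.exp (-(g x - q x)) :=
    setIntegral_congr_fun measurableSet_Ioi fun x hx => by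
      have : (0 : ℝ) ≤ x := le_of_lt hx
      simp only [hp, if_pos this]
  rw [hint, hlog, iteratedDeriv_succ, iteratedDeriv_one]
  rfl
end
end

section
/- Suppose h belongs to ℛ (i.e. Case 1 or Case 2 holds) and q satisfies the corresponding tail condition. Then the mean of the tilted density admits the refined expansion m(t) = x̂ − (h''(x̂) σ̂⁴ / 2)(1 + o(1)) as t → ∞, i.e. m(t) − ψ(t) ~ −h''(ψ(t)) σ̂⁴ / 2. -/
open Real Filter MeasureTheory Set ProbabilityTheory Asymptotics

noncomputable section

/-- The uniform convergence theorem for regularly varying functions, in additive form. -/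
theorem eventually_forall_abs_sub_lt_of_measurable {k : ℝ → ℝ} (hk : Measurable k)
    (hlim : ∀ u, Tendsto (fun x => k (x + u) - k x) atTop (nhds 0))
    (A : ℝ) {e : ℝ} (he : 0 < e) :
    ∀ᶠ x in atTop, ∀ u, |u| ≤ A → |k (x + u) - k x| < e := by
  by_contra hcon
  rw [not_eventually] at hcon
  have hseq : ∀ n : ℕ, ∃ x, (n : ℝ) ≤ x ∧ ∃ u, |u| ≤ A ∧ e ≤ |k (x + u) - k x| := by
    intro n
    obtain ⟨x, hx, hnx⟩ := (hcon.and_eventually (eventually_ge_atTop (n : ℝ))).exists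
    push Not at hx
    exact ⟨x, hnx, hx⟩
  choose x hx u hu hxu using hseq
  have hxtop : Tendsto x atTop atTop :=
    tendsto_atTop_mono hx tendsto_natCast_atTop_atTop
  have hxutop : Tendsto (fun n => x n + u n) atTop atTop := by
    refine tendsto_atTop_mono (f := fun n => x n + (-A)) (fun n => ?_)
      (tendsto_atTop_add_const_right _ _ hxtop)
    have := (abs_le.1 (hu n)).1
    linarith
  have hmeas : ∀ (y : ℕ → ℝ) (B C : ℝ), Tendsto y atTop atTop →
      Tendsto (fun n => volume.restrict (Icc B C)
        {v | e / 2 ≤ |k (y n + v) - k (y n)|}) atTop (nhds 0) := by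
    intro y B C hy
    have h1 := tendstoInMeasure_of_tendsto_ae (μ := volume.restrict (Icc B C))
      (f := fun (n : ℕ) v => k (y n + v) - k (y n)) (g := fun _ => 0)
      (fun n => ((hk.comp (measurable_const_add (y n))).sub_const _).aestronglyMeasurable)
      (ae_of_all _ fun v => (hlim v).comp hy)
    have h2 := h1 (ENNReal.ofReal (e / 2)) (by simpa using he)
    refine h2.congr fun n => ?_
    congr 1
    ext v
    simp only [mem_ofPred_eq, edist_dist, Real.dist_eq, sub_zero]
    rw [ENNReal.ofReal_le_ofReal_iff (abs_nonneg _)]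
  have hV := hmeas x (-A) (A + 1) hxtop
  have hW := hmeas _ 0 1 hxutop
  have hhalf : (0 : ENNReal) < 1 / 2 := by norm_num
  obtain ⟨n, hVn, hWn⟩ := ((hV.eventually_lt_const hhalf).and
    (hW.eventually_lt_const hhalf)).exists
  set V := {v | e / 2 ≤ |k (x n + v) - k (x n)|} with hVdef
  set W := {v | e / 2 ≤ |k (x n + u n + v) - k (x n + u n)|} with hWdef
  have hmV : MeasurableSet V := measurableSet_le measurable_const (by fun_prop)
  have hmW : MeasurableSet W := measurableSet_le measurable_const (by fun_prop)
  rw [Measure.restrict_apply hmV] at hVn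
  rw [Measure.restrict_apply hmW] at hWn
  have hcover : Icc (0 : ℝ) 1 ⊆
      (W ∩ Icc 0 1) ∪ ((fun v => u n + v) ⁻¹' (V ∩ Icc (-A) (A + 1))) := by
    intro v hv
    by_contra hnot
    simp only [mem_union, mem_inter_iff, hv, and_true, mem_preimage, not_or] at hnot
    obtain ⟨h1, h2⟩ := hnot
    have hmem : u n + v ∈ Icc (-A) (A + 1) := by
      have := abs_le.1 (hu n)
      constructor <;> linarith [hv.1, hv.2]
    have h3 : u n + v ∉ V := fun h => h2 ⟨h, hmem⟩
    simp only [hVdef, hWdef, mem_ofPred_eq, not_le, ← add_assoc] at h1 h3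
    have h4 := hxu n
    have h5 := abs_sub (k (x n + u n + v) - k (x n)) (k (x n + u n + v) - k (x n + u n))
    rw [sub_sub_sub_cancel_left] at h5
    linarith
  have hle := (measure_mono hcover (μ := volume)).trans (measure_union_le _ _)
  rw [measure_preimage_add, Real.volume_Icc] at hle
  have := hle.trans_lt (ENNReal.add_lt_add hWn hVn)
  rw [ENNReal.add_halves] at this
  simp at this

namespace RegVary

variable {α β : ℝ} {f f₁ : ℝ → ℝ}

theorem congr' (hf : RegVary α f) (h : f =ᶠ[atTop] f₁) : RegVary α f₁ := by
  refine ⟨(hf.1.and h).mono fun x hx => hx.2 ▸ hx.1, fun l hl => ?_⟩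
  have hl' : Tendsto (fun t => l * t) atTop atTop := tendsto_id.const_mul_atTop hl
  refine (hf.2 l hl).congr' ?_
  filter_upwards [h, hl'.eventually h] with x h1 h2
  rw [h1, h2]

theorem mul (hf : RegVary α f) (hf₁ : RegVary β f₁) :
    RegVary (α + β) (fun x => f x * f₁ x) := by
  refine ⟨(hf.1.and hf₁.1).mono fun x hx => mul_pos hx.1 hx.2, fun l hl => ?_⟩
  rw [Real.rpow_add hl]
  refine ((hf.2 l hl).mul (hf₁.2 l hl)).congr fun x => ?_
  rw [mul_div_mul_comm]

theorem rpow (hf : RegVary α f) (r : ℝ) : RegVary (α * r) (fun x => f x ^ r) := by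
  refine ⟨hf.1.mono fun x hx => Real.rpow_pos_of_pos hx _, fun l hl => ?_⟩
  have hl' : Tendsto (fun t => l * t) atTop atTop := tendsto_id.const_mul_atTop hl
  rw [Real.rpow_mul hl.le]
  refine ((hf.2 l hl).rpow_const (p := r) (Or.inl (Real.rpow_pos_of_pos hl _).ne')).congr' ?_
  filter_upwards [hf.1, hl'.eventually hf.1] with x h1 h2
  rw [Real.div_rpow h2.le h1.le]

theorem of_tendsto {c : ℝ} (hc : 0 < c) (h : Tendsto f atTop (nhds c)) : RegVary 0 f := by
  refine ⟨h.eventually_const_lt hc, fun l hl => ?_⟩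
  have hl' : Tendsto (fun t => l * t) atTop atTop := tendsto_id.const_mul_atTop hl
  rw [Real.rpow_zero, ← div_self hc.ne']
  exact (h.comp hl').div h hc.ne'

theorem id : RegVary 1 (fun x => x) := by
  refine ⟨eventually_gt_atTop 0, fun l hl => ?_⟩
  refine tendsto_const_nhds.congr' ?_
  filter_upwards [eventually_gt_atTop 0] with x hx
  field_simp
  simp

/-- A function whose logarithmic derivative is asymptotic to `α / x` varies regularly. -/
theorem of_deriv {f' : ℝ → ℝ} (hpos : ∀ᶠ x in atTop, 0 < f x)
    (hd : ∀ᶠ x in atTop, HasDerivAt f (f' x) x)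
    (hlim : Tendsto (fun x => x * f' x / f x) atTop (nhds α)) : RegVary α f := by
  refine ⟨hpos, fun l hl => ?_⟩
  have hl' : Tendsto (fun t => l * t) atTop atTop := tendsto_id.const_mul_atTop hl
  suffices h : Tendsto (fun t => Real.log (f (l * t)) - Real.log (f t)) atTop
      (nhds (α * Real.log l)) by
    have h2 := (Real.continuous_exp.tendsto _).comp h
    rw [mul_comm, ← Real.rpow_def_of_pos hl] at h2
    refine h2.congr' ?_
    filter_upwards [hpos, hl'.eventually hpos] with x h1 h3
    rw [Function.comp_apply, Real.exp_sub, Real.exp_log h1, Real.exp_log h3]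
  rw [Metric.tendsto_nhds]
  intro e he
  set δ := e / (2 * (|Real.log l| + 1)) with hδ
  have hδ0 : 0 < δ := by positivity
  have hmin : 0 < min l 1 := lt_min hl one_pos
  have hmin' : Tendsto (fun t => min l 1 * t) atTop atTop := tendsto_id.const_mul_atTop hmin
  have hall := ((hpos.and hd).and ((Metric.tendsto_nhds.1 hlim δ hδ0).and
    (eventually_gt_atTop 0)))
  obtain ⟨X, hX⟩ := eventually_atTop.1 hall
  filter_upwards [hmin'.eventually_ge_atTop X, eventually_gt_atTop 0] with x hx hx0
  have hderiv : ∀ v ∈ uIcc (Real.log x) (Real.log (l * x)),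
      HasDerivWithinAt (fun v => Real.log (f (Real.exp v)) - α * v)
        (Real.exp v * f' (Real.exp v) / f (Real.exp v) - α)
        (uIcc (Real.log x) (Real.log (l * x))) v ∧
      ‖Real.exp v * f' (Real.exp v) / f (Real.exp v) - α‖ ≤ δ := by
    intro v hv
    have hvX : X ≤ Real.exp v := by
      refine hx.trans ?_
      rw [mem_uIcc] at hv
      rw [← Real.log_le_iff_le_exp (by positivity)]
      rcases hv with hv | hv
      · exact (Real.log_le_log (by positivity)
          (by nlinarith [min_le_right l 1])).trans hv.1
      · exact (Real.log_le_log (by positivity)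
          (by nlinarith [min_le_left l 1])).trans hv.1
    obtain ⟨⟨h1, h2⟩, h3, h4⟩ := hX _ hvX
    refine ⟨?_, by simpa [Real.dist_eq] using h3.le⟩
    have h5 := ((h2.comp v (Real.hasDerivAt_exp v)).log h1.ne').sub
      ((hasDerivAt_id v).const_mul α)
    refine (h5.congr_deriv ?_).hasDerivWithinAt
    simp [mul_comm]
  have hmv := Convex.norm_image_sub_le_of_norm_hasDerivWithin_le
    (fun v hv => (hderiv v hv).1) (fun v hv => (hderiv v hv).2) (convex_uIcc _ _)
    left_mem_uIcc right_mem_uIcc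
  rw [Real.exp_log hx0, Real.exp_log (by positivity), Real.log_mul hl.ne' hx0.ne'] at hmv
  rw [Real.dist_eq]
  have h6 : Real.log (f (l * x)) - Real.log (f x) - α * Real.log l =
    Real.log (f (l * x)) - α * (Real.log l + Real.log x) -
      (Real.log (f x) - α * Real.log x) := by ring
  rw [h6]
  refine hmv.trans_lt ?_
  rw [add_sub_cancel_right, Real.norm_eq_abs, hδ, div_mul_eq_mul_div, div_lt_iff₀ (by positivity)]
  nlinarith [abs_nonneg (Real.log l)]

/-- The centred additive version of a regularly varying function has vanishing increments. -/
theorem tendsto_log_exp_sub (hf : RegVary α f) (u : ℝ) :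
    Tendsto (fun v => (Real.log (f (Real.exp (v + u))) - α * (v + u)) -
      (Real.log (f (Real.exp v)) - α * v)) atTop (nhds 0) := by
  have h1 := (hf.2 (Real.exp u) (Real.exp_pos u)).log (by positivity)
  rw [Real.log_rpow (Real.exp_pos u), Real.log_exp] at h1
  have h2 : Tendsto (fun t => Real.exp u * t) atTop atTop :=
    tendsto_id.const_mul_atTop (Real.exp_pos u)
  have h3 := (h1.sub_const (α * u)).comp Real.tendsto_exp_atTop
  rw [sub_self] at h3
  refine h3.congr' ?_
  filter_upwards [Real.tendsto_exp_atTop.eventually hf.1,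
    Real.tendsto_exp_atTop.eventually (h2.eventually hf.1)] with v h4 h5
  simp only [Function.comp_apply]
  rw [Real.log_div h5.ne' h4.ne', Real.exp_add, mul_comm (Real.exp u)]
  ring

theorem eventually_forall_abs_log_lt (hf : RegVary α f) (hm : Measurable f) (A : ℝ)
    {e : ℝ} (he : 0 < e) :
    ∀ᶠ v in atTop, ∀ u, |u| ≤ A →
      |(Real.log (f (Real.exp (v + u))) - α * (v + u)) -
        (Real.log (f (Real.exp v)) - α * v)| < e :=
  eventually_forall_abs_sub_lt_of_measurable
    (k := fun v => Real.log (f (Real.exp v)) - α * v) (by fun_prop)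
    hf.tendsto_log_exp_sub A he

/-- A measurable regularly varying function is relatively constant on short windows. -/
theorem exists_forall_abs_sub_le (hf : RegVary α f) (hm : Measurable f) {e : ℝ} (he : 0 < e) :
    ∃ d, 0 < d ∧ d ≤ 1 / 2 ∧ ∀ᶠ x in atTop, ∀ z, |z - x| ≤ d * x →
      0 < f z ∧ |f z - f x| ≤ e * f x := by
  have hexp : ∃ a > 0, ∀ y : ℝ, |y| < a → |Real.exp y - 1| < e := by
    have := Metric.tendsto_nhds_nhds.1 (Real.continuous_exp.tendsto 0) e he
    simpa [Real.dist_eq] using this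
  obtain ⟨a, ha, hexp⟩ := hexp
  have hlog : ∃ d > 0, ∀ y : ℝ, |y - 1| < d → |α * Real.log y| < a / 2 := by
    have h1 : ContinuousAt (fun y => α * Real.log y) 1 :=
      (Real.continuousAt_log one_ne_zero).const_mul α
    have := Metric.tendsto_nhds_nhds.1 h1 (a / 2) (by positivity)
    simpa [Real.dist_eq] using this
  obtain ⟨d, hd, hlog⟩ := hlog
  refine ⟨min (d / 2) (1 / 2), by positivity, min_le_right _ _, ?_⟩
  have h1 := Real.tendsto_log_atTop.eventually
    (hf.eventually_forall_abs_log_lt hm (Real.log 2) (half_pos ha))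
  obtain ⟨X, hX⟩ := eventually_atTop.1 hf.1
  filter_upwards [h1, eventually_gt_atTop 0, eventually_ge_atTop (2 * X), eventually_ge_atTop X]
    with x h1 hx0 hxX hxX' z hz
  have hz1 : |z - x| ≤ d / 2 * x := hz.trans (by gcongr; exact min_le_left _ _)
  have hz2 : |z - x| ≤ 1 / 2 * x := hz.trans (by gcongr; exact min_le_right _ _)
  have hz3 := abs_le.1 hz2
  have hz0 : 0 < z := by linarith
  have hfz := hX z (by linarith)
  have hfx := hX x hxX'
  refine ⟨hfz, ?_⟩
  have hzx : |Real.log (z / x)| ≤ Real.log 2 := by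
    rw [abs_le, ← Real.log_inv]
    constructor
    · refine Real.log_le_log (by positivity) ?_
      rw [le_div_iff₀ hx0]; linarith
    · refine Real.log_le_log (by positivity) ?_
      rw [div_le_iff₀ hx0]; linarith
  have h2 := h1 _ hzx
  have h3 : Real.log x + Real.log (z / x) = Real.log z := by
    rw [Real.log_div hz0.ne' hx0.ne']; ring
  have h4 : |z / x - 1| < d := by
    rw [div_sub_one hx0.ne', abs_div, abs_of_pos hx0, div_lt_iff₀ hx0]
    nlinarith
  have h5 := hlog _ h4
  rw [h3, Real.exp_log hz0, Real.exp_log hx0] at h2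
  have h6 : |Real.log (f z / f x)| < a := by
    rw [Real.log_div hfz.ne' hfx.ne']
    have h7 : Real.log (f z) - Real.log (f x) = (Real.log (f z) - α * Real.log z -
      (Real.log (f x) - α * Real.log x)) + α * Real.log (z / x) := by
      rw [Real.log_div hz0.ne' hx0.ne']; ring
    rw [h7]
    exact (abs_add_le _ _).trans_lt (by linarith)
  have h8 := hexp _ h6
  rw [Real.exp_log (by positivity), div_sub_one hfx.ne', abs_div, abs_of_pos hfx,
    div_lt_iff₀ hfx] at h8
  exact h8.le

/-- Power bounds for measurable regularly varying functions. -/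
theorem eventually_rpow_le_and_le (hf : RegVary α f) (hm : Measurable f) {a : ℝ} (ha : 0 < a) :
    ∀ᶠ x in atTop, x ^ (α - a) ≤ f x ∧ f x ≤ x ^ (α + a) := by
  obtain ⟨U, hU⟩ := eventually_atTop.1
    (hf.eventually_forall_abs_log_lt hm 1 (half_pos ha))
  set k : ℝ → ℝ := fun v => Real.log (f (Real.exp v)) - α * v with hk
  have hstep : ∀ n : ℕ, ∀ v : ℝ, 0 ≤ v → v ≤ n → |k (U + v) - k U| ≤ a / 2 * n := by
    intro n
    induction n with
    | zero =>
      intro v h0 h1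
      obtain rfl : v = 0 := le_antisymm (by simpa using h1) h0
      simp
    | succ n ih =>
      intro v h0 h1
      push_cast at h1 ⊢
      rcases le_total v 1 with hv | hv
      · have := (hU U le_rfl v (by rwa [abs_of_nonneg h0])).le
        nlinarith [(Nat.cast_nonneg n : (0 : ℝ) ≤ n)]
      · have h2 := ih (v - 1) (by linarith) (by linarith)
        have h3 := hU (U + (v - 1)) (by linarith) 1 (by simp)
        have h4 : U + (v - 1) + 1 = U + v := by ring
        rw [h4] at h3
        have h5 := abs_sub_le (k (U + v)) (k (U + (v - 1))) (k U)
        have h6 : |k (U + v) - k (U + (v - 1))| < a / 2 := h3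
        linarith
  have hmain : ∀ᶠ v in atTop, |k v| ≤ a * v := by
    filter_upwards [eventually_ge_atTop U,
      eventually_ge_atTop (2 / a * (|k U| + a / 2 * (1 - U)))] with v h1 h2
    have h3 := hstep ⌈v - U⌉₊ (v - U) (by linarith) (Nat.le_ceil _)
    have h4 := Nat.ceil_lt_add_one (sub_nonneg.2 h1)
    rw [add_sub_cancel] at h3
    have h5 : |k v| ≤ |k v - k U| + |k U| := by
      simpa using abs_add_le (k v - k U) (k U)
    have h6 : |k U| + a / 2 * (1 - U) ≤ a / 2 * v := by
      calc _ = a / 2 * (2 / a * (|k U| + a / 2 * (1 - U))) := by field_simp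
        _ ≤ _ := by gcongr
    nlinarith
  filter_upwards [Real.tendsto_log_atTop.eventually hmain, hf.1, eventually_gt_atTop 0]
    with x h1 h2 h3
  simp only [hk, Real.exp_log h3] at h1
  have h4 := abs_le.1 h1
  rw [Real.rpow_def_of_pos h3, Real.rpow_def_of_pos h3, ← Real.le_log_iff_exp_le h2,
    ← Real.log_le_iff_le_exp h2]
  constructor <;> nlinarith

end RegVary

theorem le_of_sub_mul_deriv_nonneg {φ φ' : ℝ → ℝ} {a R x : ℝ}
    (hd : ∀ z, |z - a| ≤ R → HasDerivAt φ (φ' z) z)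
    (hs : ∀ z, |z - a| ≤ R → 0 ≤ (z - a) * φ' z) (hx : |x - a| ≤ R) : φ a ≤ φ x := by
  have hx' := abs_le.1 hx
  rcases lt_trichotomy a x with h | h | h
  · have hmem : ∀ z ∈ Icc a x, |z - a| ≤ R := fun z hz => by
      rw [abs_of_nonneg (by linarith [hz.1])]; linarith [hz.2]
    obtain ⟨c, hc, hc'⟩ := exists_hasDerivAt_eq_slope φ φ' h
      (fun z hz => (hd z (hmem z hz)).continuousAt.continuousWithinAt)
      (fun z hz => hd z (hmem z (Ioo_subset_Icc_self hz)))
    have h1 := hs c (hmem c (Ioo_subset_Icc_self hc))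
    have h2 : 0 ≤ φ' c := nonneg_of_mul_nonneg_right h1 (by linarith [hc.1])
    rw [hc', le_div_iff₀ (by linarith)] at h2
    linarith
  · rw [h]
  · have hmem : ∀ z ∈ Icc x a, |z - a| ≤ R := fun z hz => by
      rw [abs_of_nonpos (by linarith [hz.2])]; linarith [hz.1]
    obtain ⟨c, hc, hc'⟩ := exists_hasDerivAt_eq_slope φ φ' h
      (fun z hz => (hd z (hmem z hz)).continuousAt.continuousWithinAt)
      (fun z hz => hd z (hmem z (Ioo_subset_Icc_self hz)))
    have h1 := hs c (hmem c (Ioo_subset_Icc_self hc))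
    have h2 : φ' c ≤ 0 := by
      by_contra hcon
      push Not at hcon
      nlinarith [hc.2]
    rw [hc', div_le_iff₀ (by linarith)] at h2
    linarith

/-- The tilted weight `exp (t x - g x)`, normalised at `a`. -/
def tiltWeight (g : ℝ → ℝ) (t a x : ℝ) : ℝ := Real.exp (t * (x - a) - (g x - g a))

theorem tiltWeight_pos (g : ℝ → ℝ) (t a x : ℝ) : 0 < tiltWeight g t a x := Real.exp_pos _

section

variable {g h : ℝ → ℝ} {t a s N κ d : ℝ}

theorem tiltWeight_hasDerivAt {x : ℝ} (hd : HasDerivAt g (h x) x) :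
    HasDerivAt (tiltWeight g t a) (tiltWeight g t a x * (t - h x)) x := by
  have h1 := ((((hasDerivAt_id x).sub_const a).const_mul t).sub (hd.sub_const (g a))).exp
  refine h1.congr_deriv ?_
  simp [tiltWeight]

/-- If `g' - t` is within relative error `d` of the line `(x - a) / s²`, the weight is squeezed
between two Gaussians. -/
theorem gaussian_bounds_tiltWeight (hs : 0 < s) {x : ℝ}
    (hd : ∀ x, |x - a| ≤ s * N → HasDerivAt g (h x) x)
    (hlin : ∀ x, |x - a| ≤ s * N → |h x - t - (x - a) / s ^ 2| ≤ d * |x - a| / s ^ 2)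
    (hx : |x - a| ≤ s * N) :
    tiltWeight g t a x ≤ Real.exp (-((1 - d) * (x - a) ^ 2 / (2 * s ^ 2))) ∧
      Real.exp (-((1 + d) * (x - a) ^ 2 / (2 * s ^ 2))) ≤ tiltWeight g t a x := by
  have hsq : ∀ c z : ℝ, HasDerivAt (fun z => c * (z - a) ^ 2 / (2 * s ^ 2))
      (c * (z - a) / s ^ 2) z := by
    intro c z
    have h1 := (((((hasDerivAt_id z).sub_const a).pow 2).const_mul c).div_const (2 * s ^ 2))
    refine h1.congr_deriv ?_
    simp
    field_simp
  have hlinear : ∀ z : ℝ, HasDerivAt (fun z => t * (z - a)) t z := by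
    intro z
    simpa using (((hasDerivAt_id z).sub_const a).const_mul t)
  have hkey : ∀ z, |z - a| ≤ s * N →
      |(z - a) * (h z - t - (z - a) / s ^ 2)| ≤ d * (z - a) ^ 2 / s ^ 2 := by
    intro z hz
    rw [abs_mul]
    calc |z - a| * |h z - t - (z - a) / s ^ 2| ≤ |z - a| * (d * |z - a| / s ^ 2) := by
          gcongr; exact hlin z hz
      _ = d * |z - a| ^ 2 / s ^ 2 := by ring
      _ = _ := by rw [sq_abs]
  constructor
  · have h1 := le_of_sub_mul_deriv_nonneg (x := x)
      (φ := fun z => g z - t * (z - a) - (1 - d) * (z - a) ^ 2 / (2 * s ^ 2))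
      (fun z hz => ((hd z hz).sub (hlinear z)).sub (hsq (1 - d) z))
      (fun z hz => ?_) hx
    · simp only [sub_self] at h1
      refine Real.exp_le_exp.2 ?_
      norm_num at h1
      linarith
    · have h2 := (abs_le.1 (hkey z hz)).1
      have h3 : (z - a) * (h z - t - (1 - d) * (z - a) / s ^ 2) =
        (z - a) * (h z - t - (z - a) / s ^ 2) + d * (z - a) ^ 2 / s ^ 2 := by ring
      rw [h3]; linarith
  · have h1 := le_of_sub_mul_deriv_nonneg (x := x)
      (φ := fun z => (1 + d) * (z - a) ^ 2 / (2 * s ^ 2) - (g z - t * (z - a)))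
      (fun z hz => (hsq (1 + d) z).sub ((hd z hz).sub (hlinear z)))
      (fun z hz => ?_) hx
    · simp only [sub_self] at h1
      refine Real.exp_le_exp.2 ?_
      norm_num at h1
      linarith
    · have h2 := (abs_le.1 (hkey z hz)).2
      have h3 : (z - a) * ((1 + d) * (z - a) / s ^ 2 - (h z - t)) =
        d * (z - a) ^ 2 / s ^ 2 - (z - a) * (h z - t - (z - a) / s ^ 2) := by ring
      rw [h3]; linarith

/-- Outside the window the weight decays exponentially, by convexity of `g`. -/
theorem tiltWeight_le_of_le_abs (hconv : ConvexOn ℝ (Ioi 0) g) (hs : 0 < s) (hN : 1 ≤ N)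
    (hNa : s * N < a) (hd2 : d ≤ 1 / 2)
    (hd : ∀ x, |x - a| ≤ s * N → HasDerivAt g (h x) x)
    (hlin : ∀ x, |x - a| ≤ s * N → |h x - t - (x - a) / s ^ 2| ≤ d * |x - a| / s ^ 2)
    {x : ℝ} (hx0 : 0 < x) (hx : s * N ≤ |x - a|) :
    tiltWeight g t a x ≤ Real.exp (-N ^ 2 / 8) * Real.exp (-|x - a| / (8 * s)) := by
  set L := s * N with hL
  have hL0 : 0 < L := by positivity
  set y := |x - a| with hy
  have hy0 : 0 < y := hL0.trans_le hx
  set z := a + L / y * (x - a) with hz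
  have hza : |z - a| = L := by
    rw [hz, add_sub_cancel_left, abs_mul, abs_of_pos (by positivity), ← hy]
    field_simp
  have hz1 : tiltWeight g t a z ≤ Real.exp (-((1 - d) * (z - a) ^ 2 / (2 * s ^ 2))) :=
    (gaussian_bounds_tiltWeight hs hd hlin hza.le).1
  rw [← sq_abs, hza, tiltWeight, Real.exp_le_exp] at hz1
  have hz2 : (1 - d) * L ^ 2 / (2 * s ^ 2) = (1 - d) * N ^ 2 / 2 := by
    rw [hL]; field_simp
  rw [hz2] at hz1
  have hLy : L / y ≤ 1 := (div_le_one hy0).2 hx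
  have hc := hconv.2 (mem_Ioi.2 (hL0.trans hNa)) (mem_Ioi.2 hx0) (sub_nonneg.2 hLy)
    (by positivity : 0 ≤ L / y) (by ring)
  have hz3 : (1 - L / y) • a + (L / y) • x = z := by
    rw [hz]; simp only [smul_eq_mul]; ring
  rw [hz3] at hc
  simp only [smul_eq_mul] at hc
  have h1 : N ^ 2 / 4 ≤ L / y * ((g x - g a) - t * (x - a)) := by
    have : z - a = L / y * (x - a) := by rw [hz]; ring
    rw [this] at hz1
    nlinarith
  have h2 : y / (4 * s) * N ≤ (g x - g a) - t * (x - a) := by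
    rw [div_mul_eq_mul_div, le_div_iff₀ hy0, hL] at h1
    have h3 : y / (4 * s) * N = (N ^ 2 / 4 * y) / (s * N) := by field_simp
    rw [h3, div_le_iff₀ (by positivity)]
    linarith
  rw [tiltWeight, ← Real.exp_add, Real.exp_le_exp]
  have h3 : N ≤ y / s := by rw [le_div_iff₀ hs]; linarith
  have h4 : y / (4 * s) * N = (y / s) * N / 4 := by field_simp
  have h5 : -y / (8 * s) = - (y / s) / 8 := by field_simp
  rw [h5]
  rw [h4] at h2
  have h6 : N * N ≤ y / s * N := by gcongr
  have h7 : y / s * 1 ≤ y / s * N := by gcongr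
  linarith

set_option maxHeartbeats 800000 in
/-- The three window moments of the tilted weight, computed by integrating by parts. -/
theorem window_moments (hs : 0 < s) (hN : 1 ≤ N) (hd0 : 0 < d) (hd2 : d ≤ 1 / 10)
    (hd : ∀ x, |x - a| ≤ s * N → HasDerivAt g (h x) x)
    (hcont : ContinuousOn h (Icc (a - s * N) (a + s * N)))
    (hquad : ∀ x, |x - a| ≤ s * N →
      |h x - t - (x - a) / s ^ 2 - κ * (x - a) ^ 2 / 2| ≤ d * |κ| * (x - a) ^ 2 / 2)
    (hlin : ∀ x, |x - a| ≤ s * N → |h x - t - (x - a) / s ^ 2| ≤ d * |x - a| / s ^ 2)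
    (hNr : N * (|κ| * s ^ 3) ≤ d) (hE : Real.exp (-N ^ 2 / 8) ≤ d * (|κ| * s ^ 3)) :
    s / 2 ≤ ∫ x in (a - s * N)..(a + s * N), tiltWeight g t a x ∧
    (∫ x in (a - s * N)..(a + s * N), (x - a) ^ 2 * tiltWeight g t a x) ≤
      2 * s ^ 2 * ∫ x in (a - s * N)..(a + s * N), tiltWeight g t a x ∧
    |(∫ x in (a - s * N)..(a + s * N), (x - a) * tiltWeight g t a x) +
      κ * s ^ 4 / 2 * ∫ x in (a - s * N)..(a + s * N), tiltWeight g t a x| ≤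
      7 * d * |κ| * s ^ 4 * ∫ x in (a - s * N)..(a + s * N), tiltWeight g t a x := by
  set W := tiltWeight g t a with hW
  set L := s * N with hL
  have hL0 : 0 < L := by positivity
  have hsL : s ≤ L := by rw [hL]; nlinarith
  have hlr : a - L ≤ a + L := by linarith
  have hmem : ∀ x ∈ Icc (a - L) (a + L), |x - a| ≤ L := fun x hx =>
    abs_le.2 ⟨by linarith [hx.1], by linarith [hx.2]⟩
  have hWd : ∀ x ∈ Icc (a - L) (a + L), HasDerivAt W (W x * (t - h x)) x :=
    fun x hx => tiltWeight_hasDerivAt (hd x (hmem x hx))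
  have hWc : ContinuousOn W (Icc (a - L) (a + L)) :=
    fun x hx => (hWd x hx).continuousAt.continuousWithinAt
  have hInt : ∀ {f : ℝ → ℝ}, ContinuousOn f (Icc (a - L) (a + L)) →
      IntervalIntegrable f volume (a - L) (a + L) := fun hf =>
    (hf.mono (by rw [uIcc_of_le hlr])).intervalIntegrable
  have hWpos : ∀ x, 0 < W x := tiltWeight_pos g t a
  have hWE : ∀ x, |x - a| = L → W x ≤ d * (|κ| * s ^ 3) := by
    intro x hx
    refine ((gaussian_bounds_tiltWeight hs hd hlin hx.le).1.trans ?_).trans hE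
    rw [← sq_abs, hx, hL, Real.exp_le_exp]
    have : (1 - d) * (s * N) ^ 2 / (2 * s ^ 2) = (1 - d) * N ^ 2 / 2 := by field_simp
    rw [this]
    nlinarith [sq_nonneg N]
  have hWl := hWE (a - L) (by rw [sub_sub_cancel_left, abs_neg, abs_of_pos hL0])
  have hWr := hWE (a + L) (by rw [add_sub_cancel_left, abs_of_pos hL0])
  set r := |κ| * s ^ 3 with hr
  have hr0 : 0 ≤ r := by positivity
  set I0 := ∫ x in (a - L)..(a + L), W x with hI0
  set I1 := ∫ x in (a - L)..(a + L), (x - a) * W x with hI1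
  set I2 := ∫ x in (a - L)..(a + L), (x - a) ^ 2 * W x with hI2
  have hI2nn : 0 ≤ I2 := intervalIntegral.integral_nonneg hlr
    (fun x _ => mul_nonneg (sq_nonneg _) (hWpos x).le)
  have hbase : s / 2 ≤ I0 := by
    have h1 : ∫ x in (a - s)..(a + s), (1 / 4 : ℝ) ≤ ∫ x in (a - s)..(a + s), W x := by
      have hsub : Icc (a - s) (a + s) ⊆ Icc (a - L) (a + L) :=
        Icc_subset_Icc (by linarith) (by linarith)
      refine intervalIntegral.integral_mono_on (by linarith) (by simp)
        ((hWc.mono (by rw [uIcc_of_le (by linarith)]; exact hsub)).intervalIntegrable)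
        fun x hx => ?_
      refine le_trans ?_ (gaussian_bounds_tiltWeight hs hd hlin (hmem x (hsub hx))).2
      have h2 : (1 + d) * (x - a) ^ 2 / (2 * s ^ 2) ≤ 1 := by
        rw [div_le_one (by positivity)]
        have h3 : (x - a) ^ 2 ≤ s ^ 2 :=
          sq_le_sq' (by linarith [hx.1]) (by linarith [hx.2])
        nlinarith [sq_nonneg s]
      refine le_trans ?_ (Real.exp_le_exp.2 (neg_le_neg h2))
      rw [Real.exp_neg, ← one_div]
      exact one_div_le_one_div_of_le (Real.exp_pos 1) (by linarith [Real.exp_one_lt_d9])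
    have h2 : ∫ x in (a - s)..(a + s), W x ≤ I0 := by
      refine intervalIntegral.integral_mono_interval (by linarith) (by linarith) (by linarith)
        (ae_of_all _ fun x => (hWpos x).le) (hInt hWc)
    rw [intervalIntegral.integral_const, smul_eq_mul] at h1
    linarith
  have hi1 : IntervalIntegrable (fun x => (x - a) * (h x - t) * W x) volume (a - L) (a + L) :=
    hInt (by fun_prop)
  have hi2 : IntervalIntegrable (fun x => (x - a) ^ 2 * W x / s ^ 2) volume (a - L) (a + L) :=
    hInt (by fun_prop)
  have hi3 : IntervalIntegrable (fun x => (h x - t) * W x) volume (a - L) (a + L) :=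
    hInt (by fun_prop)
  have hi4 : IntervalIntegrable (fun x => (x - a) * W x / s ^ 2) volume (a - L) (a + L) :=
    hInt (by fun_prop)
  have hi6 : IntervalIntegrable (fun x => (x - a) ^ 2 * W x) volume (a - L) (a + L) :=
    hInt (by fun_prop)
  have hi5 : IntervalIntegrable (fun x => κ / 2 * ((x - a) ^ 2 * W x)) volume
      (a - L) (a + L) := hi6.const_mul _
  have hsecond : |I2 / s ^ 2 - I0| ≤ d * (I2 / s ^ 2) + 4 * d ^ 2 * I0 := by
    have hparts : ∫ x in (a - L)..(a + L), (W x - (x - a) * (h x - t) * W x) =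
        L * W (a + L) + L * W (a - L) := by
      rw [intervalIntegral.integral_eq_sub_of_hasDerivAt (f := fun x => (x - a) * W x)]
      · ring
      · intro x hx
        rw [uIcc_of_le hlr] at hx
        refine (((hasDerivAt_id x).sub_const a).mul (hWd x hx)).congr_deriv ?_
        simp only [id]
        ring
      · exact (hInt hWc).sub hi1
    have hle : |∫ x in (a - L)..(a + L),
        ((x - a) * (h x - t) * W x - (x - a) ^ 2 * W x / s ^ 2)| ≤
        ∫ x in (a - L)..(a + L), d * ((x - a) ^ 2 * W x / s ^ 2) := by
      rw [← Real.norm_eq_abs]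
      refine intervalIntegral.norm_integral_le_of_norm_le hlr
        (ae_of_all _ fun x hx => ?_) (hi2.const_mul d)
      have h1 := hlin x (hmem x (Ioc_subset_Icc_self hx))
      have h2 : (x - a) * (h x - t) * W x - (x - a) ^ 2 * W x / s ^ 2 =
        (x - a) * (h x - t - (x - a) / s ^ 2) * W x := by ring
      rw [h2, Real.norm_eq_abs, abs_mul, abs_mul, abs_of_pos (hWpos x)]
      calc |x - a| * |h x - t - (x - a) / s ^ 2| * W x
          ≤ |x - a| * (d * |x - a| / s ^ 2) * W x := by have := (hWpos x).le; gcongr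
        _ = d * (|x - a| ^ 2 * W x / s ^ 2) := by ring
        _ = _ := by rw [sq_abs]
    rw [intervalIntegral.integral_sub (hInt hWc) hi1] at hparts
    rw [intervalIntegral.integral_sub hi1 hi2,
      intervalIntegral.integral_const_mul, intervalIntegral.integral_div] at hle
    set J := ∫ x in (a - L)..(a + L), (x - a) * (h x - t) * W x
    have h3 : |J - I0| ≤ 4 * d ^ 2 * I0 := by
      have h4 : I0 - J = L * W (a + L) + L * W (a - L) := hparts
      have h5 : 0 < W (a + L) := hWpos _
      have h6 : 0 < W (a - L) := hWpos _
      have h7 : L * (d * r) ≤ s * d ^ 2 := by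
        rw [hL]
        calc s * N * (d * r) = s * d * (N * r) := by ring
          _ ≤ s * d * d := by gcongr
          _ = _ := by ring
      rw [abs_sub_comm, h4, abs_of_nonneg (by positivity)]
      have h8 : L * W (a + L) ≤ L * (d * r) := by gcongr
      have h9 : L * W (a - L) ≤ L * (d * r) := by gcongr
      nlinarith [sq_nonneg d]
    have h10 := abs_sub_le (I2 / s ^ 2) J I0
    rw [abs_sub_comm (I2 / s ^ 2) J] at h10
    linarith
  have hI0pos : 0 < I0 := by linarith
  have hI2nn' : 0 ≤ I2 / s ^ 2 := by positivity
  have hdd : 4 * d ^ 2 * I0 ≤ d * I0 := by nlinarith [mul_pos hd0 hI0pos]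
  have hI2le : I2 / s ^ 2 ≤ 2 * I0 := by
    have := (abs_le.1 hsecond).2
    nlinarith
  have hI2close : |I2 / s ^ 2 - I0| ≤ 3 * d * I0 := by nlinarith
  refine ⟨hbase, ?_, ?_⟩
  · rw [div_le_iff₀ (by positivity)] at hI2le
    linarith
  have hparts : ∫ x in (a - L)..(a + L), (h x - t) * W x = W (a - L) - W (a + L) := by
    rw [intervalIntegral.integral_eq_sub_of_hasDerivAt (f := fun x => - W x)]
    · ring
    · intro x hx
      rw [uIcc_of_le hlr] at hx
      refine (hWd x hx).neg.congr_deriv ?_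
      ring
    · exact hi3
  have hle : |∫ x in (a - L)..(a + L),
      ((h x - t) * W x - (x - a) * W x / s ^ 2 - κ / 2 * ((x - a) ^ 2 * W x))| ≤
      ∫ x in (a - L)..(a + L), d * |κ| / 2 * ((x - a) ^ 2 * W x) := by
    rw [← Real.norm_eq_abs]
    refine intervalIntegral.norm_integral_le_of_norm_le hlr
      (ae_of_all _ fun x hx => ?_) (hi6.const_mul _)
    have h1 := hquad x (hmem x (Ioc_subset_Icc_self hx))
    have h2 : (h x - t) * W x - (x - a) * W x / s ^ 2 - κ / 2 * ((x - a) ^ 2 * W x) =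
      (h x - t - (x - a) / s ^ 2 - κ * (x - a) ^ 2 / 2) * W x := by ring
    rw [h2, Real.norm_eq_abs, abs_mul, abs_of_pos (hWpos x)]
    calc _ ≤ (d * |κ| * (x - a) ^ 2 / 2) * W x := by have := (hWpos x).le; gcongr
      _ = _ := by ring
  rw [intervalIntegral.integral_sub (hi3.sub hi4) hi5, intervalIntegral.integral_sub hi3 hi4,
    intervalIntegral.integral_const_mul, intervalIntegral.integral_const_mul,
    intervalIntegral.integral_div, hparts] at hle
  change |W (a - L) - W (a + L) - I1 / s ^ 2 - κ / 2 * I2| ≤ d * |κ| / 2 * I2 at hle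
  have hB : |W (a - L) - W (a + L)| ≤ 2 * d * r * (I0 / s) := by
    have h1 : 1 / 2 ≤ I0 / s := by rw [le_div_iff₀ hs]; linarith
    have h2 : |W (a - L) - W (a + L)| ≤ d * r :=
      abs_le.2 ⟨by linarith [hWpos (a - L)], by linarith [hWpos (a + L)]⟩
    nlinarith [mul_nonneg hd0.le hr0]
  have hkey : I1 + κ * s ^ 4 / 2 * I0 = s ^ 2 * (W (a - L) - W (a + L)) -
      s ^ 2 * (W (a - L) - W (a + L) - I1 / s ^ 2 - κ / 2 * I2) -
      κ * s ^ 4 / 2 * (I2 / s ^ 2 - I0) := by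
    field_simp
    ring
  rw [hkey]
  refine (abs_sub _ _).trans ?_
  have h1 : |κ * s ^ 4 / 2 * (I2 / s ^ 2 - I0)| ≤ |κ| * s ^ 4 / 2 * (3 * d * I0) := by
    rw [abs_mul, abs_div, abs_mul, abs_of_pos (by positivity : 0 < s ^ 4), abs_two]
    gcongr
  have h2 : |s ^ 2 * (W (a - L) - W (a + L))| ≤ s ^ 2 * (2 * d * r * (I0 / s)) := by
    rw [abs_mul, abs_of_pos (by positivity : 0 < s ^ 2)]
    gcongr
  have h3 : |s ^ 2 * (W (a - L) - W (a + L) - I1 / s ^ 2 - κ / 2 * I2)| ≤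
      s ^ 2 * (d * |κ| / 2 * (2 * s ^ 2 * I0)) := by
    rw [abs_mul, abs_of_pos (by positivity : 0 < s ^ 2)]
    rw [div_le_iff₀ (by positivity)] at hI2le
    have : I2 ≤ 2 * s ^ 2 * I0 := by linarith
    refine mul_le_mul_of_nonneg_left (hle.trans ?_) (by positivity)
    gcongr
  have h4 : s ^ 2 * (2 * d * r * (I0 / s)) = 2 * (d * |κ| * s ^ 4 * I0) := by
    rw [hr]; field_simp
  have h5 : 0 ≤ d * |κ| * s ^ 4 * I0 := by positivity
  have h6 := abs_sub (s ^ 2 * (W (a - L) - W (a + L)))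
    (s ^ 2 * (W (a - L) - W (a + L) - I1 / s ^ 2 - κ / 2 * I2))
  rw [h4] at h2
  linarith

end

theorem integral_exp_neg_abs_sub_div {b : ℝ} (hb : 0 < b) (a : ℝ) :
    ∫ x, Real.exp (-|x - a| / b) = 2 * b := by
  rw [integral_sub_right_eq_self (fun x => Real.exp (-|x| / b)) a,
    integral_comp_abs (f := fun x => Real.exp (-x / b))]
  have h1 : ∀ x : ℝ, -x / b = -b⁻¹ * x := fun x => by field_simp
  simp_rw [h1]
  rw [integral_exp_mul_Ioi (by simpa using hb)]
  simp

theorem integrable_exp_neg_abs_sub_div {b : ℝ} (hb : 0 < b) (a : ℝ) :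
    Integrable (fun x : ℝ => Real.exp (-|x - a| / b)) := by
  refine Integrable.of_integral_ne_zero ?_
  rw [integral_exp_neg_abs_sub_div hb]
  positivity

section

variable {g h q u : ℝ → ℝ} {t a s N κ d M B ρ E : ℝ}

/-- Replacing the full perturbed moment by the unperturbed moment over the window. -/
theorem integral_perturbed_sub_window_le (hs : 0 < s) (hN : 1 ≤ N) (hNa : s * N < a)
    (hE : 0 ≤ E) (hgc : ContinuousOn g (Ioi 0)) (hu : Continuous u) (hB : 0 ≤ B)
    (huB : ∀ x, |u x| ≤ B * Real.exp (|x - a| / (16 * s)))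
    (htail : ∀ x, 0 < x → s * N ≤ |x - a| →
      tiltWeight g t a x ≤ E * Real.exp (-|x - a| / (8 * s)))
    (hqm : Measurable q) (hqM : ∀ x ≥ 0, |q x| ≤ M)
    (hρ1 : ρ ≤ 1) (hqρ : ∀ x, |x - a| ≤ s * N → |q x| ≤ ρ) :
    IntegrableOn (fun x => u x * (tiltWeight g t a x * Real.exp (q x))) (Ioi 0) ∧
    |(∫ x in Ioi 0, u x * (tiltWeight g t a x * Real.exp (q x))) -
      ∫ x in (a - s * N)..(a + s * N), u x * tiltWeight g t a x| ≤
      2 * ρ * (∫ x in (a - s * N)..(a + s * N), |u x| * tiltWeight g t a x) +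
        Real.exp M * E * (B * (32 * s)) := by
  set W := tiltWeight g t a with hW
  set L := s * N with hL
  have hL0 : 0 < L := by positivity
  have hlr : a - L ≤ a + L := by linarith
  have hWpos : ∀ x, 0 < W x := tiltWeight_pos g t a
  have hsub : Ioc (a - L) (a + L) ⊆ Ioi 0 := fun x hx => by
    simp only [mem_Ioi]; linarith [hx.1]
  have hsub' : Icc (a - L) (a + L) ⊆ Ioi 0 := fun x hx => by
    simp only [mem_Ioi]; linarith [hx.1]
  have hWc : ContinuousOn W (Ioi 0) := by
    unfold W tiltWeight
    fun_prop
  have hmeas : AEStronglyMeasurable (fun x => u x * (W x * Real.exp (q x)))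
      (volume.restrict (Ioi 0)) :=
    hu.aestronglyMeasurable.mul ((hWc.aestronglyMeasurable measurableSet_Ioi).mul
      (by fun_prop : Measurable fun x => Real.exp (q x)).aestronglyMeasurable)
  have hwin : ∀ {f : ℝ → ℝ}, ContinuousOn f (Ioi 0) →
      IntegrableOn f (Ioc (a - L) (a + L)) := fun hf =>
    ((hf.mono hsub').integrableOn_Icc).mono_set Ioc_subset_Icc_self
  have hind : ∀ {f : ℝ → ℝ}, ContinuousOn f (Ioi 0) →
      IntegrableOn ((Ioc (a - L) (a + L)).indicator f) (Ioi 0) := fun hf =>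
    ((integrable_indicator_iff measurableSet_Ioc).2 (hwin hf)).integrableOn
  have hindint : ∀ f : ℝ → ℝ, ∫ x in Ioi 0, (Ioc (a - L) (a + L)).indicator f x =
      ∫ x in (a - L)..(a + L), f x := fun f => by
    rw [intervalIntegral.integral_of_le hlr, setIntegral_indicator measurableSet_Ioc,
      inter_eq_right.2 hsub]
  have hbig : 0 < 16 * s := by positivity
  set D : ℝ → ℝ := fun x => Real.exp M * E * (B * Real.exp (-|x - a| / (16 * s))) with hD
  have hDi : Integrable D := ((integrable_exp_neg_abs_sub_div hbig a).const_mul B).const_mul _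
  have hDnn : ∀ x, 0 ≤ D x := fun x => by positivity
  have hpoint : ∀ x ∈ Ioi (0 : ℝ), ‖u x * (W x * Real.exp (q x)) -
      (Ioc (a - L) (a + L)).indicator (fun x => u x * W x) x‖ ≤
      2 * ρ * (Ioc (a - L) (a + L)).indicator (fun x => |u x| * W x) x + D x := by
    intro x hx
    have hx' : 0 < x := hx
    by_cases hxw : x ∈ Ioc (a - L) (a + L)
    · have hxa : |x - a| ≤ L := abs_le.2 ⟨by linarith [hxw.1], by linarith [hxw.2]⟩
      have h1 := hqρ x hxa
      have h2 := Real.abs_exp_sub_one_le (h1.trans hρ1)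
      rw [indicator_of_mem hxw, indicator_of_mem hxw]
      have h3 : u x * (W x * Real.exp (q x)) - u x * W x =
        (u x * W x) * (Real.exp (q x) - 1) := by ring
      rw [h3, norm_mul, Real.norm_eq_abs, Real.norm_eq_abs, abs_mul, abs_of_pos (hWpos x)]
      have h4 : |Real.exp (q x) - 1| ≤ 2 * ρ := by linarith
      have h5 : |u x| * W x * |Real.exp (q x) - 1| ≤ |u x| * W x * (2 * ρ) := by
        have := (hWpos x).le
        gcongr
      linarith [hDnn x]
    · rw [indicator_of_notMem hxw, indicator_of_notMem hxw, mul_zero, zero_add, sub_zero]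
      have hxa : L ≤ |x - a| := by
        by_contra hcon
        push Not at hcon
        have := abs_lt.1 hcon
        exact hxw ⟨by linarith, by linarith⟩
      have h1 := htail x hx' hxa
      have h2 : Real.exp (q x) ≤ Real.exp M :=
        Real.exp_le_exp.2 ((le_abs_self _).trans (hqM x hx'.le))
      rw [norm_mul, norm_mul, Real.norm_eq_abs, Real.norm_eq_abs, Real.norm_eq_abs,
        abs_of_pos (hWpos x), abs_of_pos (Real.exp_pos _)]
      calc |u x| * (W x * Real.exp (q x))
          ≤ (B * Real.exp (|x - a| / (16 * s))) *
            ((E * Real.exp (-|x - a| / (8 * s))) * Real.exp M) := by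
            have := (hWpos x).le
            gcongr
            exact huB x
        _ = Real.exp M * E * (B * (Real.exp (|x - a| / (16 * s)) *
            Real.exp (-|x - a| / (8 * s)))) := by ring
        _ = D x := by
            rw [← Real.exp_add, hD]
            congr 4
            field_simp
            ring
  have hdom : IntegrableOn (fun x =>
      2 * ρ * (Ioc (a - L) (a + L)).indicator (fun x => |u x| * W x) x + D x) (Ioi 0) :=
    ((hind (by fun_prop)).const_mul _).add hDi.integrableOn
  have hdiff : IntegrableOn (fun x => u x * (W x * Real.exp (q x)) -
      (Ioc (a - L) (a + L)).indicator (fun x => u x * W x) x) (Ioi 0) := by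
    refine Integrable.mono' hdom (hmeas.sub (hind (by fun_prop)).aestronglyMeasurable) ?_
    exact (ae_restrict_iff' measurableSet_Ioi).2 (ae_of_all _ hpoint)
  have hwini : IntegrableOn ((Ioc (a - L) (a + L)).indicator (fun x => u x * W x)) (Ioi 0) :=
    hind (by fun_prop)
  have hfull : IntegrableOn (fun x => u x * (W x * Real.exp (q x))) (Ioi 0) := by
    refine (hdiff.add hwini).congr (ae_of_all _ fun x => ?_)
    simp
  refine ⟨hfull, ?_⟩
  rw [← hindint, ← integral_sub hfull hwini]
  refine (norm_integral_le_of_norm_le hdom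
    ((ae_restrict_iff' measurableSet_Ioi).2 (ae_of_all _ hpoint))).trans ?_
  rw [integral_add ((hind (by fun_prop)).const_mul _) hDi.integrableOn, integral_const_mul,
    hindint]
  gcongr
  refine (setIntegral_le_integral hDi (ae_of_all _ hDnn)).trans ?_
  rw [hD, integral_const_mul, integral_const_mul, integral_exp_neg_abs_sub_div hbig]
  apply le_of_eq
  ring

/-- Second order Laplace estimate for the mean of the tilted density, at a fixed tilt. -/
theorem abs_tilted_moment_add_le (hconv : ConvexOn ℝ (Ioi 0) g) (hs : 0 < s) (hN : 1 ≤ N)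
    (hNa : s * N < a) (hd0 : 0 < d) (hd2 : d ≤ 1 / 10) (hdM : (4 + 128 * Real.exp M) * d ≤ 1)
    (hd : ∀ x > 0, HasDerivAt g (h x) x) (hcont : ContinuousOn h (Ioi 0))
    (hquad : ∀ x, |x - a| ≤ s * N →
      |h x - t - (x - a) / s ^ 2 - κ * (x - a) ^ 2 / 2| ≤ d * |κ| * (x - a) ^ 2 / 2)
    (hNr : N * (|κ| * s ^ 3) ≤ d) (hE : Real.exp (-N ^ 2 / 8) ≤ d * (|κ| * s ^ 3))
    (hqm : Measurable q) (hqM : ∀ x ≥ 0, |q x| ≤ M)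
    (hq : ∀ x, |x - a| ≤ s * N → |q x| ≤ d * (|κ| * s ^ 3)) :
    IntegrableOn (fun x => tiltWeight g t a x * Real.exp (q x)) (Ioi 0) ∧
    IntegrableOn (fun x => (x - a) * (tiltWeight g t a x * Real.exp (q x))) (Ioi 0) ∧
    0 < ∫ x in Ioi 0, tiltWeight g t a x * Real.exp (q x) ∧
    |(∫ x in Ioi 0, (x - a) * (tiltWeight g t a x * Real.exp (q x))) +
      κ * s ^ 4 / 2 * ∫ x in Ioi 0, tiltWeight g t a x * Real.exp (q x)| ≤
      (22 + 2112 * Real.exp M) * d * |κ| * s ^ 4 *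
        ∫ x in Ioi 0, tiltWeight g t a x * Real.exp (q x) := by
  have hpos : ∀ x, |x - a| ≤ s * N → 0 < x := fun x hx => by
    have := (abs_le.1 hx).1
    linarith
  set r := |κ| * s ^ 3 with hr
  have hr0 : 0 ≤ r := by positivity
  have hrd : r ≤ d := by nlinarith
  have hlin : ∀ x, |x - a| ≤ s * N → |h x - t - (x - a) / s ^ 2| ≤ d * |x - a| / s ^ 2 := by
    intro x hx
    have h1 := hquad x hx
    have h2 : |h x - t - (x - a) / s ^ 2| ≤ |κ| * (x - a) ^ 2 / 2 + d * |κ| * (x - a) ^ 2 / 2 := by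
      have h3 := abs_add_le (h x - t - (x - a) / s ^ 2 - κ * (x - a) ^ 2 / 2)
        (κ * (x - a) ^ 2 / 2)
      rw [sub_add_cancel, abs_div, abs_mul, abs_of_nonneg (sq_nonneg (x - a)), abs_two] at h3
      linarith
    have h4 : |κ| * (x - a) ^ 2 ≤ d * |x - a| / s ^ 2 := by
      rw [le_div_iff₀ (by positivity), ← sq_abs (x - a)]
      calc |κ| * |x - a| ^ 2 * s ^ 2 = |κ| * |x - a| * s ^ 2 * |x - a| := by ring
        _ ≤ |κ| * (s * N) * s ^ 2 * |x - a| := by gcongr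
        _ = N * r * |x - a| := by rw [hr]; ring
        _ ≤ d * |x - a| := by gcongr
    have h5 : 0 ≤ |κ| * (x - a) ^ 2 := by positivity
    nlinarith
  have hgc : ContinuousOn g (Ioi 0) := fun x hx => (hd x hx).continuousAt.continuousWithinAt
  have htail := fun x hx0 hx => tiltWeight_le_of_le_abs (x := x) hconv hs hN hNa
    (by linarith) (fun x hx => hd x (hpos x hx)) hlin hx0 hx
  have hEnn := (Real.exp_pos (-N ^ 2 / 8)).le
  obtain ⟨hbase, hI2, hI1⟩ := window_moments hs hN hd0 hd2 (fun x hx => hd x (hpos x hx))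
    (hcont.mono fun x hx => by simp only [mem_Ioi]; linarith [hx.1]) hquad hlin hNr hE
  have hρ1 : d * r ≤ 1 := by nlinarith
  obtain ⟨hi0, hJ0⟩ := integral_perturbed_sub_window_le (u := fun _ => 1) (B := 1) hs hN hNa hEnn
    hgc continuous_const zero_le_one
    (fun x => by rw [abs_one, one_mul]; exact Real.one_le_exp (by positivity))
    htail hqm hqM hρ1 hq
  obtain ⟨hi1, hJ1⟩ := integral_perturbed_sub_window_le (u := fun x => x - a) (B := 16 * s)
    hs hN hNa hEnn hgc (by fun_prop) (by positivity)
    (fun x => by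
      have h1 := Real.add_one_le_exp (|x - a| / (16 * s))
      have h2 : |x - a| / (16 * s) ≤ Real.exp (|x - a| / (16 * s)) := by linarith
      rw [div_le_iff₀ (by positivity)] at h2
      linarith)
    htail hqm hqM hρ1 hq
  simp only [one_mul, abs_one] at hi0 hJ0
  refine ⟨hi0, hi1, ?_⟩
  set W := tiltWeight g t a with hW
  have hWpos : ∀ x, 0 < W x := tiltWeight_pos g t a
  have hsN : 0 < s * N := by positivity
  have hlr : a - s * N ≤ a + s * N := by linarith
  have hWc : ContinuousOn W (Icc (a - s * N) (a + s * N)) := by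
    have : Icc (a - s * N) (a + s * N) ⊆ Ioi 0 := fun x hx => by
      simp only [mem_Ioi]; linarith [hx.1]
    have := hgc.mono this
    unfold W tiltWeight
    fun_prop
  have hInt : ∀ {f : ℝ → ℝ}, ContinuousOn f (Icc (a - s * N) (a + s * N)) →
      IntervalIntegrable f volume (a - s * N) (a + s * N) := fun hf =>
    (hf.mono (by rw [uIcc_of_le hlr])).intervalIntegrable
  have hW2i : IntervalIntegrable (fun x => (x - a) ^ 2 * W x) volume (a - s * N) (a + s * N) :=
    hInt (by fun_prop)
  have hWai : IntervalIntegrable (fun x => |x - a| * W x) volume (a - s * N) (a + s * N) :=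
    hInt (by fun_prop)
  set I0 := ∫ x in (a - s * N)..(a + s * N), W x with hI0def
  set I2 := ∫ x in (a - s * N)..(a + s * N), (x - a) ^ 2 * W x with hI2def
  have hI0pos : 0 < I0 := by linarith
  have habs : ∫ x in (a - s * N)..(a + s * N), |x - a| * W x ≤ 3 / 2 * s * I0 := by
    have h1 : ∫ x in (a - s * N)..(a + s * N), |x - a| * W x ≤
        ∫ x in (a - s * N)..(a + s * N), (s / 2 * W x + 1 / (2 * s) * ((x - a) ^ 2 * W x)) := by
      refine intervalIntegral.integral_mono_on hlr hWai
        (((hInt hWc).const_mul _).add (hW2i.const_mul _)) fun x _ => ?_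
      have h2 : |x - a| ≤ s / 2 + 1 / (2 * s) * (x - a) ^ 2 := by
        rw [← sub_nonneg, ← sq_abs (x - a)]
        have : s / 2 + 1 / (2 * s) * |x - a| ^ 2 - |x - a| = (|x - a| - s) ^ 2 / (2 * s) := by
          field_simp; ring
        rw [this]; positivity
      calc |x - a| * W x ≤ (s / 2 + 1 / (2 * s) * (x - a) ^ 2) * W x := by
            have := (hWpos x).le
            gcongr
        _ = _ := by ring
    rw [intervalIntegral.integral_add ((hInt hWc).const_mul _) (hW2i.const_mul _),
      intervalIntegral.integral_const_mul, intervalIntegral.integral_const_mul] at h1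
    refine h1.trans ?_
    have h3 : 1 / (2 * s) * I2 ≤ 1 / (2 * s) * (2 * s ^ 2 * I0) := by gcongr
    have h4 : 1 / (2 * s) * (2 * s ^ 2 * I0) = s * I0 := by field_simp
    change s / 2 * I0 + 1 / (2 * s) * I2 ≤ _
    linarith
  set J0 := ∫ x in Ioi 0, W x * Real.exp (q x) with hJ0def
  set J1 := ∫ x in Ioi 0, (x - a) * (W x * Real.exp (q x)) with hJ1def
  set I1 := ∫ x in (a - s * N)..(a + s * N), (x - a) * W x with hI1def
  set C := Real.exp M with hC
  have hC0 : 0 < C := Real.exp_pos _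
  set P := d * r * I0 with hP
  have hP0 : 0 ≤ P := by positivity
  have hexps : C * Real.exp (-N ^ 2 / 8) * (32 * s) ≤ 64 * C * P := by
    calc C * Real.exp (-N ^ 2 / 8) * (32 * s) ≤ C * (d * r) * (32 * (2 * I0)) := by
          gcongr; linarith
      _ = _ := by rw [hP]; ring
  have hJ0' : |J0 - I0| ≤ (2 + 64 * C) * P := by
    refine hJ0.trans ?_
    have : 2 * (d * r) * I0 = 2 * P := by rw [hP]; ring
    linarith
  have hJ1' : |J1 - I1| ≤ (3 + 1024 * C) * (s * P) := by
    refine hJ1.trans ?_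
    have h1 : 2 * (d * r) * (∫ x in (a - s * N)..(a + s * N), |x - a| * W x) ≤
        2 * (d * r) * (3 / 2 * s * I0) := by gcongr
    have h2 : 2 * (d * r) * (3 / 2 * s * I0) = 3 * (s * P) := by rw [hP]; ring
    have h3 : C * Real.exp (-N ^ 2 / 8) * (16 * s * (32 * s)) ≤ 1024 * C * (s * P) := by
      calc _ = 16 * s * (C * Real.exp (-N ^ 2 / 8) * (32 * s)) := by ring
        _ ≤ 16 * s * (64 * C * P) := by gcongr
        _ = _ := by ring
    linarith
  have hsP : s * P = d * |κ| * s ^ 4 * I0 := by rw [hP, hr]; ring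
  have hPd : P ≤ d * I0 := by
    rw [hP]
    have : r ≤ 1 := by linarith
    calc d * r * I0 ≤ d * 1 * I0 := by gcongr
      _ = _ := by ring
  have hdiffhalf : (2 + 64 * C) * P ≤ I0 / 2 := by
    calc (2 + 64 * C) * P ≤ (2 + 64 * C) * (d * I0) := by gcongr
      _ = ((4 + 128 * C) * d) * I0 / 2 := by ring
      _ ≤ 1 * I0 / 2 := by gcongr
      _ = _ := by ring
  have hI0J0 : I0 ≤ 2 * J0 := by linarith [(abs_le.1 hJ0').1]
  refine ⟨by linarith, ?_⟩
  have hcorr : |κ * s ^ 4 / 2 * (J0 - I0)| ≤ (1 + 32 * C) * (s * P) := by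
    rw [abs_mul, abs_div, abs_mul, abs_of_pos (by positivity : 0 < s ^ 4), abs_two]
    calc |κ| * s ^ 4 / 2 * |J0 - I0| ≤ |κ| * s ^ 4 / 2 * ((2 + 64 * C) * P) := by gcongr
      _ = (1 + 32 * C) * (s * (r * P)) := by rw [hr]; ring
      _ ≤ (1 + 32 * C) * (s * (1 * P)) := by
        have : r ≤ 1 := by linarith
        gcongr
      _ = _ := by ring
  have hsplit : J1 + κ * s ^ 4 / 2 * J0 =
      (J1 - I1) + (I1 + κ * s ^ 4 / 2 * I0) + κ * s ^ 4 / 2 * (J0 - I0) := by ring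
  have hI1' : |I1 + κ * s ^ 4 / 2 * I0| ≤ 7 * (s * P) := by
    rw [hsP]; linarith
  rw [hsplit]
  have htri := abs_add_three (J1 - I1) (I1 + κ * s ^ 4 / 2 * I0) (κ * s ^ 4 / 2 * (J0 - I0))
  have htot : (11 + 1056 * C) * (s * P) ≤ (22 + 2112 * C) * d * |κ| * s ^ 4 * J0 := by
    rw [hsP]
    calc (11 + 1056 * C) * (d * |κ| * s ^ 4 * I0)
        ≤ (11 + 1056 * C) * (d * |κ| * s ^ 4 * (2 * J0)) := by gcongr
      _ = _ := by ring
  linarith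

end

/-- Differentiation under the integral sign for a Laplace transform finite on `(0, ∞)`. -/
theorem hasDerivAt_integral_exp_mul {p : ℝ → ℝ} (hp0 : ∀ x, 0 ≤ p x) (hpm : AEMeasurable p)
    (hInt : ∀ t > (0 : ℝ), Integrable (fun x => Real.exp (t * x) * p x)) {t : ℝ} (ht : 0 < t) :
    HasDerivAt (fun u => ∫ x, Real.exp (u * x) * p x)
      (∫ x, x * (Real.exp (t * x) * p x)) t := by
  set μ : Measure ℝ := volume.withDensity (fun x => ENNReal.ofReal (p x)) with hμ
  have hm : AEMeasurable (fun x => ENNReal.ofReal (p x)) := hpm.ennreal_ofReal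
  have hlt : ∀ᵐ x, ENNReal.ofReal (p x) < ⊤ := ae_of_all _ fun x => ENNReal.ofReal_lt_top
  have hintegral : ∀ f : ℝ → ℝ, ∫ x, f x ∂μ = ∫ x, f x * p x := fun f => by
    rw [hμ, integral_withDensity_eq_integral_toReal_smul₀ hm hlt]
    simp only [ENNReal.toReal_ofReal (hp0 _), smul_eq_mul, mul_comm]
  have hset : Ioi (0 : ℝ) ⊆ integrableExpSet (fun x : ℝ => x) μ := fun u hu => by
    rw [integrableExpSet, mem_ofPred_eq, hμ, integrable_withDensity_iff_integrable_smul₀' hm hlt]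
    simpa only [ENNReal.toReal_ofReal (hp0 _), smul_eq_mul, mul_comm] using hInt u hu
  have hmem : t ∈ interior (integrableExpSet (fun x : ℝ => x) μ) :=
    interior_maximal hset isOpen_Ioi ht
  have hder := hasDerivAt_mgf hmem
  have hmgf : mgf (fun x : ℝ => x) μ = fun u => ∫ x, Real.exp (u * x) * p x := by
    ext u
    rw [mgf, hintegral]
  rw [hmgf, hintegral] at hder
  simpa only [mul_assoc] using hder

theorem deriv_log_laplace_sub {g q p Φ : ℝ → ℝ} {t a : ℝ}
    (hgc : ContinuousOn g (Ioi 0)) (hqm : Measurable q)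
    (hp : ∀ x, p x = if 0 ≤ x then Real.exp (-(g x - q x)) else 0)
    (hΦ : ∀ t, Φ t = ∫ x, Real.exp (t * x) * p x)
    (hΦ_int : ∀ t > (0:ℝ), Integrable (fun x => Real.exp (t * x) * p x)) (ht : 0 < t)
    (hi0 : IntegrableOn (fun x => tiltWeight g t a x * Real.exp (q x)) (Ioi 0))
    (hi1 : IntegrableOn (fun x => (x - a) * (tiltWeight g t a x * Real.exp (q x))) (Ioi 0))
    (hpos : 0 < ∫ x in Ioi 0, tiltWeight g t a x * Real.exp (q x)) :
    deriv (fun u => Real.log (Φ u)) t - a =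
      (∫ x in Ioi 0, (x - a) * (tiltWeight g t a x * Real.exp (q x))) /
        ∫ x in Ioi 0, tiltWeight g t a x * Real.exp (q x) := by
  have hp0 : ∀ x, 0 ≤ p x := fun x => by
    rw [hp]
    split_ifs
    exacts [(Real.exp_pos _).le, le_rfl]
  have hne : ∀ᵐ x : ℝ, x ≠ 0 := by simp [ae_iff]
  have hpae : p =ᵐ[volume] (Ioi 0).indicator (fun x => Real.exp (-(g x - q x))) := by
    filter_upwards [hne] with x hx
    rw [hp, indicator]
    simp only [mem_Ioi]
    have : 0 ≤ x ↔ 0 < x := ⟨fun h => lt_of_le_of_ne h (Ne.symm hx), le_of_lt⟩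
    simp [this]
  have hpm : AEMeasurable p := by
    refine AEMeasurable.congr ?_ hpae.symm
    rw [aemeasurable_indicator_iff measurableSet_Ioi]
    have h1 : AEMeasurable g (volume.restrict (Ioi 0)) := hgc.aemeasurable measurableSet_Ioi
    fun_prop
  set c := Real.exp (t * a - g a) with hc
  have hc0 : 0 < c := Real.exp_pos _
  have htrans : ∀ f : ℝ → ℝ, ∫ x, f x * (Real.exp (t * x) * p x) =
      c * ∫ x in Ioi 0, f x * (tiltWeight g t a x * Real.exp (q x)) := by
    intro f
    rw [← integral_const_mul, ← integral_indicator measurableSet_Ioi]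
    refine integral_congr_ae ?_
    filter_upwards [hpae] with x hx
    rw [hx]
    by_cases hx0 : x ∈ Ioi (0 : ℝ)
    · rw [indicator_of_mem hx0, indicator_of_mem hx0, ← Real.exp_add, tiltWeight, hc,
        ← Real.exp_add, mul_left_comm, ← Real.exp_add]
      congr 2
      ring
    · rw [indicator_of_notMem hx0, indicator_of_notMem hx0]
      simp
  have hder := hasDerivAt_integral_exp_mul hp0 hpm hΦ_int ht
  have hfun : (fun u => ∫ x, Real.exp (u * x) * p x) = Φ := funext fun u => (hΦ u).symm
  rw [hfun] at hder
  have h0 := htrans (fun _ => 1)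
  have h1 := htrans (fun x => x)
  simp only [one_mul] at h0
  rw [← hΦ] at h0
  have h2 : ∫ x in Ioi 0, x * (tiltWeight g t a x * Real.exp (q x)) =
      (∫ x in Ioi 0, (x - a) * (tiltWeight g t a x * Real.exp (q x))) +
        a * ∫ x in Ioi 0, tiltWeight g t a x * Real.exp (q x) := by
    rw [← integral_const_mul, ← integral_add hi1 (hi0.const_mul a)]
    congr 1
    ext x
    ring
  rw [(hder.log (by rw [h0]; positivity)).deriv, h1, h0, h2]
  field_simp
  ring

/-- The refined mean expansion, reduced to conditions on a window of half-width `s t * N t`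
around the saddle point `ψ t`. -/
theorem tendsto_mean_ratio {g ψ q p Φ h s N κ : ℝ → ℝ}
    (hconv : ConvexOn ℝ (Ioi 0) g)
    (hd : ∀ x > 0, HasDerivAt g (h x) x) (hcont : ContinuousOn h (Ioi 0))
    (hqm : Measurable q) {M : ℝ} (hqM : ∀ x ≥ 0, |q x| ≤ M)
    (hp : ∀ x, p x = if 0 ≤ x then Real.exp (-(g x - q x)) else 0)
    (hΦ : ∀ t, Φ t = ∫ x, Real.exp (t * x) * p x)
    (hΦ_int : ∀ t > (0:ℝ), Integrable (fun x => Real.exp (t * x) * p x))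
    (hs : ∀ᶠ t in atTop, 0 < s t) (hκ : ∀ᶠ t in atTop, κ t ≠ 0)
    (hN : ∀ᶠ t in atTop, 1 ≤ N t) (hNψ : ∀ᶠ t in atTop, s t * N t < ψ t)
    (hquad : ∀ d > 0, ∀ᶠ t in atTop, ∀ x, |x - ψ t| ≤ s t * N t →
      |h x - t - (x - ψ t) / s t ^ 2 - κ t * (x - ψ t) ^ 2 / 2| ≤
        d * |κ t| * (x - ψ t) ^ 2 / 2)
    (hNr : ∀ d > 0, ∀ᶠ t in atTop, N t * (|κ t| * s t ^ 3) ≤ d)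
    (hE : ∀ d > 0, ∀ᶠ t in atTop, Real.exp (-N t ^ 2 / 8) ≤ d * (|κ t| * s t ^ 3))
    (hq : ∀ d > 0, ∀ᶠ t in atTop, ∀ x, |x - ψ t| ≤ s t * N t →
      |q x| ≤ d * (|κ t| * s t ^ 3)) :
    Tendsto (fun t => (deriv (fun u => Real.log (Φ u)) t - ψ t) / (-κ t * s t ^ 4 / 2))
      atTop (nhds 1) := by
  rw [Metric.tendsto_nhds]
  intro e he
  set C := Real.exp M with hC
  have hC0 : 0 < C := Real.exp_pos M
  set d := min (1 / 10) (min (1 / (4 + 128 * C)) (e / (4 * (22 + 2112 * C)))) with hdd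
  have hd0 : 0 < d := by positivity
  have hd1 : d ≤ 1 / 10 := min_le_left _ _
  have hd2 : d ≤ 1 / (4 + 128 * C) := (min_le_right _ _).trans (min_le_left _ _)
  have hd3 : d ≤ e / (4 * (22 + 2112 * C)) := (min_le_right _ _).trans (min_le_right _ _)
  have hgc : ContinuousOn g (Ioi 0) := fun x hx => (hd x hx).continuousAt.continuousWithinAt
  filter_upwards [hs, hκ, hN, hNψ, hquad d hd0, hNr d hd0, hE d hd0, hq d hd0,
    eventually_gt_atTop 0] with t h1 h2 h3 h4 h5 h6 h7 h8 ht
  rw [le_div_iff₀ (by positivity)] at hd2 hd3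
  obtain ⟨hi0, hi1, hJ, hmain⟩ := abs_tilted_moment_add_le (a := ψ t) (t := t) hconv h1 h3 h4 hd0
    hd1 (by linarith) hd hcont h5 h6 h7 hqm hqM h8
  rw [deriv_log_laplace_sub hgc hqm hp hΦ hΦ_int ht hi0 hi1 hJ]
  set J0 := ∫ x in Ioi 0, tiltWeight g t (ψ t) x * Real.exp (q x)
  set J1 := ∫ x in Ioi 0, (x - ψ t) * (tiltWeight g t (ψ t) x * Real.exp (q x))
  have hden : 0 < |κ t| * s t ^ 4 / 2 * J0 := by positivity
  have hre : J1 / J0 / (-κ t * s t ^ 4 / 2) - 1 =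
      -((J1 + κ t * s t ^ 4 / 2 * J0) / (κ t * s t ^ 4 / 2 * J0)) := by
    field_simp
    ring
  rw [Real.dist_eq, hre, abs_neg, abs_div, abs_mul, abs_div, abs_mul, abs_two, abs_of_pos hJ,
    abs_of_pos (by positivity : 0 < s t ^ 4), div_lt_iff₀ hden]
  refine hmain.trans_lt ?_
  have h9 : (22 + 2112 * C) * d * 2 < e := by linarith
  calc (22 + 2112 * C) * d * |κ t| * s t ^ 4 * J0
      = ((22 + 2112 * C) * d * 2) * (|κ t| * s t ^ 4 / 2 * J0) := by ring
    _ < _ := by gcongr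

theorem abs_taylor_two_sub_le {h h₁ h₂ : ℝ → ℝ} {a L κ e x : ℝ}
    (hd : ∀ z, |z - a| ≤ L → HasDerivAt h (h₁ z) z)
    (hd₁ : ∀ z, |z - a| ≤ L → HasDerivAt h₁ (h₂ z) z)
    (hκ : ∀ z, |z - a| ≤ L → |h₂ z - κ| ≤ e) (hx : |x - a| ≤ L) :
    |h x - h a - (x - a) * h₁ a - κ * (x - a) ^ 2 / 2| ≤ e * (x - a) ^ 2 / 2 := by
  have hquad : ∀ c z : ℝ, HasDerivAt (fun z => c * (z - a) ^ 2 / 2) (c * (z - a)) z := by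
    intro c z
    refine (((((hasDerivAt_id z).sub_const a).pow 2).const_mul c).div_const 2).congr_deriv ?_
    simp
    ring
  have hlin : ∀ c z : ℝ, HasDerivAt (fun z => (z - a) * c) c z := by
    intro c z
    simpa using ((hasDerivAt_id z).sub_const a).mul_const c
  have hfirst : ∀ z, |z - a| ≤ L → |h₁ z - h₁ a - κ * (z - a)| ≤ e * |z - a| := by
    intro z hz
    have hsub : ∀ w ∈ uIcc a z, |w - a| ≤ L := fun w hw =>
      (abs_sub_left_of_mem_uIcc hw).trans hz
    have := Convex.norm_image_sub_le_of_norm_hasDerivWithin_le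
      (f := fun z => h₁ z - (z - a) * κ) (f' := fun z => h₂ z - κ) (s := uIcc a z) (C := e)
      (fun w hw => ((hd₁ w (hsub w hw)).sub (hlin κ w)).hasDerivWithinAt)
      (fun w hw => hκ w (hsub w hw)) (convex_uIcc _ _) left_mem_uIcc right_mem_uIcc
    simp only [sub_self, zero_mul, sub_zero, Real.norm_eq_abs] at this
    convert this using 2
    ring
  set R : ℝ → ℝ := fun z => h z - h a - (z - a) * h₁ a - κ * (z - a) ^ 2 / 2 with hR
  have hRd : ∀ z, |z - a| ≤ L → HasDerivAt R (h₁ z - h₁ a - κ * (z - a)) z := fun z hz =>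
    (((hd z hz).sub_const (h a)).sub (hlin (h₁ a) z)).sub (hquad κ z)
  have hRa : R a = 0 := by simp [hR]
  have hprod : ∀ z, |z - a| ≤ L →
      |(z - a) * (h₁ z - h₁ a - κ * (z - a))| ≤ e * (z - a) ^ 2 := by
    intro z hz
    rw [abs_mul, ← sq_abs (z - a)]
    calc _ ≤ |z - a| * (e * |z - a|) := by gcongr; exact hfirst z hz
      _ = _ := by ring
  rw [abs_le]
  constructor
  · have := le_of_sub_mul_deriv_nonneg (fun z hz => (hquad e z).add (hRd z hz))
      (fun z hz => by nlinarith [(abs_le.1 (hprod z hz)).1]) hx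
    simp only [Pi.add_apply, hRa, sub_self] at this
    change -(e * (x - a) ^ 2 / 2) ≤ R x
    norm_num at this
    linarith
  · have := le_of_sub_mul_deriv_nonneg (fun z hz => (hquad e z).sub (hRd z hz))
      (fun z hz => by nlinarith [(abs_le.1 (hprod z hz)).2]) hx
    simp only [Pi.sub_apply, hRa, sub_self] at this
    change R x ≤ _
    norm_num at this
    linarith

theorem eventually_rpow_le_mul_rpow {α β d : ℝ} (hαβ : α < β) (hd : 0 < d) :
    ∀ᶠ x : ℝ in atTop, x ^ α ≤ d * x ^ β := by
  have h := (tendsto_rpow_neg_atTop (sub_pos.2 hαβ)).eventually_le_const hd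
  filter_upwards [h, eventually_gt_atTop 0] with x hx hx0
  have h1 : x ^ α = x ^ (-(β - α)) * x ^ β := by
    rw [← Real.rpow_add hx0]; congr 1; ring
  rw [h1]
  gcongr

theorem eventually_exp_neg_rpow_le {ν d : ℝ} (hν : 0 < ν) (ρ : ℝ) (hd : 0 < d) :
    ∀ᶠ x : ℝ in atTop, Real.exp (-(x ^ ν) ^ 2 / 8) ≤ d * x ^ ρ := by
  have h := (isLittleO_exp_neg_mul_rpow_atTop (by norm_num : (0 : ℝ) < 1 / 8) (ρ / ν)).bound hd
  filter_upwards [(tendsto_rpow_atTop hν).eventually h, eventually_ge_atTop 1,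
    (tendsto_rpow_atTop hν).eventually_ge_atTop 1] with x hx hx1 hx2
  have hx0 : 0 < x := by linarith
  rw [Real.norm_of_nonneg (Real.exp_pos _).le, Real.norm_of_nonneg (by positivity),
    ← Real.rpow_mul hx0.le, mul_div_cancel₀ _ hν.ne'] at hx
  refine le_trans (Real.exp_le_exp.2 ?_) hx
  nlinarith

theorem eventually_forall_half_le_le {f : ℝ → ℝ} {α ρ d : ℝ} (hα : α < 0) (hαρ : α < ρ)
    (hd : 0 < d) (hf : ∀ᶠ x in atTop, f x ≤ x ^ α) :
    ∀ᶠ x in atTop, ∀ z, x / 2 ≤ z → f z ≤ d * x ^ ρ := by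
  obtain ⟨X, hX⟩ := eventually_atTop.1 hf
  filter_upwards [eventually_rpow_le_mul_rpow hαρ (by positivity : 0 < d * (1 / 2) ^ (-α)),
    eventually_ge_atTop (2 * X), eventually_gt_atTop 0] with x h1 h2 h3 z hz
  refine (hX z (by linarith)).trans ?_
  refine (Real.rpow_le_rpow_of_nonpos (by positivity) hz hα.le).trans ?_
  have h4 : (x / 2) ^ α = (1 / 2 : ℝ) ^ α * x ^ α := by
    rw [← Real.mul_rpow (by norm_num) h3.le]; congr 1; ring
  rw [h4]
  calc (1 / 2 : ℝ) ^ α * x ^ α ≤ (1 / 2 : ℝ) ^ α * (d * (1 / 2) ^ (-α) * x ^ ρ) := by gcongr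
    _ = ((1 / 2 : ℝ) ^ α * (1 / 2) ^ (-α)) * (d * x ^ ρ) := by ring
    _ = d * x ^ ρ := by rw [← Real.rpow_add (by norm_num)]; simp

theorem abs_sub_eq_abs_abs_sub_abs {x y : ℝ} (h : 0 ≤ x * y) : |x - y| = |(|x| - |y|)| := by
  rcases mul_nonneg_iff.1 h with ⟨hx, hy⟩ | ⟨hx, hy⟩
  · rw [abs_of_nonneg hx, abs_of_nonneg hy]
  · rw [abs_of_nonpos hx, abs_of_nonpos hy, ← abs_neg]
    congr 1
    ring

theorem mul_nonneg_of_continuousOn_ne_zero {f : ℝ → ℝ} {s : Set ℝ} (hs : s.OrdConnected)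
    (hf : ContinuousOn f s) (h0 : ∀ x ∈ s, f x ≠ 0) {x y : ℝ} (hx : x ∈ s) (hy : y ∈ s) :
    0 ≤ f x * f y := by
  by_contra hcon
  push Not at hcon
  have hsub := hs.uIcc_subset hx hy
  have hmem : (0 : ℝ) ∈ uIcc (f x) (f y) := by
    rw [mem_uIcc]
    rcases mul_neg_iff.1 hcon with ⟨h1, h2⟩ | ⟨h1, h2⟩
    · exact Or.inr ⟨h2.le, h1.le⟩
    · exact Or.inl ⟨h1.le, h2.le⟩
  obtain ⟨z, hz, hz0⟩ := intermediate_value_uIcc (hf.mono hsub) hmem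
  exact h0 z (hsub hz) hz0

theorem hasDerivAt_integral_div {ε : ℝ → ℝ} (hε : ∀ x ≥ (1 : ℝ), DifferentiableAt ℝ ε x)
    {x : ℝ} (hx : 1 < x) :
    HasDerivAt (fun x => ∫ u in (1 : ℝ)..x, ε u / u) (ε x / x) x := by
  have hc : ∀ u ≥ (1 : ℝ), ContinuousAt (fun u => ε u / u) u := fun u hu =>
    (hε u hu).continuousAt.div continuousAt_id (zero_lt_one.trans_le hu).ne'
  have hco : ContinuousOn (fun u => ε u / u) (Ioi 1) :=
    fun u hu => (hc u (le_of_lt hu)).continuousWithinAt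
  refine intervalIntegral.integral_hasDerivAt_right ?_ ?_ (hc x hx.le)
  · refine ContinuousOn.intervalIntegrable fun u hu => (hc u ?_).continuousWithinAt
    rw [uIcc_of_le hx.le] at hu
    exact hu.1
  · exact hco.stronglyMeasurableAtFilter isOpen_Ioi x hx

theorem RegVary.sqrt_one_div {f : ℝ → ℝ} {α : ℝ} (hf : RegVary α f) :
    RegVary (α * (-1 / 2)) (fun x => Real.sqrt (1 / f x)) := by
  refine (hf.rpow (-1 / 2)).congr' ?_
  filter_upwards [hf.1] with x hx
  rw [Real.sqrt_eq_rpow, one_div, Real.inv_rpow hx.le, ← Real.rpow_neg hx.le]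
  norm_num

section

variable {g : ℝ → ℝ}

theorem hasDerivAt_of_contDiffOn_four (hg : ContDiffOn ℝ 4 g (Ioi 0)) {x : ℝ} (hx : 0 < x) :
    HasDerivAt g (deriv g x) x ∧ HasDerivAt (deriv g) (deriv (deriv g) x) x ∧
      HasDerivAt (deriv (deriv g)) (deriv (deriv (deriv g)) x) x ∧
      ContinuousAt (deriv (deriv (deriv g))) x := by
  have hx' : Ioi (0 : ℝ) ∈ nhds x := Ioi_mem_nhds hx
  have h1 : ContDiffOn ℝ 3 (deriv g) (Ioi 0) := hg.deriv_of_isOpen isOpen_Ioi (by norm_num)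
  have h2 : ContDiffOn ℝ 2 (deriv (deriv g)) (Ioi 0) := h1.deriv_of_isOpen isOpen_Ioi (by norm_num)
  have h3 : ContDiffOn ℝ 1 (deriv (deriv (deriv g))) (Ioi 0) :=
    h2.deriv_of_isOpen isOpen_Ioi (by norm_num)
  exact ⟨((hg.differentiableOn (by norm_num)).differentiableAt hx').hasDerivAt,
    ((h1.differentiableOn (by norm_num)).differentiableAt hx').hasDerivAt,
    ((h2.differentiableOn (by norm_num)).differentiableAt hx').hasDerivAt,
    h3.continuousOn.continuousAt hx'⟩

/-- The refined mean expansion, reduced to relative constancy of `g'''` and smallness of `q` on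
the window of half-width `N t / √(g'' (ψ t))` around `ψ t`. -/
theorem tendsto_mean_ratio_of_window {ψ q p Φ N : ℝ → ℝ}
    (hconv : ConvexOn ℝ (Ioi 0) g) (hsmooth : ContDiffOn ℝ 4 g (Ioi 0))
    (hψ : ∀ᶠ t in atTop, deriv g (ψ t) = t)
    (hqm : Measurable q) {M : ℝ} (hqM : ∀ x ≥ 0, |q x| ≤ M)
    (hp : ∀ x, p x = if 0 ≤ x then Real.exp (-(g x - q x)) else 0)
    (hΦ : ∀ t, Φ t = ∫ x, Real.exp (t * x) * p x)
    (hΦ_int : ∀ t > (0:ℝ), Integrable (fun x => Real.exp (t * x) * p x))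
    (hpos : ∀ᶠ t in atTop, 0 < deriv (deriv g) (ψ t))
    (hκ0 : ∀ᶠ t in atTop, deriv (deriv (deriv g)) (ψ t) ≠ 0)
    (hN : ∀ᶠ t in atTop, 1 ≤ N t)
    (hNψ : ∀ᶠ t in atTop, Real.sqrt (1 / deriv (deriv g) (ψ t)) * N t < ψ t)
    (hκ : ∀ e > 0, ∀ᶠ t in atTop, ∀ x,
      |x - ψ t| ≤ Real.sqrt (1 / deriv (deriv g) (ψ t)) * N t →
      |deriv (deriv (deriv g)) x - deriv (deriv (deriv g)) (ψ t)| ≤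
        e * |deriv (deriv (deriv g)) (ψ t)|)
    (hNr : ∀ e > 0, ∀ᶠ t in atTop, N t * (|deriv (deriv (deriv g)) (ψ t)| *
      Real.sqrt (1 / deriv (deriv g) (ψ t)) ^ 3) ≤ e)
    (hE : ∀ e > 0, ∀ᶠ t in atTop, Real.exp (-N t ^ 2 / 8) ≤
      e * (|deriv (deriv (deriv g)) (ψ t)| * Real.sqrt (1 / deriv (deriv g) (ψ t)) ^ 3))
    (hq : ∀ e > 0, ∀ᶠ t in atTop, ∀ x,
      |x - ψ t| ≤ Real.sqrt (1 / deriv (deriv g) (ψ t)) * N t →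
      |q x| ≤ e * (|deriv (deriv (deriv g)) (ψ t)| *
        Real.sqrt (1 / deriv (deriv g) (ψ t)) ^ 3)) :
    Tendsto (fun t => (deriv (fun u => Real.log (Φ u)) t - ψ t) /
      (-(iteratedDeriv 2 (deriv g) (ψ t)) *
        (Real.sqrt (1 / deriv (deriv g) (ψ t))) ^ 4 / 2)) atTop (nhds 1) := by
  have hiter : iteratedDeriv 2 (deriv g) = deriv (deriv (deriv g)) := by
    rw [iteratedDeriv_succ, iteratedDeriv_one]
  simp_rw [hiter]
  have hder := fun x (hx : 0 < x) => hasDerivAt_of_contDiffOn_four hsmooth hx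
  refine tendsto_mean_ratio (N := N) (s := fun t => Real.sqrt (1 / deriv (deriv g) (ψ t)))
    (κ := fun t => deriv (deriv (deriv g)) (ψ t)) hconv
    (fun x hx => (hder x hx).1) (fun x hx => (hder x hx).2.1.continuousAt.continuousWithinAt)
    hqm hqM hp hΦ hΦ_int ?_ hκ0 hN hNψ ?_ hNr hE hq
  · filter_upwards [hpos] with t ht
    positivity
  · intro e he
    filter_upwards [hpos, hNψ, hκ e he, hψ] with t h1 h2 h3 h4 x hx
    have hx0 : ∀ z, |z - ψ t| ≤ Real.sqrt (1 / deriv (deriv g) (ψ t)) * N t → 0 < z := by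
      intro z hz
      linarith [(abs_le.1 hz).1]
    have := abs_taylor_two_sub_le (fun z hz => (hder z (hx0 z hz)).2.1)
      (fun z hz => (hder z (hx0 z hz)).2.2.1) h3 hx
    rw [h4] at this
    rwa [Real.sq_sqrt (by positivity), div_div_eq_mul_div, div_one]

end

namespace Case1

variable {h ε : ℝ → ℝ} {β c θ : ℝ}

theorem pos (H : Case1 h β c θ ε) {x : ℝ} (hx : 1 ≤ x) : 0 < h x := by
  rw [H.h_eq x hx]
  have := H.c_pos
  positivity

theorem hasDerivAt (H : Case1 h β c θ ε) {x : ℝ} (hx : 1 < x) :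
    HasDerivAt h (h x * (β + ε x) / x) x := by
  have hx0 : 0 < x := by linarith
  have h1 := ((Real.hasDerivAt_rpow_const (p := β) (Or.inl hx0.ne')).const_mul c).mul
    (hasDerivAt_integral_div H.eps_diff hx).exp
  refine (h1.congr_of_eventuallyEq ?_).congr_deriv ?_
  · filter_upwards [lt_mem_nhds hx] with z hz using H.h_eq z (le_of_lt hz)
  · rw [H.h_eq x hx.le, Real.rpow_sub_one hx0.ne']
    field_simp

theorem tendsto_add (H : Case1 h β c θ ε) : Tendsto (fun x => β + ε x) atTop (nhds β) := by
  simpa using H.eps_to_zero.const_add β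

theorem regVary (H : Case1 h β c θ ε) : RegVary β h := by
  refine RegVary.of_deriv (f' := fun x => h x * (β + ε x) / x) ?_ ?_ ?_
  · filter_upwards [eventually_ge_atTop 1] with x hx using H.pos hx
  · filter_upwards [eventually_gt_atTop 1] with x hx using H.hasDerivAt hx
  · refine H.tendsto_add.congr' ?_
    filter_upwards [eventually_gt_atTop 1] with x hx
    have := H.pos hx.le
    field_simp

theorem regVary_deriv (H : Case1 h β c θ ε) : RegVary (β - 1) (deriv h) := by
  have h1 := (H.regVary.mul (RegVary.of_tendsto H.beta_pos H.tendsto_add)).mul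
    (RegVary.id.rpow (-1))
  rw [show β + 0 + 1 * (-1) = β - 1 by ring] at h1
  refine h1.congr' ?_
  filter_upwards [eventually_gt_atTop 1] with x hx
  rw [(H.hasDerivAt hx).deriv, Real.rpow_neg_one, div_eq_mul_inv]

theorem deriv_deriv (H : Case1 h β c θ ε) {x : ℝ} (hx : 1 < x) :
    deriv (deriv h) x =
      (deriv h x * (β + ε x) + h x * deriv ε x) / x - h x * (β + ε x) / x ^ 2 := by
  have h1 := ((H.hasDerivAt hx).mul ((H.eps_diff x hx.le).hasDerivAt.const_add β)).div
    (hasDerivAt_id x) (by simp; linarith)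
  have h2 : deriv h =ᶠ[nhds x] fun x => h x * (β + ε x) / x := by
    filter_upwards [lt_mem_nhds hx] with z hz using (H.hasDerivAt hz).deriv
  rw [(h1.congr_of_eventuallyEq h2).deriv, (H.hasDerivAt hx).deriv]
  have hx0 : x ≠ 0 := by linarith
  simp only [id, Pi.mul_apply]
  field_simp

theorem exists_abs_deriv_deriv_le (H : Case1 h β c θ ε) :
    ∃ C, 0 < C ∧ ∀ᶠ x in atTop, |deriv (deriv h) x| ≤ C * deriv h x / x := by
  obtain ⟨K, hK0, hK⟩ := H.eps_deriv_bigO.exists_pos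
  have hβ := H.beta_pos
  refine ⟨2 * β + K * 2 / β + 1, by positivity, ?_⟩
  filter_upwards [hK.bound, eventually_gt_atTop 1,
    H.tendsto_add.eventually_const_lt (half_lt_self hβ),
    H.tendsto_add.eventually_lt_const (by linarith : β < 2 * β)] with x h1 hx h2 h3
  have hx0 : 0 < x := by linarith
  have hd := (H.hasDerivAt hx).deriv
  have hh := H.pos hx.le
  have hb : 0 < β + ε x := by linarith
  have hd0 : 0 < deriv h x := by rw [hd]; positivity
  have hhx : h x = deriv h x * x / (β + ε x) := by rw [hd]; field_simp
  have key : deriv (deriv h) x =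
      deriv h x / x * (β + ε x + x * deriv ε x / (β + ε x) - 1) := by
    rw [H.deriv_deriv hx, hhx]
    field_simp
  simp only [Real.norm_eq_abs, norm_one, mul_one] at h1
  have h4 : |x * deriv ε x / (β + ε x)| ≤ K * 2 / β := by
    rw [abs_div, abs_of_pos hb, div_le_div_iff₀ hb hβ]
    nlinarith
  rw [key, abs_mul, abs_of_pos (by positivity)]
  calc deriv h x / x * |β + ε x + x * deriv ε x / (β + ε x) - 1|
      ≤ deriv h x / x * (2 * β + K * 2 / β + 1) := by
        gcongr
        rw [abs_le]
        constructor <;> linarith [(abs_le.1 h4).1, (abs_le.1 h4).2]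
    _ = _ := by ring

theorem regVary_scale (H : Case1 h β c θ ε) :
    RegVary ((1 - β) / 2) (fun x => √(1 / deriv h x)) := by
  have h1 := H.regVary_deriv.sqrt_one_div
  rwa [show (β - 1) * (-1 / 2) = (1 - β) / 2 by ring] at h1

theorem eventually_scale_mul_rpow_le (H : Case1 h β c θ ε) {d : ℝ} (hd : 0 < d) :
    ∀ᶠ x in atTop, √(1 / deriv h x) * x ^ ((1 + β) / 8) ≤ d * x := by
  have hβ := H.beta_pos
  filter_upwards [H.regVary_scale.eventually_rpow_le_and_le
      (((measurable_deriv h).const_div 1).sqrt) (by positivity : 0 < (1 + β) / 8),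
    eventually_rpow_le_mul_rpow (by linarith : 1 - (1 + β) / 4 < 1) hd,
    eventually_gt_atTop 0] with x h1 h2 hx
  rw [Real.rpow_one] at h2
  refine le_trans ?_ h2
  calc _ ≤ x ^ ((1 - β) / 2 + (1 + β) / 8) * x ^ ((1 + β) / 8) := by
        gcongr; exact h1.2
    _ = _ := by rw [← Real.rpow_add hx]; congr 1; ring

theorem regVary_skewness (H : Case1 h β c θ ε) :
    RegVary (θ + 3 * (1 - β) / 2) (fun x => |deriv (deriv h) x| * √(1 / deriv h x) ^ 3) := by
  have h1 := H.h2_RV.mul (H.regVary_scale.rpow 3)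
  rw [show θ + (1 - β) / 2 * 3 = θ + 3 * (1 - β) / 2 by ring] at h1
  refine h1.congr' (Eventually.of_forall fun x => ?_)
  simp only
  norm_cast

theorem measurable_skewness :
    Measurable (fun x => |deriv (deriv h) x| * √(1 / deriv h x) ^ 3) := by
  have h1 := measurable_deriv h
  have h2 := measurable_deriv (deriv h)
  simp only [← Real.norm_eq_abs]
  fun_prop

theorem eventually_rpow_mul_skewness_le (H : Case1 h β c θ ε) {e : ℝ} (he : 0 < e) :
    ∀ᶠ x in atTop,
      x ^ ((1 + β) / 8) * (|deriv (deriv h) x| * √(1 / deriv h x) ^ 3) ≤ e := by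
  obtain ⟨C, hC, hb⟩ := H.exists_abs_deriv_deriv_le
  filter_upwards [hb, H.eventually_scale_mul_rpow_le (by positivity : 0 < e / C),
    H.regVary_deriv.1, eventually_gt_atTop 0] with x h1 h2 h3 hx
  have h4 : √(1 / deriv h x) ^ 3 = √(1 / deriv h x) / deriv h x := by
    rw [pow_succ, Real.sq_sqrt (by positivity)]; ring
  rw [h4]
  calc x ^ ((1 + β) / 8) * (|deriv (deriv h) x| * (√(1 / deriv h x) / deriv h x))
      ≤ x ^ ((1 + β) / 8) * (C * deriv h x / x * (√(1 / deriv h x) / deriv h x)) := by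
        gcongr
    _ = C / x * (√(1 / deriv h x) * x ^ ((1 + β) / 8)) := by field_simp
    _ ≤ C / x * (e / C * x) := by gcongr
    _ = e := by field_simp

theorem eventually_abs_deriv_deriv_sub_le (H : Case1 h β c θ ε)
    (hcont : ContinuousOn (deriv (deriv h)) (Ioi 0)) {e : ℝ} (he : 0 < e) :
    ∀ᶠ x in atTop, ∀ z, |z - x| ≤ √(1 / deriv h x) * x ^ ((1 + β) / 8) →
      |deriv (deriv h) z - deriv (deriv h) x| ≤ e * |deriv (deriv h) x| := by
  have hm : Measurable fun x => |deriv (deriv h) x| := (measurable_deriv (deriv h)).norm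
  obtain ⟨d, hd, hd2, hw⟩ := H.h2_RV.exists_forall_abs_sub_le hm he
  obtain ⟨X, hX⟩ := eventually_atTop.1 (H.h2_RV.1.and (eventually_gt_atTop 0))
  filter_upwards [hw, H.eventually_scale_mul_rpow_le hd, eventually_ge_atTop (2 * X),
    eventually_gt_atTop 0] with x h1 h2 h3 hx z hz
  have hz' := hz.trans h2
  have hzx : x / 2 ≤ z := by nlinarith [(abs_le.1 hz').1]
  have hs := mul_nonneg_of_continuousOn_ne_zero (ordConnected_Ici (a := X))
    (hcont.mono fun y hy => (hX y hy).2) (fun y hy => abs_pos.1 (hX y hy).1)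
    (x := z) (y := x) (by simp only [mem_Ici]; linarith)
    (by simp only [mem_Ici]; linarith)
  rw [abs_sub_eq_abs_abs_sub_abs hs]
  exact (h1 z hz').2

theorem eventually_abs_le_skewness (H : Case1 h β c θ ε) {q : ℝ → ℝ} {η : ℝ}
    (hqm : Measurable q) (hη : η < θ - 3 * β / 2 - 3 / 2) (hq : RegVary η (fun x => |q x|))
    {e : ℝ} (he : 0 < e) :
    ∀ᶠ x in atTop, ∀ z, |z - x| ≤ √(1 / deriv h x) * x ^ ((1 + β) / 8) →
      |q z| ≤ e * (|deriv (deriv h) x| * √(1 / deriv h x) ^ 3) := by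
  have hβ := H.beta_pos
  have hθ := H.theta_le
  have h1 := hq.eventually_rpow_le_and_le hqm.norm one_pos
  filter_upwards [eventually_forall_half_le_le (by linarith : η + 1 < 0)
      (by linarith : η + 1 < θ + 3 * (1 - β) / 2 - 1) he (h1.mono fun x hx => hx.2),
    H.regVary_skewness.eventually_rpow_le_and_le measurable_skewness one_pos,
    H.eventually_scale_mul_rpow_le (by norm_num : (0 : ℝ) < 1 / 2)] with x h2 h3 h4 z hz
  refine (h2 z (by linarith [(abs_le.1 (hz.trans h4)).1])).trans ?_
  gcongr
  exact h3.1

theorem tendsto_mean_ratio {g ψ q p Φ : ℝ → ℝ} (H : Case1 (deriv g) β c θ ε)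
    (hconv : ConvexOn ℝ (Ioi 0) g) (hsmooth : ContDiffOn ℝ 4 g (Ioi 0))
    (hψ : ∀ᶠ t in atTop, deriv g (ψ t) = t) (hψ_top : Tendsto ψ atTop atTop)
    (hqm : Measurable q) {M : ℝ} (hqM : ∀ x ≥ 0, |q x| ≤ M) {η : ℝ}
    (hη : η < θ - 3 * β / 2 - 3 / 2) (hq : RegVary η (fun x => |q x|))
    (hp : ∀ x, p x = if 0 ≤ x then Real.exp (-(g x - q x)) else 0)
    (hΦ : ∀ t, Φ t = ∫ x, Real.exp (t * x) * p x)
    (hΦ_int : ∀ t > (0:ℝ), Integrable (fun x => Real.exp (t * x) * p x)) :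
    Tendsto (fun t => (deriv (fun u => Real.log (Φ u)) t - ψ t) /
      (-(iteratedDeriv 2 (deriv g) (ψ t)) *
        (Real.sqrt (1 / deriv (deriv g) (ψ t))) ^ 4 / 2)) atTop (nhds 1) := by
  have hβ := H.beta_pos
  have hν : 0 < (1 + β) / 8 := by positivity
  have hcont : ContinuousOn (deriv (deriv (deriv g))) (Ioi 0) := fun x hx =>
    (hasDerivAt_of_contDiffOn_four hsmooth hx).2.2.2.continuousWithinAt
  refine tendsto_mean_ratio_of_window (N := fun t => ψ t ^ ((1 + β) / 8)) hconv hsmooth hψ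
    hqm hqM hp hΦ hΦ_int (hψ_top.eventually H.regVary_deriv.1)
    (hψ_top.eventually (H.h2_RV.1.mono fun x hx => abs_pos.1 hx)) ?_ ?_
    (fun e he => hψ_top.eventually (H.eventually_abs_deriv_deriv_sub_le hcont he))
    (fun e he => hψ_top.eventually (H.eventually_rpow_mul_skewness_le he))
    (fun e he => ?_)
    (fun e he => hψ_top.eventually (H.eventually_abs_le_skewness hqm hη hq he))
  · filter_upwards [hψ_top.eventually_ge_atTop 1] with t ht
    exact Real.one_le_rpow ht hν.le
  · filter_upwards [hψ_top.eventually
      (H.eventually_scale_mul_rpow_le (by norm_num : (0 : ℝ) < 1 / 2)),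
      hψ_top.eventually_gt_atTop 0] with t h1 h2
    linarith
  · filter_upwards [hψ_top.eventually (eventually_exp_neg_rpow_le hν _ he),
      hψ_top.eventually
        (H.regVary_skewness.eventually_rpow_le_and_le measurable_skewness one_pos)]
      with t h1 h2
    refine h1.trans ?_
    gcongr
    exact h2.1

end Case1

theorem eventually_eventuallyEq_nhds_of_atTop {f f₁ : ℝ → ℝ} (h : f =ᶠ[atTop] f₁) :
    ∀ᶠ t in atTop, f =ᶠ[nhds t] f₁ := by
  obtain ⟨T, hT⟩ := eventually_atTop.1 h
  filter_upwards [eventually_gt_atTop T] with t ht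
  filter_upwards [lt_mem_nhds ht] with z hz using hT z (le_of_lt hz)

theorem deriv_nonneg_of_strictMonoOn_Ioi {h : ℝ → ℝ} {a x : ℝ} (hh : StrictMonoOn h (Ioi a))
    (hx : a < x) : 0 ≤ deriv h x := by
  rw [← derivWithin_of_isOpen isOpen_Ioi (mem_Ioi.2 hx)]
  exact hh.monotoneOn.derivWithin_nonneg

namespace Case2

variable {h ψ ε : ℝ → ℝ} {c : ℝ}

theorem pos (H : Case2 ψ c ε) {t : ℝ} (ht : 1 ≤ t) : 0 < ψ t := by
  rw [H.psi_eq t ht]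
  have := H.c_pos
  positivity

theorem hasDerivAt (H : Case2 ψ c ε) {t : ℝ} (ht : 1 < t) :
    HasDerivAt ψ (ψ t * ε t / t) t := by
  have h1 := (hasDerivAt_integral_div H.eps_diff ht).exp.const_mul c
  refine (h1.congr_of_eventuallyEq ?_).congr_deriv ?_
  · filter_upwards [lt_mem_nhds ht] with z hz using H.psi_eq z (le_of_lt hz)
  · rw [H.psi_eq t ht.le]
    ring

theorem hasDerivAt_deriv (H : Case2 ψ c ε) {t : ℝ} (ht : 1 < t) :
    HasDerivAt (deriv ψ)
      ((deriv ψ t * ε t + ψ t * deriv ε t) / t - ψ t * ε t / t ^ 2) t := by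
  have h1 := ((H.hasDerivAt ht).mul (H.eps_diff t ht.le).hasDerivAt).div
    (hasDerivAt_id t) (by simp; linarith)
  have h2 : deriv ψ =ᶠ[nhds t] fun x => ψ x * ε x / x := by
    filter_upwards [lt_mem_nhds ht] with z hz using (H.hasDerivAt hz).deriv
  refine (h1.congr_of_eventuallyEq h2).congr_deriv ?_
  rw [(H.hasDerivAt ht).deriv]
  have ht0 : t ≠ 0 := by linarith
  simp only [id, Pi.mul_apply]
  field_simp

theorem eventually_deriv_comp_mul (H : Case2 ψ c ε)
    (hh : ∀ x, 0 < x → HasDerivAt h (deriv h x) x) (hψ : ∀ᶠ t in atTop, h (ψ t) = t) :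
    (fun t => deriv h (ψ t) * deriv ψ t) =ᶠ[atTop] fun _ => 1 := by
  filter_upwards [eventually_eventuallyEq_nhds_of_atTop (f := fun t => h (ψ t))
    (f₁ := fun t => t) hψ, eventually_gt_atTop 1] with t h1 ht
  have h2 := (hh _ (H.pos ht.le)).comp t (H.hasDerivAt ht)
  rw [(H.hasDerivAt ht).deriv]
  exact h2.unique ((hasDerivAt_id t).congr_of_eventuallyEq h1)

theorem eventually_deriv_pos (H : Case2 ψ c ε)
    (hh : ∀ x, 0 < x → HasDerivAt h (deriv h x) x) (hψ : ∀ᶠ t in atTop, h (ψ t) = t)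
    (hmono : ∃ x₀, StrictMonoOn h (Ioi x₀)) (hψ_top : Tendsto ψ atTop atTop) :
    ∀ᶠ t in atTop, 0 < deriv ψ t := by
  obtain ⟨x₀, hx₀⟩ := hmono
  filter_upwards [H.eventually_deriv_comp_mul hh hψ, hψ_top.eventually_gt_atTop x₀] with t h1 h2
  exact pos_of_mul_pos_right (h1 ▸ one_pos) (deriv_nonneg_of_strictMonoOn_Ioi hx₀ h2)

theorem tendsto_mul_deriv_deriv_div (H : Case2 ψ c ε) (hpos : ∀ᶠ t in atTop, 0 < deriv ψ t) :
    Tendsto (fun t => t * deriv (deriv ψ) t / deriv ψ t) atTop (nhds (-1)) := by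
  have h1 := (H.eps_to_zero.add H.eps_ratio1).sub_const 1
  rw [show (0 : ℝ) + 0 - 1 = -1 by norm_num] at h1
  refine h1.congr' ?_
  filter_upwards [hpos, eventually_gt_atTop 1] with t h2 ht
  have h3 := (H.hasDerivAt ht).deriv
  have h4 := H.pos ht.le
  have ht0 : t ≠ 0 := by linarith
  have h5 : ε t ≠ 0 := by
    intro h0
    rw [h3, h0] at h2
    simp at h2
  rw [(H.hasDerivAt_deriv ht).deriv, h3]
  field_simp

theorem regVary_deriv (H : Case2 ψ c ε) (hpos : ∀ᶠ t in atTop, 0 < deriv ψ t) :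
    RegVary (-1) (deriv ψ) := by
  refine RegVary.of_deriv hpos ?_ (H.tendsto_mul_deriv_deriv_div hpos)
  filter_upwards [eventually_gt_atTop 1] with t ht
  exact (H.hasDerivAt_deriv ht).differentiableAt.hasDerivAt

theorem eventually_deriv_deriv_comp (H : Case2 ψ c ε)
    (hh : ∀ x, 0 < x → HasDerivAt h (deriv h x) x)
    (hh₁ : ∀ x, 0 < x → HasDerivAt (deriv h) (deriv (deriv h) x) x)
    (hψ : ∀ᶠ t in atTop, h (ψ t) = t) (hpos : ∀ᶠ t in atTop, 0 < deriv ψ t) :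
    ∀ᶠ t in atTop, deriv (deriv h) (ψ t) = -deriv (deriv ψ) t / deriv ψ t ^ 3 := by
  have h1 := H.eventually_deriv_comp_mul hh hψ
  filter_upwards [h1, eventually_eventuallyEq_nhds_of_atTop h1, hpos, eventually_gt_atTop 1]
    with t h2 h3 h4 ht
  have h5 := ((hh₁ _ (H.pos ht.le)).comp t (H.hasDerivAt ht)).mul
    (H.hasDerivAt_deriv ht).differentiableAt.hasDerivAt
  have h6 := h5.unique ((hasDerivAt_const t (1 : ℝ)).congr_of_eventuallyEq h3)
  rw [← (H.hasDerivAt ht).deriv] at h6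
  simp only [Function.comp_apply] at h6
  rw [eq_div_iff (by positivity)]
  linear_combination deriv ψ t * h6 - deriv (deriv ψ) t * h2

theorem regVary_curvature (H : Case2 ψ c ε) (hpos : ∀ᶠ t in atTop, 0 < deriv ψ t) :
    RegVary 1 (fun t => -deriv (deriv ψ) t / deriv ψ t ^ 3) := by
  have h1 := (H.tendsto_mul_deriv_deriv_div hpos).neg
  rw [neg_neg] at h1
  have h2 := ((RegVary.of_tendsto one_pos h1).mul (RegVary.id.rpow (-1))).mul
    ((H.regVary_deriv hpos).rpow (-2))
  rw [show (0 : ℝ) + 1 * -1 + -1 * -2 = 1 by norm_num] at h2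
  refine h2.congr' ?_
  filter_upwards [hpos, eventually_gt_atTop 0] with t h3 ht
  rw [Real.rpow_neg_one, Real.rpow_neg h3.le, Real.rpow_two]
  field_simp

theorem measurable_curvature : Measurable (fun t => -deriv (deriv ψ) t / deriv ψ t ^ 3) := by
  have h1 := measurable_deriv ψ
  have h2 := measurable_deriv (deriv ψ)
  fun_prop

theorem regVary_scale (H : Case2 ψ c ε) (hpos : ∀ᶠ t in atTop, 0 < deriv ψ t) :
    RegVary (-1 / 2) (fun t => √(deriv ψ t)) := by
  have h1 := (H.regVary_deriv hpos).rpow (1 / 2)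
  rw [show (-1 : ℝ) * (1 / 2) = -1 / 2 by norm_num] at h1
  simpa only [Real.sqrt_eq_rpow] using h1

theorem regVary_skewness (H : Case2 ψ c ε) (hpos : ∀ᶠ t in atTop, 0 < deriv ψ t) :
    RegVary (-1 / 2)
      (fun t => -deriv (deriv ψ) t / deriv ψ t ^ 3 * √(deriv ψ t) ^ 3) := by
  have h1 := (H.regVary_curvature hpos).mul ((H.regVary_scale hpos).rpow 3)
  rw [show 1 + (-1 : ℝ) / 2 * 3 = -1 / 2 by norm_num] at h1
  refine h1.congr' (Eventually.of_forall fun x => ?_)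
  simp only
  norm_cast

theorem measurable_skewness :
    Measurable (fun t => -deriv (deriv ψ) t / deriv ψ t ^ 3 * √(deriv ψ t) ^ 3) :=
  measurable_curvature.mul ((measurable_deriv ψ).sqrt.pow_const 3)

theorem eventually_exists_eq (H : Case2 ψ c ε) (hpos : ∀ᶠ t in atTop, 0 < deriv ψ t)
    {d : ℝ} (hd : 0 < d) :
    ∀ᶠ t in atTop, ∀ x, |x - ψ t| ≤ √(deriv ψ t) * t ^ (1 / 8 : ℝ) →
      ∃ u, |u - t| ≤ d * t ∧ ψ u = x := by
  obtain ⟨d₀, hd₀, hd₀2, hw⟩ := (H.regVary_deriv hpos).exists_forall_abs_sub_le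
    (measurable_deriv ψ) (by norm_num : (0 : ℝ) < 1 / 2)
  have hk : 0 < min d d₀ := lt_min hd hd₀
  filter_upwards [hw, hpos, eventually_gt_atTop 2,
    (H.regVary_scale hpos).eventually_rpow_le_and_le (measurable_deriv ψ).sqrt
      (by norm_num : (0 : ℝ) < 1 / 8),
    eventually_rpow_le_mul_rpow (by norm_num : (1 / 8 : ℝ) < 1 + (-1 / 2 - 1 / 8))
      (half_pos hk)] with t h1 h2 ht h3 h4 x hx
  set k := min d d₀
  have ht0 : 0 < t := by linarith
  have hkd : k * t ≤ d * t := by gcongr; exact min_le_left _ _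
  have hkd₀ : k * t ≤ d₀ * t := by gcongr; exact min_le_right _ _
  have hkt : 0 < k * t := by positivity
  have hlow : 1 < t - k * t := by nlinarith
  have hmem : ∀ z ∈ Icc (t - k * t) (t + k * t), |z - t| ≤ k * t := fun z hz =>
    abs_le.2 ⟨by linarith [hz.1], by linarith [hz.2]⟩
  have hcont : ContinuousOn ψ (Icc (t - k * t) (t + k * t)) := fun z hz =>
    (H.hasDerivAt (hlow.trans_le hz.1)).continuousAt.continuousWithinAt
  have hmvt := (convex_Icc (t - k * t) (t + k * t)).mul_sub_le_image_sub_of_le_deriv hcont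
    (fun z hz => (H.hasDerivAt (hlow.trans_le
      (interior_subset hz).1)).differentiableAt.differentiableWithinAt)
    (C := deriv ψ t / 2) (fun z hz => by
      have := (h1 z ((hmem z (interior_subset hz)).trans hkd₀)).2
      linarith [(abs_le.1 this).1])
  have hup := hmvt t ⟨by linarith, by linarith⟩ (t + k * t) ⟨by linarith, le_rfl⟩ (by linarith)
  have hdown := hmvt (t - k * t) ⟨le_rfl, by linarith⟩ t ⟨by linarith, by linarith⟩ (by linarith)
  have hwidth : √(deriv ψ t) * t ^ (1 / 8 : ℝ) ≤ deriv ψ t / 2 * (k * t) := by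
    rw [Real.rpow_add ht0, Real.rpow_one] at h4
    calc √(deriv ψ t) * t ^ (1 / 8 : ℝ)
        ≤ √(deriv ψ t) * (k / 2 * (t * √(deriv ψ t))) := by
          gcongr
          refine h4.trans ?_
          gcongr
          exact h3.1
      _ = √(deriv ψ t) ^ 2 / 2 * (k * t) := by ring
      _ = _ := by rw [Real.sq_sqrt h2.le]
  obtain ⟨u, hu, hux⟩ := intermediate_value_Icc (by linarith) hcont
    (show x ∈ Icc (ψ (t - k * t)) (ψ (t + k * t)) from
      ⟨by linarith [(abs_le.1 hx).1], by linarith [(abs_le.1 hx).2]⟩)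
  exact ⟨u, (hmem u hu).trans hkd, hux⟩

theorem eventually_abs_le_skewness (H : Case2 ψ c ε) (hpos : ∀ᶠ t in atTop, 0 < deriv ψ t)
    {q : ℝ → ℝ} {η : ℝ} (hqm : Measurable q) (hη : η < -(1 / 2))
    (hq : RegVary η (fun t => |q (ψ t)|)) {e : ℝ} (he : 0 < e) :
    ∀ᶠ t in atTop, ∀ x, |x - ψ t| ≤ √(deriv ψ t) * t ^ (1 / 8 : ℝ) →
      |q x| ≤ e * (-deriv (deriv ψ) t / deriv ψ t ^ 3 * √(deriv ψ t) ^ 3) := by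
  have ha : 0 < (-(1 / 2) - η) / 4 := by linarith
  have hcont : Continuous fun t => ψ (max t 2) := continuous_iff_continuousAt.2 fun t =>
    ContinuousAt.comp (g := ψ)
      (H.hasDerivAt (one_lt_two.trans_le (le_max_right t 2))).continuousAt (by fun_prop)
  have hmax : (fun t => |q (ψ t)|) =ᶠ[atTop] fun t => |q (ψ (max t 2))| := by
    filter_upwards [eventually_ge_atTop 2] with t ht
    rw [max_eq_left ht]
  have hub : ∀ᶠ t in atTop, |q (ψ t)| ≤ t ^ (η + (-(1 / 2) - η) / 4) := by
    filter_upwards [hmax, (hq.congr' hmax).eventually_rpow_le_and_le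
      (hqm.comp hcont.measurable).norm ha] with t h1 h2
    exact h1.le.trans h2.2
  filter_upwards [eventually_forall_half_le_le (by linarith)
      (by linarith : η + (-(1 / 2) - η) / 4 < -1 / 2 - (-(1 / 2) - η) / 4) he hub,
    (H.regVary_skewness hpos).eventually_rpow_le_and_le measurable_skewness ha,
    H.eventually_exists_eq hpos (by norm_num : (0 : ℝ) < 1 / 2)] with t h2 h3 h4 x hx
  obtain ⟨u, hu, rfl⟩ := h4 x hx
  refine (h2 u (by linarith [(abs_le.1 hu).1])).trans ?_
  gcongr
  exact h3.1

theorem tendsto_mean_ratio {g q p Φ : ℝ → ℝ} (H : Case2 ψ c ε)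
    (hconv : ConvexOn ℝ (Ioi 0) g) (hsmooth : ContDiffOn ℝ 4 g (Ioi 0))
    (hmono : ∃ x₀, StrictMonoOn (deriv g) (Ioi x₀))
    (hψ : ∀ᶠ t in atTop, deriv g (ψ t) = t) (hψ_top : Tendsto ψ atTop atTop)
    (hqm : Measurable q) {M : ℝ} (hqM : ∀ x ≥ 0, |q x| ≤ M) {η : ℝ}
    (hη : η < -(1 / 2)) (hq : RegVary η (fun t => |q (ψ t)|))
    (hp : ∀ x, p x = if 0 ≤ x then Real.exp (-(g x - q x)) else 0)
    (hΦ : ∀ t, Φ t = ∫ x, Real.exp (t * x) * p x)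
    (hΦ_int : ∀ t > (0:ℝ), Integrable (fun x => Real.exp (t * x) * p x)) :
    Tendsto (fun t => (deriv (fun u => Real.log (Φ u)) t - ψ t) /
      (-(iteratedDeriv 2 (deriv g) (ψ t)) *
        (Real.sqrt (1 / deriv (deriv g) (ψ t))) ^ 4 / 2)) atTop (nhds 1) := by
  have hd₁ := fun x (hx : 0 < x) => (hasDerivAt_of_contDiffOn_four hsmooth hx).2.1
  have hd₂ := fun x (hx : 0 < x) => (hasDerivAt_of_contDiffOn_four hsmooth hx).2.2.1
  have hpos := H.eventually_deriv_pos hd₁ hψ hmono hψ_top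
  have hcurv := H.regVary_curvature hpos
  have hone : ∀ᶠ t in atTop, deriv (deriv g) (ψ t) = 1 / deriv ψ t := by
    filter_upwards [H.eventually_deriv_comp_mul hd₁ hψ, hpos] with t h1 h2
    exact eq_one_div_of_mul_eq_one_left h1
  have hscale : ∀ᶠ t in atTop, √(1 / deriv (deriv g) (ψ t)) = √(deriv ψ t) := by
    filter_upwards [hone] with t h1
    rw [h1, one_div_one_div]
  have hκ := H.eventually_deriv_deriv_comp hd₁ hd₂ hψ hpos
  have hskew : ∀ᶠ t in atTop,
      |deriv (deriv (deriv g)) (ψ t)| * √(1 / deriv (deriv g) (ψ t)) ^ 3 =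
        -deriv (deriv ψ) t / deriv ψ t ^ 3 * √(deriv ψ t) ^ 3 := by
    filter_upwards [hscale, hκ, hcurv.1] with t h1 h2 h3
    rw [h1, h2, abs_of_pos h3]
  have hscale_le := (H.regVary_scale hpos).eventually_rpow_le_and_le (measurable_deriv ψ).sqrt
    (by norm_num : (0 : ℝ) < 1 / 8)
  have hskew_le := (H.regVary_skewness hpos).eventually_rpow_le_and_le measurable_skewness
    (by norm_num : (0 : ℝ) < 1 / 8)
  refine tendsto_mean_ratio_of_window (N := fun t => t ^ (1 / 8 : ℝ)) hconv hsmooth hψ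
    hqm hqM hp hΦ hΦ_int ?_ ?_ ?_ ?_ (fun e he => ?_) (fun e he => ?_) (fun e he => ?_)
    (fun e he => ?_)
  · filter_upwards [hone, hpos] with t h1 h2
    rw [h1]
    positivity
  · filter_upwards [hκ, hcurv.1] with t h1 h2
    rw [h1]
    exact h2.ne'
  · filter_upwards [eventually_ge_atTop 1] with t ht
    exact Real.one_le_rpow ht (by norm_num)
  · filter_upwards [hscale, hscale_le, eventually_ge_atTop 1, hψ_top.eventually_gt_atTop 1]
      with t h1 h2 ht h3
    rw [h1]
    refine lt_of_le_of_lt ?_ h3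
    calc √(deriv ψ t) * t ^ (1 / 8 : ℝ)
        ≤ t ^ (-1 / 2 + 1 / 8 : ℝ) * t ^ (1 / 8 : ℝ) := by gcongr; exact h2.2
      _ = t ^ (-1 / 2 + 1 / 8 + 1 / 8 : ℝ) := by rw [← Real.rpow_add (by linarith)]
      _ ≤ 1 := Real.rpow_le_one_of_one_le_of_nonpos ht (by norm_num)
  · obtain ⟨d, hd, -, hw⟩ := hcurv.exists_forall_abs_sub_le measurable_curvature he
    obtain ⟨T, hT⟩ := eventually_atTop.1 hκ
    filter_upwards [hw, H.eventually_exists_eq hpos (lt_min hd (half_pos one_pos)), hscale, hκ,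
      hcurv.1, eventually_ge_atTop (2 * T), eventually_gt_atTop 0] with t h1 h2 h3 h4 h5 h6 ht x hx
    rw [h3] at hx
    obtain ⟨u, hu, rfl⟩ := h2 x hx
    have hu1 : |u - t| ≤ d * t := hu.trans (by gcongr; exact min_le_left _ _)
    have hu2 : |u - t| ≤ 1 / 2 * t := hu.trans (by gcongr; exact min_le_right _ _)
    rw [hT u (by linarith [(abs_le.1 hu2).1]), h4, abs_of_pos h5]
    exact (h1 u hu1).2
  · filter_upwards [hskew, hskew_le, eventually_gt_atTop 0,
      eventually_rpow_le_mul_rpow (by norm_num : 1 / 8 + (-1 / 2 + 1 / 8) < (0 : ℝ)) he]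
      with t h1 h2 ht h3
    rw [h1]
    calc t ^ (1 / 8 : ℝ) * (-deriv (deriv ψ) t / deriv ψ t ^ 3 * √(deriv ψ t) ^ 3)
        ≤ t ^ (1 / 8 : ℝ) * t ^ (-1 / 2 + 1 / 8 : ℝ) := by gcongr; exact h2.2
      _ = t ^ (1 / 8 + (-1 / 2 + 1 / 8) : ℝ) := by rw [← Real.rpow_add ht]
      _ ≤ e := by simpa using h3
  · filter_upwards [hskew, hskew_le,
      eventually_exp_neg_rpow_le (by norm_num : (0 : ℝ) < 1 / 8) _ he] with t h1 h2 h3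
    rw [h1]
    refine h3.trans ?_
    gcongr
    exact h2.1
  · filter_upwards [hskew, hscale, H.eventually_abs_le_skewness hpos hqm hη hq he]
      with t h1 h2 h3 x hx
    rw [h1]
    rw [h2] at hx
    exact h3 x hx

end Case2

/-- the mean of the tilted density admits the refined expansion
`m(t) = x̂ − (h''(x̂) σ̂⁴/2)(1 + o(1))`, i.e. `m(t) − ψ(t) ~ −h''(ψ(t)) σ̂⁴/2`
as `t → ∞`. -/
theorem tilted_mean_refined
    (g ψ q p Φ : ℝ → ℝ)
    (hg_pos : ∀ x > (0:ℝ), 0 < g x)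
    (hg_conv : ConvexOn ℝ (Set.Ioi 0) g)
    (hg_smooth : ContDiffOn ℝ 4 g (Set.Ioi 0))
    (hg_super : Tendsto (fun x => g x / x) atTop atTop)
    (hh_mono : ∃ x₀ : ℝ, StrictMonoOn (deriv g) (Set.Ioi x₀))
    (hh_top : Tendsto (deriv g) atTop atTop)
    (hψ_inv : ∀ᶠ t in atTop, deriv g (ψ t) = t)
    (hψ_inv' : ∀ᶠ x in atTop, ψ (deriv g x) = x)
    (hψ_top : Tendsto ψ atTop atTop)
    (hq_meas : Measurable q)
    (hq_bdd : ∃ M : ℝ, ∀ x ≥ (0:ℝ), |q x| ≤ M)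
    (hcase :
      (∃ β c θ ε, Case1 (deriv g) β c θ ε ∧
        ∃ η, η < θ - 3 * β / 2 - 3 / 2 ∧ RegVary η (fun x => |q x|)) ∨
      (∃ c ε, Case2 ψ c ε ∧
        ∃ η, η < -(1/2 : ℝ) ∧ RegVary η (fun t => |q (ψ t)|)))
    (hp : ∀ x, p x = if 0 ≤ x then Real.exp (-(g x - q x)) else 0)
    (hΦ : ∀ t, Φ t = ∫ x, Real.exp (t * x) * p x)
    (hΦ_int : ∀ t > (0:ℝ), Integrable (fun x => Real.exp (t * x) * p x)) :
    Tendsto (fun t =>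
        (deriv (fun u => Real.log (Φ u)) t - ψ t) /
          (-(iteratedDeriv 2 (deriv g) (ψ t)) *
            (Real.sqrt (1 / deriv (deriv g) (ψ t))) ^ 4 / 2))
      atTop (nhds 1) := by
  obtain ⟨M, hM⟩ := hq_bdd
  rcases hcase with ⟨β, c, θ, ε, H, η, hη, hq⟩ | ⟨c, ε, H, η, hη, hq⟩
  · exact H.tendsto_mean_ratio hg_conv hg_smooth hψ_inv hψ_top hq_meas hM hη hq hp hΦ hΦ_int
  · exact H.tendsto_mean_ratio hg_conv hg_smooth hh_mono hψ_inv hψ_top hq_meas hM hη hq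
      hp hΦ hΦ_int
end
end
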